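/- arXiv:2202.02793 — 3 statements merged into one kernel-verified Lean document; each statement's English description precedes it below -/
import Mathlib

section
/- Suppose q^8 ≠ 1 and let A_h be the quadratic algebra obtained by homogenizing the Jimbo relations, i.e., the quotient of K⟨X_{ij} : (i,j) ∈ Λ_N⟩ by the two-sided ideal generated by: X_{mn}X_{ij} − q^{−2}X_{ij}X_{mn} when i = m < j < n or i < m < j = n; X_{mn}X_{ij} − X_{ij}X_{mn} when i < m < n < j or i < j < m < n; X_{mn}X_{ij} − X_{ij}X_{mn} + (q² − q^{−2})X_{in}X_{mj} when i < m < j < n; and X_{mn}X_{ij} − q²X_{ij}X_{mn} when i < j = m < n. Then the ordered monomials of A_h, indexed by the finitely supported functions α : Λ_N → ℕ, form a K-basis of A_h. (A_h is the associated graded algebra of U_q^+(A_N) for the standard filtration.) -/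
/-- The index set Λ_N = {(i,j) : 1 ≤ i < j ≤ N+1}. -/
def Lam (N : ℕ) : Type := {p : ℕ × ℕ // 1 ≤ p.1 ∧ p.1 < p.2 ∧ p.2 ≤ N + 1}

/-- Lexicographic linear order on Λ_N: (l,k) < (i,j) iff l < i, or l = i and k < j. -/
instance (N : ℕ) : LinearOrder (Lam N) :=
  LinearOrder.lift' (fun p => toLex p.val) (fun a b h => Subtype.ext (toLex.injective h))

/-- The homogenized Jimbo relations: here `a = (i,j)` and `b = (m,n)`. -/
inductive HJimboRel (K : Type) [Field K] (q : K) (N : ℕ) :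
    FreeAlgebra K (Lam N) → FreeAlgebra K (Lam N) → Prop
  /-- C1 : i = m < j < n -/
  | c1 : ∀ a b : Lam N, a.1.1 = b.1.1 → a.1.2 < b.1.2 →
      HJimboRel K q N (FreeAlgebra.ι K b * FreeAlgebra.ι K a)
        ((q ^ 2)⁻¹ • (FreeAlgebra.ι K a * FreeAlgebra.ι K b))
  /-- C3 : i < m < j = n -/
  | c3 : ∀ a b : Lam N, a.1.1 < b.1.1 → a.1.2 = b.1.2 →
      HJimboRel K q N (FreeAlgebra.ι K b * FreeAlgebra.ι K a)
        ((q ^ 2)⁻¹ • (FreeAlgebra.ι K a * FreeAlgebra.ι K b))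
  /-- C2 : i < m < n < j -/
  | c2 : ∀ a b : Lam N, a.1.1 < b.1.1 → b.1.2 < a.1.2 →
      HJimboRel K q N (FreeAlgebra.ι K b * FreeAlgebra.ι K a)
        (FreeAlgebra.ι K a * FreeAlgebra.ι K b)
  /-- C6 : i < j < m < n -/
  | c6 : ∀ a b : Lam N, a.1.2 < b.1.1 →
      HJimboRel K q N (FreeAlgebra.ι K b * FreeAlgebra.ι K a)
        (FreeAlgebra.ι K a * FreeAlgebra.ι K b)
  /-- C4 : i < m < j < n, with c = (i,n) and d = (m,j) -/
  | c4 : ∀ a b c d : Lam N, a.1.1 < b.1.1 → b.1.1 < a.1.2 → a.1.2 < b.1.2 →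
      c.1 = (a.1.1, b.1.2) → d.1 = (b.1.1, a.1.2) →
      HJimboRel K q N (FreeAlgebra.ι K b * FreeAlgebra.ι K a)
        (FreeAlgebra.ι K a * FreeAlgebra.ι K b
          - (q ^ 2 - (q ^ 2)⁻¹) • (FreeAlgebra.ι K c * FreeAlgebra.ι K d))
  /-- C5 (homogenized) : i < j = m < n -/
  | c5 : ∀ a b : Lam N, a.1.2 = b.1.1 →
      HJimboRel K q N (FreeAlgebra.ι K b * FreeAlgebra.ι K a)
        ((q ^ 2) • (FreeAlgebra.ι K a * FreeAlgebra.ι K b))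

/-- A_h: the quadratic algebra obtained by homogenizing the Jimbo relations. -/
abbrev Ah (K : Type) [Field K] (q : K) (N : ℕ) := RingQuot (HJimboRel K q N)

/-- The image of the generator X_{ij} in A_h. -/
noncomputable def xh (K : Type) [Field K] (q : K) (N : ℕ) (p : Lam N) : Ah K q N :=
  RingQuot.mkAlgHom K (HJimboRel K q N) (FreeAlgebra.ι K p)

/-- The ordered monomial ∏ x_{ij}^{α(i,j)} in A_h, taken in <_lex-increasing order. -/
noncomputable def monH (K : Type) [Field K] (q : K) (N : ℕ) (α : Lam N →₀ ℕ) : Ah K q N :=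
  ((α.support.sort (· ≤ ·)).map (fun p => xh K q N p ^ α p)).prod

namespace QuantumMatrix

section Relations

variable {K : Type*} [Field K] {C : Type*} [LinearOrder C]

/-- The off-diagonal coefficient of the Hecke operator. -/
def swapCoeff (r : K) (a b : C) : K := if a = b then r else 1

/-- The diagonal coefficient of the Hecke operator. -/
def keepCoeff (p r : K) (a b : C) : K := if b < a then r - p else 0

lemma swapCoeff_comm (r : K) (a b : C) : swapCoeff r a b = swapCoeff r b a := by
  simp [swapCoeff, eq_comm]

variable {E : Type*} [Ring E] [Algebra K E]

/-- The quantum matrix (RTT) relations for a square matrix of operators. -/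
def IsQuantum (p r : K) (Z : Matrix C C E) : Prop :=
  ∀ i m j n, swapCoeff r i m • (Z m j * Z i n) + keepCoeff p r i m • (Z i j * Z m n) =
    swapCoeff r j n • (Z i n * Z m j) + keepCoeff p r j n • (Z i j * Z m n)

variable {p r : K} [Fintype C] {A : Matrix C C E}

lemma IsQuantum.sum_mul (hA : IsQuantum p r A) (G : C → C → E) (i m : C) :
    swapCoeff r i m • ∑ k, ∑ l, A m k * A i l * G k l +
        keepCoeff p r i m • ∑ k, ∑ l, A i k * A m l * G k l =
      ∑ k, ∑ l, A i k * A m l * (swapCoeff r k l • G l k + keepCoeff p r k l • G k l) := by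
  have h1 : ∑ k, ∑ l, swapCoeff r k l • (A i l * A m k * G k l) =
      ∑ k, ∑ l, swapCoeff r k l • (A i k * A m l * G l k) := by
    rw [Finset.sum_comm]
    simp_rw [fun k l : C => swapCoeff_comm r k l]
  calc _ = ∑ k, ∑ l, (swapCoeff r i m • (A m k * A i l) +
          keepCoeff p r i m • (A i k * A m l)) * G k l := by
        simp only [Finset.smul_sum, add_mul, Finset.sum_add_distrib, smul_mul_assoc]
    _ = ∑ k, ∑ l, swapCoeff r k l • (A i l * A m k * G k l) +
          ∑ k, ∑ l, keepCoeff p r k l • (A i k * A m l * G k l) := by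
        simp only [hA i m, add_mul, Finset.sum_add_distrib, smul_mul_assoc]
    _ = _ := by
        rw [h1]
        simp only [mul_add, Finset.sum_add_distrib, mul_smul_comm]

omit [LinearOrder C] in
lemma sum_mul_sum_of_commute {u w : C → E} (i m : C)
    (h : ∀ k l, Commute (u k) (A m l)) :
    (∑ k, A i k * u k) * (∑ l, A m l * w l) = ∑ k, ∑ l, A i k * A m l * (u k * w l) := by
  rw [Finset.sum_mul_sum]
  refine Finset.sum_congr rfl fun k _ => Finset.sum_congr rfl fun l _ => ?_
  calc _ = A i k * (u k * A m l) * w l := by noncomm_ring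
    _ = _ := by rw [(h k l).eq]; noncomm_ring

lemma IsQuantum.mul {B : Matrix C C E} (hA : IsQuantum p r A) (hB : IsQuantum p r B)
    (h : ∀ i j k l, Commute (B i j) (A k l)) : IsQuantum p r (A * B) := by
  intro i m j n
  simp only [Matrix.mul_apply]
  rw [sum_mul_sum_of_commute _ _ fun k l => h k _ _ l,
    sum_mul_sum_of_commute _ _ fun k l => h k _ _ l,
    sum_mul_sum_of_commute _ _ fun k l => h k _ _ l, hA.sum_mul]
  simp only [hB _ _ j n, mul_add, Finset.sum_add_distrib, mul_smul_comm, Finset.smul_sum]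

omit [Fintype C] in
lemma IsQuantum.one : IsQuantum p r (1 : Matrix C C E) := by
  intro i m j n
  simp only [Matrix.one_apply, swapCoeff, keepCoeff]
  by_cases h1 : m = j <;> by_cases h2 : i = n <;> by_cases h3 : i = j <;> by_cases h4 : m = n <;>
    subst_vars <;> simp_all

lemma IsQuantum.mulVec_same_row (hA : IsQuantum p r A) {e : C → E}
    (he : ∀ k l, swapCoeff r k l • (e l * e k) + keepCoeff p r k l • (e k * e l) =
      r • (e k * e l))
    (h : ∀ j k l, Commute (e j) (A k l)) {j n : C} (hjn : j < n) :
    A.mulVec e n * A.mulVec e j = r • (A.mulVec e j * A.mulVec e n) := by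
  have := hA.sum_mul (fun k l => e k * e l) j n
  simp only [he, mul_smul_comm, ← Finset.smul_sum] at this
  rw [← sum_mul_sum_of_commute _ _ fun k l => h k _ l,
    ← sum_mul_sum_of_commute _ _ fun k l => h k _ l] at this
  simp only [swapCoeff, keepCoeff, hjn.ne, hjn.not_gt, if_false, one_smul, zero_smul,
    add_zero] at this
  exact this

lemma IsQuantum.mulVec_mul_mulVec (hA : IsQuantum p r A) {e P : C → E}
    (he : ∀ l j, P l * e j = swapCoeff r l j • (e j * P l) + keepCoeff p r l j • (e l * P j))
    (h : ∀ j k l, Commute (e j) (A k l)) (hP : ∀ j k l, Commute (P j) (A k l)) (n j : C) :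
    A.mulVec P n * A.mulVec e j = swapCoeff r n j • (A.mulVec e j * A.mulVec P n) +
      keepCoeff p r n j • (A.mulVec e n * A.mulVec P j) := by
  have := hA.sum_mul (fun k l => e k * P l) n j
  simp only [← he] at this
  rw [← sum_mul_sum_of_commute _ _ fun k l => h k _ l,
    ← sum_mul_sum_of_commute _ _ fun k l => h k _ l,
    ← sum_mul_sum_of_commute _ _ fun k l => hP k _ l] at this
  exact this.symm

lemma mulVec_mul_exchange {e W : C → E}
    (hAe : ∀ n k j, A n k * e j =
      swapCoeff r n j • (e j * A n k) + keepCoeff p r n j • (e n * A j k))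
    (hW : ∀ j k, Commute (e j) (W k)) (l j : C) :
    A.mulVec W l * e j = swapCoeff r l j • (e j * A.mulVec W l) +
      keepCoeff p r l j • (e l * A.mulVec W j) := by
  simp only [Matrix.mulVec, dotProduct, Finset.sum_mul, Finset.mul_sum, Finset.smul_sum,
    ← Finset.sum_add_distrib]
  refine Finset.sum_congr rfl fun k _ => ?_
  rw [mul_assoc, ← (hW j k).eq, ← mul_assoc, hAe, add_mul, smul_mul_assoc, smul_mul_assoc,
    mul_assoc, mul_assoc]

end Relations

section Rows

variable {K : Type*} [Field K] {C : Type*} [LinearOrder C] [Fintype C]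
  {E : Type*} [Ring E] [Algebra K E] {p r : K}

/-- The ordered product of the first `m` matrices of a sequence. -/
def prefixProd (L : ℕ → Matrix C C E) : ℕ → Matrix C C E
  | 0 => 1
  | m + 1 => prefixProd L m * L m

/-- The `m`-th row of the quantum matrix built from the exchange matrices `L` and the
creation operators `e`. -/
def rowVec (L : ℕ → Matrix C C E) (e : ℕ → C → E) (m : ℕ) : C → E :=
  (prefixProd L m).mulVec (e m)

variable {L : ℕ → Matrix C C E} {e : ℕ → C → E}

omit [LinearOrder C] in
lemma commute_matrix_mul {x : E} {A B : Matrix C C E} (hA : ∀ n k, Commute x (A n k))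
    (hB : ∀ n k, Commute x (B n k)) (n k : C) : Commute x ((A * B) n k) := by
  rw [Matrix.mul_apply]
  exact Commute.sum_right _ _ _ fun l _ => (hA n l).mul_right (hB l k)

omit [LinearOrder C] in
lemma commute_mulVec {x : E} {A : Matrix C C E} {u : C → E} (hA : ∀ n k, Commute x (A n k))
    (hu : ∀ k, Commute x (u k)) (n : C) : Commute x (A.mulVec u n) :=
  Commute.sum_right _ _ _ fun l _ => (hA n l).mul_right (hu l)

omit [Fintype C] in
lemma commute_matrix_one (x : E) (n k : C) : Commute x ((1 : Matrix C C E) n k) := by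
  rw [Matrix.one_apply]
  split_ifs
  exacts [Commute.one_right x, Commute.zero_right x]

lemma commute_prefixProd {x : E} {m : ℕ} (h : ∀ i < m, ∀ n k, Commute x (L i n k)) (n k : C) :
    Commute x (prefixProd L m n k) := by
  induction m generalizing n k with
  | zero => exact commute_matrix_one x n k
  | succ m ih =>
    exact commute_matrix_mul (fun n k => ih (fun i hi => h i (by lia)) n k) (h m (by lia)) n k

lemma prefixProd_eq_of_lt {i m : ℕ} (him : i < m) :
    ∃ U : Matrix C C E, prefixProd L m = prefixProd L i * (L i * U) ∧
      ∀ x, (∀ a, i < a → ∀ n k, Commute x (L a n k)) → ∀ n k, Commute x (U n k) := by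
  induction m, him using Nat.le_induction with
  | base => exact ⟨1, by simp [prefixProd], fun x _ => commute_matrix_one x⟩
  | succ m him ih =>
    obtain ⟨U, hU, hc⟩ := ih
    exact ⟨U * L m, by simp [prefixProd, hU, Matrix.mul_assoc],
      fun x hx => commute_matrix_mul (hc x hx) (hx m him)⟩

lemma isQuantum_prefixProd (hL : ∀ i, IsQuantum p r (L i))
    (hLL : ∀ i a, i ≠ a → ∀ n k n' k', Commute (L i n k) (L a n' k')) (m : ℕ) :
    IsQuantum p r (prefixProd L m) := by
  induction m with
  | zero => exact IsQuantum.one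
  | succ m ih =>
    exact ih.mul (hL m) fun i j k l =>
      commute_prefixProd (fun a ha n k => hLL m a ha.ne' _ _ _ _) k l

theorem rowVec_same_row (hL : ∀ i, IsQuantum p r (L i))
    (hLL : ∀ i a, i ≠ a → ∀ n k n' k', Commute (L i n k) (L a n' k'))
    (heL : ∀ i a, i ≠ a → ∀ j n k, Commute (e i j) (L a n k))
    (hee : ∀ i k l, swapCoeff r k l • (e i l * e i k) + keepCoeff p r k l • (e i k * e i l) =
      r • (e i k * e i l)) (i : ℕ) {j n : C} (hjn : j < n) :
    rowVec L e i n * rowVec L e i j = r • (rowVec L e i j * rowVec L e i n) :=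
  (isQuantum_prefixProd hL hLL i).mulVec_same_row (hee i)
    (fun _ => commute_prefixProd fun a ha => heL i a ha.ne' _) hjn

theorem rowVec_mul_rowVec (hL : ∀ i, IsQuantum p r (L i))
    (hLL : ∀ i a, i ≠ a → ∀ n k n' k', Commute (L i n k) (L a n' k'))
    (heL : ∀ i a, i ≠ a → ∀ j n k, Commute (e i j) (L a n k))
    (hee : ∀ i a, i ≠ a → ∀ j n, Commute (e i j) (e a n))
    (hLe : ∀ i n k j, L i n k * e i j =
      swapCoeff r n j • (e i j * L i n k) + keepCoeff p r n j • (e i n * L i j k))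
    {i m : ℕ} (him : i < m) (n j : C) :
    rowVec L e m n * rowVec L e i j = swapCoeff r n j • (rowVec L e i j * rowVec L e m n) +
      keepCoeff p r n j • (rowVec L e i n * rowVec L e m j) := by
  obtain ⟨U, hU, hc⟩ := prefixProd_eq_of_lt (L := L) him
  have hrow : rowVec L e m = (prefixProd L i).mulVec ((L i).mulVec (U.mulVec (e m))) := by
    simp [rowVec, hU, Matrix.mulVec_mulVec]
  have hW : ∀ j k, Commute (e i j) (U.mulVec (e m) k) := fun j =>
    commute_mulVec (hc _ fun a ha => heL i a ha.ne j) (hee i m him.ne j)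
  rw [hrow]
  refine (isQuantum_prefixProd hL hLL i).mulVec_mul_mulVec (fun l j => ?_)
    (fun _ => commute_prefixProd fun a ha => heL i a ha.ne' _)
    (fun l => commute_prefixProd fun a ha n k => ?_) n j
  · exact mulVec_mul_exchange (hLe i) hW l j
  · refine (commute_mulVec (fun n' k' => hLL a i ha.ne _ _ _ _) (fun k' => ?_) l).symm
    exact commute_mulVec (hc _ fun b hb n' k' => hLL a b (by lia) _ _ _ _)
      (fun x => (heL m a (by lia) x n k).symm) k'

lemma prefixProd_eq_zero (hL : ∀ i n k, n < k → L i n k = 0) (m : ℕ) {n k : C} (h : n < k) :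
    prefixProd L m n k = 0 := by
  induction m generalizing n k with
  | zero => simp [prefixProd, h.ne]
  | succ m ih =>
    rw [prefixProd, Matrix.mul_apply]
    refine Finset.sum_eq_zero fun l _ => ?_
    rcases lt_or_ge n l with hl | hl
    · rw [ih hl, zero_mul]
    · rw [hL m l k (hl.trans_lt h), mul_zero]

end Rows

section Oscillators

variable {K : Type*} [Field K] {C : Type*} [LinearOrder C] [Fintype C]

/-- Exponent configurations: infinitely many rows indexed by `ℕ`, columns indexed by `C`. -/
abbrev Config (C : Type*) := ℕ → C → ℕ

/-- The monomial operator acting on row `i` by rescaling with `c` and transforming with `g`. -/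
noncomputable def rowOp (i : ℕ) (c : (C → ℕ) → K) (g : (C → ℕ) → C → ℕ) :
    Module.End K (Config C →₀ K) :=
  Finsupp.linearCombination K
    fun α => Finsupp.single (Function.update α i (g (α i))) (c (α i))

omit [LinearOrder C] [Fintype C] in
lemma rowOp_single (i : ℕ) (c : (C → ℕ) → K) (g : (C → ℕ) → C → ℕ) (α : Config C) (x : K) :
    rowOp i c g (Finsupp.single α x) =
      Finsupp.single (Function.update α i (g (α i))) (x * c (α i)) := by
  simp [rowOp]

omit [LinearOrder C] [Fintype C] in
lemma end_ext {f g : Module.End K (Config C →₀ K)}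
    (h : ∀ α, f (Finsupp.single α 1) = g (Finsupp.single α 1)) : f = g :=
  Finsupp.lhom_ext' fun α => LinearMap.ext_ring (h α)

omit [LinearOrder C] [Fintype C] in
lemma commute_rowOp {i a : ℕ} (hia : i ≠ a) (c c' : (C → ℕ) → K)
    (g g' : (C → ℕ) → C → ℕ) : Commute (rowOp i c g) (rowOp a c' g') := by
  refine end_ext fun α => ?_
  simp only [Module.End.mul_apply, rowOp_single, Function.update_of_ne hia,
    Function.update_of_ne hia.symm]
  rw [Function.update_comm hia, one_mul, one_mul, mul_comm]

/-- The total exponent strictly left of column `j`. -/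
def below (j : C) (ρ : C → ℕ) : ℕ := ∑ l, if l < j then ρ l else 0

/-- The total exponent strictly between columns `k` and `n`. -/
def between (k n : C) (ρ : C → ℕ) : ℕ := ∑ l, if k < l ∧ l < n then ρ l else 0

lemma below_add (j : C) (ρ σ : C → ℕ) : below j (ρ + σ) = below j ρ + below j σ := by
  simp only [below, ← Finset.sum_add_distrib]
  exact Finset.sum_congr rfl fun l _ => by split_ifs <;> simp

lemma between_add (k n : C) (ρ σ : C → ℕ) :
    between k n (ρ + σ) = between k n ρ + between k n σ := by
  simp only [between, ← Finset.sum_add_distrib]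
  exact Finset.sum_congr rfl fun l _ => by split_ifs <;> simp

lemma below_single (j k : C) : below j (Pi.single k 1) = if k < j then 1 else 0 := by
  rw [below, Finset.sum_eq_single k (fun l _ hl => by simp [hl]) (by simp)]
  simp

lemma between_single (k n l : C) :
    between k n (Pi.single l 1) = if k < l ∧ l < n then 1 else 0 := by
  rw [between, Finset.sum_eq_single l (fun x _ hx => by simp [hx]) (by simp)]
  simp

lemma below_eq {k n : C} (h : k < n) (ρ : C → ℕ) :
    below n ρ = below k ρ + ρ k + between k n ρ := by
  have hk : ρ k = ∑ l, if l = k then ρ l else 0 := by simp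
  rw [hk]
  simp only [below, between, ← Finset.sum_add_distrib]
  refine Finset.sum_congr rfl fun l _ => ?_
  rcases lt_trichotomy l k with hl | rfl | hl
  · simp [hl, hl.trans h, hl.ne, hl.not_gt]
  · simp [h]
  · simp [hl, hl.ne', hl.not_gt]

/-- Left multiplication by the generator of row `i` and column `j` on a single quantum row. -/
noncomputable def create (r : K) (i : ℕ) (j : C) : Module.End K (Config C →₀ K) :=
  rowOp i (fun ρ => r ^ below j ρ) fun ρ => ρ + Pi.single j 1

/-- The exchange matrix of row `i`: how a column index changes when a generator of a lower row
is moved past row `i`. -/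
noncomputable def exchange (p r : K) (i : ℕ) : Matrix C C (Module.End K (Config C →₀ K)) :=
  fun n k =>
    if k = n then rowOp i (fun ρ => r ^ ρ n) id
    else if k < n then
      rowOp i (fun ρ => -p * (1 - r ^ (2 * ρ k)) * r ^ between k n ρ)
        fun ρ => ρ - Pi.single k 1 + Pi.single n 1
    else 0

lemma exchange_eq_zero (p r : K) (i : ℕ) {n k : C} (h : n < k) : exchange p r i n k = 0 := by
  simp [exchange, h.ne', h.not_gt]

lemma exchange_self (p r : K) (i : ℕ) (n : C) (α : Config C) (x : K) :
    exchange p r i n n (Finsupp.single α x) = Finsupp.single α (x * r ^ α i n) := by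
  simp [exchange, rowOp_single]

lemma exchange_of_lt (p r : K) (i : ℕ) {n k : C} (h : k < n) (α : Config C) (x : K) :
    exchange p r i n k (Finsupp.single α x) =
      Finsupp.single (Function.update α i (α i - Pi.single k 1 + Pi.single n 1))
        (x * (-p * (1 - r ^ (2 * α i k)) * r ^ between k n (α i))) := by
  simp [exchange, rowOp_single, h, h.ne]

lemma create_single (r : K) (i : ℕ) (j : C) (α : Config C) (x : K) :
    create r i j (Finsupp.single α x) =
      Finsupp.single (Function.update α i (α i + Pi.single j 1)) (x * r ^ below j (α i)) :=
  rowOp_single _ _ _ _ _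

lemma create_create {p r : K} (hpr : p * r = 1) (i : ℕ) (k l : C) :
    swapCoeff r k l • (create r i l * create r i k) +
      keepCoeff p r k l • (create r i k * create r i l) = r • (create r i k * create r i l) := by
  refine end_ext fun α => ?_
  simp only [LinearMap.add_apply, LinearMap.smul_apply, Module.End.mul_apply, create_single,
    Function.update_self, Function.update_idem, below_add, below_single, swapCoeff, keepCoeff,
    add_right_comm _ (Pi.single k 1) (Pi.single l 1), Finsupp.smul_single, ← Finsupp.single_add]
  congr 1
  rcases lt_trichotomy k l with h | rfl | h
  · simp [h, h.ne, h.not_gt, pow_succ]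
    ring
  · simp
  · simp [h, h.ne', h.not_gt, pow_succ]
    linear_combination (-r ^ below l (α i) * r ^ below k (α i)) * hpr

lemma exchange_create {p r : K} (hpr : p * r = 1) (i : ℕ) (n k j : C) :
    exchange p r i n k * create r i j = swapCoeff r n j • (create r i j * exchange p r i n k) +
      keepCoeff p r n j • (create r i n * exchange p r i j k) := by
  rcases lt_trichotomy n k with hnk | rfl | hkn
  · rw [exchange_eq_zero p r i hnk]
    rcases lt_or_ge j n with hj | hj
    · simp [exchange_eq_zero p r i (hj.trans hnk)]
    · simp [keepCoeff, hj.not_gt]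
  · refine end_ext fun α => ?_
    rcases lt_trichotomy j n with hj | rfl | hj
    · simp [exchange_self, create_single, exchange_eq_zero p r i hj, swapCoeff, hj.ne', mul_comm]
    · simp only [LinearMap.smul_apply, Module.End.mul_apply, create_single,
        exchange_self, Function.update_self, swapCoeff, keepCoeff, if_true, lt_irrefl, if_false,
        zero_smul, add_zero, Finsupp.smul_single, smul_eq_mul, Pi.add_apply, Pi.single_eq_same]
      congr 1
      ring
    · simp [exchange_self, create_single, swapCoeff, keepCoeff, hj.ne, hj.not_gt, mul_comm]
  · refine end_ext fun α => ?_
    by_cases h0 : α i k = 0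
    · rcases eq_or_ne j k with rfl | hjk
      · simp [exchange_of_lt p r i hkn, exchange_self, h0, create_single, swapCoeff, keepCoeff,
          hkn, hkn.ne', between_add, between_single, -Finsupp.single_mul, below_eq hkn,
          -Finsupp.single_neg]
        congr 1
        linear_combination (r * r ^ below j (α i) * r ^ between j n (α i)) * hpr
      · have hz : ∀ m, exchange p r i m k (Finsupp.single α 1) = 0 ∨ m = k := fun m => by
          rcases lt_trichotomy k m with hm | rfl | hm
          · simp [exchange_of_lt p r i hm, h0]
          · simp
          · simp [exchange_eq_zero p r i hm]
        simp [(hz j).resolve_right hjk, (hz n).resolve_right hkn.ne', create_single,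
          exchange_of_lt p r i hkn, h0, hjk.symm]
    · obtain ⟨ρ, hρ⟩ : ∃ ρ, α i = ρ + Pi.single k 1 := ⟨α i - Pi.single k 1, by
        ext l
        by_cases hl : l = k
        · subst hl; simp; lia
        · simp [hl]⟩
      have hc : ρ + Pi.single k 1 + Pi.single j 1 - Pi.single k 1 = ρ + Pi.single j 1 := by
        rw [add_right_comm, add_tsub_cancel_right]
      rcases lt_trichotomy j k with hj | rfl | hj
      · simp only [LinearMap.add_apply, LinearMap.smul_apply, Module.End.mul_apply, create_single,
          exchange_of_lt p r i hkn, exchange_eq_zero p r i hj, Function.update_self,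
          Function.update_idem, swapCoeff, hρ, hc, add_tsub_cancel_right, LinearMap.zero_apply,
          map_zero, smul_zero, add_zero, (hj.trans hkn).ne', if_false, one_smul,
          add_right_comm _ (Pi.single j 1) (Pi.single n 1)]
        congr 1
        simp [below_add, between_add, below_single, between_single, hj.not_gt, hj.ne',
          (hj.trans hkn).not_gt]
        ring
      · simp only [LinearMap.add_apply, LinearMap.smul_apply, Module.End.mul_apply, create_single,
          exchange_of_lt p r i hkn, exchange_self, Function.update_self, hkn, hkn.ne', if_true,
          if_false, one_smul,
          Function.update_idem, swapCoeff, keepCoeff, hρ, hc, add_tsub_cancel_right,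
          Finsupp.smul_single, add_right_comm _ (Pi.single j 1) (Pi.single n 1),
          ← Finsupp.single_add]
        congr 1
        simp [below_add, between_add, below_single, between_single, hkn, hkn.not_gt, below_eq hkn]
        linear_combination
          (r ^ 3 * r ^ (2 * ρ j) * r ^ below j ρ * r ^ between j n ρ) * hpr
      · simp only [LinearMap.add_apply, LinearMap.smul_apply, Module.End.mul_apply, create_single,
          exchange_of_lt p r i hkn, exchange_of_lt p r i hj, Function.update_self,
          Function.update_idem, swapCoeff, keepCoeff, hρ, hc, add_tsub_cancel_right,
          Finsupp.smul_single, add_right_comm _ (Pi.single j 1) (Pi.single n 1),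
          ← Finsupp.single_add]
        congr 1
        rcases lt_trichotomy j n with h | rfl | h
        · simp [below_add, between_add, below_single, between_single, h, h.ne', hj, hj.ne, hkn,
            h.not_gt, below_eq hkn, below_eq hj, hkn.not_gt, hkn.ne, hj.not_gt]
          linear_combination (-p * (1 - r ^ (2 * (ρ k + 1))) * r ^ between k n ρ *
            r ^ (below k ρ + ρ k + between k j ρ)) * hpr
        · simp [below_add, between_add, below_single, between_single, hj, hj.ne]
          ring
        · simp [below_add, between_add, below_single, between_single, h, h.ne, hj, hj.ne, hkn,
            h.not_gt]
          ring

/-- The result of moving two operators with row indices `n` and `n'` past a creation operator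
with index `j`, as a formal combination of three-index symbols. -/
def pushThrough {V : Type*} [AddCommGroup V] [Module K V] (p r : K) (G : C → C → C → V)
    (n n' j : C) : V :=
  swapCoeff r n' j • (swapCoeff r n j • G j n n' + keepCoeff p r n j • G n j n') +
    keepCoeff p r n' j • (swapCoeff r n n' • G n' n j + keepCoeff p r n n' • G n n' j)

omit [Fintype C] in
/-- The braid relation for the Hecke operator. -/
lemma pushThrough_braid {V : Type*} [AddCommGroup V] [Module K V] {p r : K} (hpr : p * r = 1)
    (G : C → C → C → V) (n n' j : C) :
    swapCoeff r n n' • pushThrough p r G n' n j + keepCoeff p r n n' • pushThrough p r G n n' j =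
      pushThrough p r (fun x a b => swapCoeff r a b • G x b a + keepCoeff p r a b • G x a b)
        n n' j := by
  have hp : p = r⁻¹ := eq_inv_of_mul_eq_one_left hpr
  have hr : r ≠ 0 := right_ne_zero_of_mul_eq_one hpr
  subst hp
  rcases lt_trichotomy n n' with h1 | h1 | h1 <;> rcases lt_trichotomy n j with h2 | h2 | h2 <;>
    rcases lt_trichotomy n' j with h3 | h3 | h3
  all_goals first
    | (exfalso; order)
    | subst_vars
      simp [pushThrough, swapCoeff, keepCoeff, *, ne_of_gt, ne_of_lt, not_lt_of_gt]
      try match_scalars <;> field_simp <;> ring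

omit [Fintype C] in
/-- If the quantum matrix relations for the exchange matrix hold on a vector, they also hold on
its image under a creation operator. -/
lemma quantum_apply_create {V : Type*} [AddCommGroup V] [Module K V] {p r : K} (hpr : p * r = 1)
    {L : C → C → Module.End K V} {e : C → Module.End K V}
    (hLe : ∀ n k j, L n k * e j =
      swapCoeff r n j • (e j * L n k) + keepCoeff p r n j • (e n * L j k)) {k k' : C} {v : V}
    (hv : ∀ n n', swapCoeff r n n' • L n' k (L n k' v) + keepCoeff p r n n' • L n k (L n' k' v) =
      swapCoeff r k k' • L n k' (L n' k v) + keepCoeff p r k k' • L n k (L n' k' v))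
    (j n n' : C) :
    swapCoeff r n n' • L n' k (L n k' (e j v)) +
        keepCoeff p r n n' • L n k (L n' k' (e j v)) =
      swapCoeff r k k' • L n k' (L n' k (e j v)) +
        keepCoeff p r k k' • L n k (L n' k' (e j v)) := by
  have hx : ∀ n k j v, L n k (e j v) =
      swapCoeff r n j • e j (L n k v) + keepCoeff p r n j • e n (L j k v) := fun n k j v =>
    LinearMap.congr_fun (hLe n k j) v
  have hA : ∀ k k' n n', L n k (L n' k' (e j v)) =
      pushThrough p r (fun x a b => e x (L a k (L b k' v))) n n' j := fun k k' n n' => by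
    simp only [hx, map_add, map_smul, pushThrough]
  rw [hA, hA, hA, pushThrough_braid hpr]
  have hG : (fun x a b => swapCoeff r a b • e x (L b k (L a k' v)) +
      keepCoeff p r a b • e x (L a k (L b k' v))) = fun x a b =>
      swapCoeff r k k' • e x (L a k' (L b k v)) + keepCoeff p r k k' • e x (L a k (L b k' v)) := by
    funext x a b
    simpa only [map_add, map_smul] using congrArg (e x) (hv a b)
  rw [hG]
  simp only [pushThrough]
  module

lemma isQuantum_exchange {p r : K} (hpr : p * r = 1) (i : ℕ) :
    IsQuantum p r (exchange (C := C) p r i) := by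
  intro n n' k k'
  refine end_ext fun α => ?_
  simp only [LinearMap.add_apply, LinearMap.smul_apply, Module.End.mul_apply]
  induction hd : ∑ l, α i l generalizing α n n' with
  | zero =>
    have h0 : ∀ l, α i l = 0 := by simpa using hd
    have hL : ∀ n k, exchange p r i n k (Finsupp.single α 1) =
        (1 : Matrix C C K) n k • Finsupp.single α 1 := fun n k => by
      rcases lt_trichotomy n k with h | rfl | h
      · simp [exchange_eq_zero p r i h, Matrix.one_apply_ne h.ne]
      · simp [exchange_self, h0]
      · simp [exchange_of_lt p r i h, h0, Matrix.one_apply_ne h.ne']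
    have := IsQuantum.one (p := p) (r := r) (E := K) n n' k k'
    simp only [hL, map_smul, smul_smul, ← add_smul]
    congr 1
    simp only [smul_eq_mul] at this
    linear_combination this
  | succ d ih =>
    obtain ⟨j, hj⟩ : ∃ j, α i j ≠ 0 := by
      by_contra! h
      simp [h] at hd
    have hr : r ≠ 0 := right_ne_zero_of_mul_eq_one hpr
    set β : Config C := Function.update α i (α i - Pi.single j 1) with hβ
    have hρ : α i - Pi.single j 1 + Pi.single j 1 = α i := by
      ext l
      by_cases hl : l = j
      · subst hl; simp; lia
      · simp [hl]
    have hα : Finsupp.single α 1 =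
        create r i j ((r ^ below j (β i))⁻¹ • Finsupp.single β (1 : K)) := by
      rw [map_smul, create_single, Finsupp.smul_single]
      simp [hβ, hρ, hr]
    have hβd : ∑ l, β i l = d := by
      have : ∑ l, α i l = ∑ l, β i l + 1 := by
        rw [← hρ]
        simp [hβ, Finset.sum_add_distrib]
      lia
    rw [hα]
    refine quantum_apply_create hpr (exchange_create hpr i) (fun n n' => ?_) j n n'
    simp only [map_smul, smul_comm _ (r ^ below j (β i))⁻¹, ← smul_add]
    rw [ih n n' β hβd]

/-- The exchange matrix of row `i` when its columns up to the `i`-th are discarded. -/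
noncomputable def strictExchange {M : ℕ} (p r : K) (i : ℕ) :
    Matrix (Fin M) (Fin M) (Module.End K (Config (Fin M) →₀ K)) :=
  fun n k => if i < k then exchange p r i n k else 0

/-- The creation operators of row `i` when its columns up to the `i`-th are discarded. -/
noncomputable def strictCreate {M : ℕ} (r : K) (i : ℕ) (j : Fin M) :
    Module.End K (Config (Fin M) →₀ K) :=
  if i < j then create r i j else 0

variable {M : ℕ}

lemma strictExchange_eq_zero (p r : K) (i : ℕ) {n k : Fin M} (h : n < k) :
    strictExchange p r i n k = 0 := by
  simp [strictExchange, exchange_eq_zero p r i h]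

lemma isQuantum_strictExchange {p r : K} (hpr : p * r = 1) (i : ℕ) :
    IsQuantum p r (strictExchange (M := M) p r i) := by
  intro n n' k k'
  simp only [strictExchange]
  split_ifs
  · exact isQuantum_exchange hpr i n n' k k'
  all_goals simp

lemma strictExchange_strictCreate {p r : K} (hpr : p * r = 1) (i : ℕ) (n k j : Fin M) :
    strictExchange p r i n k * strictCreate r i j =
      swapCoeff r n j • (strictCreate r i j * strictExchange p r i n k) +
        keepCoeff p r n j • (strictCreate r i n * strictExchange p r i j k) := by
  by_cases hk : i < k
  · by_cases hj : i < j
    · by_cases hn : i < n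
      · simpa [strictExchange, strictCreate, hk, hj, hn] using exchange_create hpr i n k j
      · have hnk : n < k := by lia
        have hnj : n < j := by lia
        simp [strictExchange_eq_zero p r i hnk, keepCoeff, hnj.not_gt]
    · have hjk : j < k := by lia
      simp [strictCreate, hj, strictExchange_eq_zero p r i hjk]
  · simp [strictExchange, hk]

lemma strictCreate_strictCreate {p r : K} (hpr : p * r = 1) (i : ℕ) (k l : Fin M) :
    swapCoeff r k l • (strictCreate r i l * strictCreate r i k) +
      keepCoeff p r k l • (strictCreate r i k * strictCreate r i l) =
        r • (strictCreate r i k * strictCreate r i l) := by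
  simp only [strictCreate]
  split_ifs
  · exact create_create hpr i k l
  all_goals simp

lemma exists_exchange_eq (p r : K) (n k : C) : ∃ c g, ∀ i, exchange p r i n k = rowOp i c g := by
  rcases lt_trichotomy n k with h | rfl | h
  · refine ⟨0, id, fun i => end_ext fun α => ?_⟩
    simp [exchange_eq_zero p r i h, rowOp_single]
  · exact ⟨_, _, fun i => by simp only [exchange, if_true]; rfl⟩
  · exact ⟨_, _, fun i => by simp only [exchange, h, h.ne, if_true, if_false]; rfl⟩

lemma commute_exchange (p r : K) {i a : ℕ} (hia : i ≠ a) (n k n' k' : C) :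
    Commute (exchange p r i n k) (exchange p r a n' k') := by
  obtain ⟨c, g, h⟩ := exists_exchange_eq p r n k
  obtain ⟨c', g', h'⟩ := exists_exchange_eq p r n' k'
  rw [h, h']
  exact commute_rowOp hia _ _ _ _

lemma commute_create_exchange (p r : K) {i a : ℕ} (hia : i ≠ a) (j n k : C) :
    Commute (create r i j) (exchange p r a n k) := by
  obtain ⟨c, g, h⟩ := exists_exchange_eq p r n k
  rw [h]
  exact commute_rowOp hia _ _ _ _

lemma commute_strictExchange (p r : K) (i a : ℕ) (hia : i ≠ a) (n k n' k' : Fin M) :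
    Commute (strictExchange p r i n k) (strictExchange p r a n' k') := by
  simp only [strictExchange]
  split_ifs
  exacts [commute_exchange p r hia _ _ _ _, .zero_right _, .zero_left _, .zero_left _]

lemma commute_strictCreate_strictExchange (p r : K) (i a : ℕ) (hia : i ≠ a) (j n k : Fin M) :
    Commute (strictCreate r i j) (strictExchange p r a n k) := by
  simp only [strictCreate, strictExchange]
  split_ifs
  exacts [commute_create_exchange p r hia _ _ _, .zero_right _, .zero_left _, .zero_left _]

lemma commute_strictCreate (r : K) (i a : ℕ) (hia : i ≠ a) (j n : Fin M) :
    Commute (strictCreate r i j) (strictCreate r a n) := by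
  simp only [strictCreate]
  split_ifs
  exacts [commute_rowOp hia _ _ _ _, .zero_right _, .zero_left _, .zero_left _]

/-- The entries of a strictly upper triangular quantum matrix, acting on configurations. -/
noncomputable def entry (p r : K) (m : ℕ) (n : Fin M) : Module.End K (Config (Fin M) →₀ K) :=
  rowVec (strictExchange p r) (strictCreate r) m n

lemma entry_same_row {p r : K} (hpr : p * r = 1) (i : ℕ) {j n : Fin M} (hjn : j < n) :
    entry p r i n * entry p r i j = r • (entry p r i j * entry p r i n) :=
  rowVec_same_row (isQuantum_strictExchange hpr) (commute_strictExchange p r)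
    (commute_strictCreate_strictExchange p r) (strictCreate_strictCreate hpr) i hjn

lemma entry_mul_entry {p r : K} (hpr : p * r = 1) {i m : ℕ} (him : i < m) (n j : Fin M) :
    entry p r m n * entry p r i j = swapCoeff r n j • (entry p r i j * entry p r m n) +
      keepCoeff p r n j • (entry p r i n * entry p r m j) :=
  rowVec_mul_rowVec (isQuantum_strictExchange hpr) (commute_strictExchange p r)
    (commute_strictCreate_strictExchange p r) (commute_strictCreate r)
    (strictExchange_strictCreate hpr) him n j

lemma entry_eq_zero (p r : K) {m : ℕ} {j : Fin M} (h : j ≤ m) : entry p r m j = 0 := by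
  rw [entry, rowVec, Matrix.mulVec, dotProduct]
  refine Finset.sum_eq_zero fun k _ => ?_
  rcases lt_or_ge j k with hk | hk
  · rw [prefixProd_eq_zero (fun i n k => strictExchange_eq_zero p r i) m hk, zero_mul]
  · have : ¬ m < k := by lia
    simp [strictCreate, this]

/-- The total exponent of column `m` in the rows below `M`. -/
def colWeight (m : Fin M) (α : Config (Fin M)) : ℕ := ∑ i ∈ Finset.range M, α i m

lemma colWeight_update {i : ℕ} (hi : i < M) (m : Fin M) (α : Config (Fin M)) (ρ : Fin M → ℕ) :
    colWeight m (Function.update α i ρ) + α i m = colWeight m α + ρ m := by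
  have hi' : i ∈ Finset.range M := Finset.mem_range.2 hi
  have h : ∑ a ∈ (Finset.range M).erase i, Function.update α i ρ a m =
      ∑ a ∈ (Finset.range M).erase i, α a m :=
    Finset.sum_congr rfl fun a ha => by rw [Function.update_of_ne (Finset.ne_of_mem_erase ha)]
  rw [colWeight, colWeight, ← Finset.add_sum_erase _ _ hi', ← Finset.add_sum_erase _ _ hi', h,
    Function.update_self]
  ring

/-- The diagonal operator scaling by `p` to the exponent of column `m`. -/
noncomputable def colScale (p : K) (m : Fin M) : Module.End K (Config (Fin M) →₀ K) :=
  Finsupp.linearCombination K fun α => Finsupp.single α (p ^ colWeight m α)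

lemma colScale_single (p : K) (m : Fin M) (α : Config (Fin M)) (x : K) :
    colScale p m (Finsupp.single α x) = Finsupp.single α (x * p ^ colWeight m α) := by
  simp [colScale]

lemma colScale_commute (p : K) (m n : Fin M) : Commute (colScale p m) (colScale p n) := by
  refine end_ext fun α => ?_
  simp only [Module.End.mul_apply, colScale_single]
  ring_nf

/-- The scalar by which `colScale p m` commutes past an operator raising column `n`. -/
def colFactor (p : K) (n m : Fin M) : K := if n = m then p else 1

lemma colFactor_ne_zero {p : K} (hp : p ≠ 0) (n m : Fin M) : colFactor p n m ≠ 0 := by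
  rw [colFactor]
  split_ifs <;> simp [hp]

lemma pow_single (p : K) (n m : Fin M) :
    p ^ (Pi.single n 1 : Fin M → ℕ) m = colFactor p n m := by
  by_cases h : n = m
  · subst h; simp [colFactor]
  · simp [colFactor, h]

lemma colScale_strictCreate (p r : K) {i : ℕ} (hi : i < M) (m n : Fin M) :
    colScale p m * strictCreate r i n =
      colFactor p n m • (strictCreate r i n * colScale p m) := by
  rw [strictCreate]
  split_ifs
  swap
  · simp
  refine end_ext fun α => ?_
  have h := colWeight_update hi m α (α i + Pi.single n 1)
  have h' : colWeight m (Function.update α i (α i + Pi.single n 1)) =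
      colWeight m α + (Pi.single n 1 : Fin M → ℕ) m := by
    rw [Pi.add_apply] at h; lia
  simp only [LinearMap.smul_apply, Module.End.mul_apply, create_single, colScale_single,
    Finsupp.smul_single, h', pow_add, pow_single, smul_eq_mul]
  congr 1
  ring

lemma colScale_strictExchange {p : K} (hp : p ≠ 0) (p' r : K) {i : ℕ} (hi : i < M)
    (m n k : Fin M) :
    colScale p m * strictExchange p' r i n k =
      (colFactor p n m * (colFactor p k m)⁻¹) • (strictExchange p' r i n k * colScale p m) := by
  rw [strictExchange]
  split_ifs
  swap
  · simp
  refine end_ext fun α => ?_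
  simp only [LinearMap.smul_apply, Module.End.mul_apply]
  rcases lt_trichotomy n k with hnk | rfl | hkn
  · simp [exchange_eq_zero p' r i hnk]
  · simp [exchange_self, colScale_single, colFactor_ne_zero hp, -Finsupp.single_mul, mul_comm]
  by_cases h0 : α i k = 0
  · simp [exchange_of_lt p' r i hkn, colScale_single, h0]
  have h := colWeight_update hi m α (α i - Pi.single k 1 + Pi.single n 1)
  have h' : colWeight m (Function.update α i (α i - Pi.single k 1 + Pi.single n 1)) +
      (Pi.single k 1 : Fin M → ℕ) m = colWeight m α + (Pi.single n 1 : Fin M → ℕ) m := by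
    have hle : (Pi.single k 1 : Fin M → ℕ) m ≤ α i m := by
      by_cases hkm : m = k
      · subst hkm; simp; lia
      · simp [hkm]
    simp only [Pi.add_apply, Pi.sub_apply] at h
    lia
  have hpow := congrArg (p ^ ·) h'
  simp only [pow_add, pow_single] at hpow
  rw [← eq_mul_inv_iff_mul_eq₀ (colFactor_ne_zero hp k m)] at hpow
  simp only [exchange_of_lt p' r i hkn, colScale_single, Finsupp.smul_single, hpow, smul_eq_mul]
  congr 1
  ring

lemma colScale_prefixProd {p : K} (hp : p ≠ 0) (p' r : K) {a : ℕ} (ha : a ≤ M)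
    (m n k : Fin M) :
    colScale p m * prefixProd (strictExchange p' r) a n k =
      (colFactor p n m * (colFactor p k m)⁻¹) •
        (prefixProd (strictExchange p' r) a n k * colScale p m) := by
  induction a generalizing k with
  | zero =>
    rcases eq_or_ne n k with rfl | h
    · simp [prefixProd, colFactor_ne_zero hp]
    · simp [prefixProd, h]
  | succ a ih =>
    simp only [prefixProd, Matrix.mul_apply, Finset.mul_sum, Finset.sum_mul, Finset.smul_sum]
    refine Finset.sum_congr rfl fun l _ => ?_
    rw [← mul_assoc, ih (by lia), smul_mul_assoc, mul_assoc,
      colScale_strictExchange hp p' r (by lia), mul_smul_comm, smul_smul, mul_assoc]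
    congr 1
    have := colFactor_ne_zero hp l m
    field_simp

lemma colScale_entry {p : K} (hp : p ≠ 0) (p' r : K) {i : ℕ} (hi : i < M) (m n : Fin M) :
    colScale p m * entry p' r i n = colFactor p n m • (entry p' r i n * colScale p m) := by
  simp only [entry, rowVec, Matrix.mulVec, dotProduct, Finset.mul_sum, Finset.sum_mul,
    Finset.smul_sum]
  refine Finset.sum_congr rfl fun l _ => ?_
  rw [← mul_assoc, colScale_prefixProd hp p' r hi.le, smul_mul_assoc, mul_assoc,
    colScale_strictCreate p r hi, mul_smul_comm, smul_smul, mul_assoc]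
  congr 1
  have := colFactor_ne_zero hp l m
  field_simp

lemma prefixProd_single (p r : K) {m : ℕ} {α : Config (Fin M)} (hα : ∀ i < m, α i = 0)
    {n : Fin M} (hn : m ≤ n) (k : Fin M) :
    prefixProd (strictExchange p r) m n k (Finsupp.single α 1) =
      (1 : Matrix (Fin M) (Fin M) K) n k • Finsupp.single α 1 := by
  induction m generalizing k with
  | zero => by_cases h : n = k <;> simp [prefixProd, Matrix.one_apply, h]
  | succ m ih =>
    have hL : ∀ l, strictExchange p r m l k (Finsupp.single α 1) =
        if l = k ∧ m < k then Finsupp.single α 1 else 0 := fun l => by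
      have h0 : α m = 0 := hα m (by lia)
      by_cases hk : m < k
      · rcases lt_trichotomy l k with h | rfl | h
        · simp [strictExchange_eq_zero p r m h, h.ne]
        · simp [strictExchange, hk, exchange_self, h0]
        · simp [strictExchange, hk, exchange_of_lt p r m h, h0, h.ne']
      · simp [strictExchange, hk]
    simp only [prefixProd, Matrix.mul_apply, LinearMap.sum_apply, Module.End.mul_apply, hL]
    rw [Finset.sum_eq_single k (fun l _ hl => by simp [hl]) (by simp)]
    by_cases hk : m < k
    · simp only [hk, and_self, if_true]
      exact ih (fun i hi => hα i (by lia)) (by lia) k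
    · have : n ≠ k := by rintro rfl; lia
      simp [hk, this]

lemma entry_single (p r : K) {m : ℕ} {n : Fin M} (hmn : m < n) {α : Config (Fin M)}
    (hα : ∀ i < m, α i = 0) (hαm : ∀ l < n, α m l = 0) :
    entry p r m n (Finsupp.single α 1) =
      Finsupp.single (Function.update α m (α m + Pi.single n 1)) 1 := by
  have hT : ∀ k, prefixProd (strictExchange p r) m n k (strictCreate r m k (Finsupp.single α 1)) =
      if n = k then strictCreate r m k (Finsupp.single α 1) else 0 := fun k => by
    by_cases hk : m < k
    · simp only [strictCreate, hk, if_true, create_single, one_mul]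
      rw [← mul_one (r ^ _), ← smul_eq_mul, ← Finsupp.smul_single, map_smul,
        prefixProd_single p r (fun i hi => by simp [Function.update_of_ne hi.ne, hα i hi]) hmn.le,
        Matrix.one_apply]
      split_ifs <;> simp
    · simp [strictCreate, hk]
  have hb : below n (α m) = 0 :=
    Finset.sum_eq_zero fun l _ => by
      split_ifs with h
      exacts [hαm l h, rfl]
  simp only [entry, rowVec, Matrix.mulVec, dotProduct, LinearMap.sum_apply, Module.End.mul_apply,
    hT]
  simp [strictCreate, hmn, create_single, hb]

end Oscillators

section Jimbo

variable {N : ℕ}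

/-- The row of a generator. -/
def rowIdx (a : Lam N) : Fin (N + 2) := ⟨a.1.1, by have := a.2; lia⟩

/-- The column of a generator. -/
def colIdx (a : Lam N) : Fin (N + 2) := ⟨a.1.2, by have := a.2; lia⟩

lemma rowIdx_lt_colIdx (a : Lam N) : a.1.1 < colIdx a := a.2.2.1

variable {K : Type} [Field K]

/-- The operator by which a generator acts: a quantum matrix entry twisted by a column scaling. -/
noncomputable def gen (p r : K) (a : Lam N) : Module.End K (Config (Fin (N + 2)) →₀ K) :=
  entry p r a.1.1 (colIdx a) * colScale p (rowIdx a)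

lemma gen_mul_gen {p : K} (hp : p ≠ 0) (r : K) (a b : Lam N) :
    gen p r a * gen p r b = colFactor p (colIdx b) (rowIdx a) •
      (entry p r a.1.1 (colIdx a) * entry p r b.1.1 (colIdx b) *
        (colScale p (rowIdx a) * colScale p (rowIdx b))) := by
  have hb : b.1.1 < N + 2 := (rowIdx b).2
  rw [gen, gen, mul_assoc, ← mul_assoc (colScale p _), colScale_entry hp p r hb]
  simp only [smul_mul_assoc, mul_smul_comm, mul_assoc]

lemma gen_mul_gen_of_le {p : K} (hp : p ≠ 0) (r : K) {a b : Lam N} (h : a.1.1 ≤ b.1.1) :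
    gen p r a * gen p r b = entry p r a.1.1 (colIdx a) * entry p r b.1.1 (colIdx b) *
      (colScale p (rowIdx a) * colScale p (rowIdx b)) := by
  have hne : colIdx b ≠ rowIdx a := by
    have := b.2
    simp only [colIdx, rowIdx, ne_eq, Fin.mk.injEq]
    lia
  rw [gen_mul_gen hp, colFactor, if_neg hne, one_smul]

lemma add_sub_smul_eq_sub_sub_smul {R M : Type*} [Ring R] [AddCommGroup M] [Module R M]
    (s t : R) (x y : M) : x + (s - t) • y = x - (t - s) • y := by
  rw [← neg_sub t s, neg_smul, ← sub_eq_add_neg]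

lemma lift_gen_eq {q : K} (hq : q ≠ 0) {x y : FreeAlgebra K (Lam N)} (h : HJimboRel K q N x y) :
    FreeAlgebra.lift K (gen (q ^ 2) (q ^ 2)⁻¹) x =
      FreeAlgebra.lift K (gen (q ^ 2) (q ^ 2)⁻¹) y := by
  have hp : q ^ 2 ≠ 0 := pow_ne_zero 2 hq
  have hpr : q ^ 2 * (q ^ 2)⁻¹ = 1 := mul_inv_cancel₀ hp
  induction h with
  | c1 a b hrow hcol =>
    have hcol' : colIdx a < colIdx b := hcol
    have hr : rowIdx b = rowIdx a := Fin.ext hrow.symm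
    simp only [map_mul, map_smul, FreeAlgebra.lift_ι_apply]
    rw [gen_mul_gen_of_le hp _ hrow.le, gen_mul_gen_of_le hp _ hrow.ge, ← hrow,
      entry_same_row hpr _ hcol', hr, smul_mul_assoc]
  | c3 a b hrow hcol =>
    have hcol' : colIdx a = colIdx b := Fin.ext hcol
    have hne : colIdx b ≠ rowIdx b := fun h => (rowIdx_lt_colIdx b).ne (congrArg Fin.val h).symm
    simp only [map_mul, map_smul, FreeAlgebra.lift_ι_apply]
    rw [gen_mul_gen_of_le hp _ hrow.le, gen_mul_gen hp, hcol', colFactor, if_neg hne, one_smul,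
      entry_mul_entry hpr hrow, (colScale_commute _ (rowIdx b) (rowIdx a)).eq]
    simp [swapCoeff, keepCoeff]
  | c2 a b hrow hcol =>
    have hcol' : colIdx b < colIdx a := hcol
    have hne : colIdx a ≠ rowIdx b := fun h => by
      have := congrArg Fin.val h
      have := rowIdx_lt_colIdx b
      simp only [colIdx, rowIdx] at *
      lia
    simp only [map_mul, FreeAlgebra.lift_ι_apply]
    rw [gen_mul_gen_of_le hp _ hrow.le, gen_mul_gen hp, colFactor, if_neg hne, one_smul,
      entry_mul_entry hpr hrow, (colScale_commute _ (rowIdx b) (rowIdx a)).eq]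
    simp [swapCoeff, keepCoeff, hcol'.ne, hcol'.not_gt]
  | c6 a b hab =>
    have hrow : a.1.1 < b.1.1 := (rowIdx_lt_colIdx a).trans hab
    have hcol : colIdx a < colIdx b := hab.trans (rowIdx_lt_colIdx b)
    have hne : colIdx a ≠ rowIdx b := fun h => hab.ne (congrArg Fin.val h)
    simp only [map_mul, FreeAlgebra.lift_ι_apply]
    rw [gen_mul_gen_of_le hp _ hrow.le, gen_mul_gen hp, colFactor, if_neg hne, one_smul,
      entry_mul_entry hpr hrow, entry_eq_zero (j := colIdx a) _ _ hab.le,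
      (colScale_commute _ (rowIdx b) (rowIdx a)).eq]
    simp [swapCoeff, hcol.ne']
  | c4 a b c d hrow hba hcol hc hd =>
    have hcol' : colIdx a < colIdx b := hcol
    have hne : colIdx a ≠ rowIdx b := fun h => hba.ne' (congrArg Fin.val h)
    have hc1' : c.1.1 = a.1.1 := by rw [hc]
    have hd1' : d.1.1 = b.1.1 := by rw [hd]
    have hc1 : rowIdx c = rowIdx a := Fin.ext hc1'
    have hc2 : colIdx c = colIdx b := Fin.ext (show c.1.2 = b.1.2 by rw [hc])
    have hd1 : rowIdx d = rowIdx b := Fin.ext hd1'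
    have hd2 : colIdx d = colIdx a := Fin.ext (show d.1.2 = a.1.2 by rw [hd])
    simp only [map_mul, map_sub, map_smul, FreeAlgebra.lift_ι_apply]
    rw [gen_mul_gen_of_le hp _ hrow.le, gen_mul_gen_of_le (a := c) (b := d) hp _ (by lia),
      gen_mul_gen hp, colFactor, if_neg hne, one_smul, entry_mul_entry hpr hrow,
      (colScale_commute _ (rowIdx b) (rowIdx a)).eq, hc1, hc2, hd1, hd2, hc1', hd1', swapCoeff,
      keepCoeff, if_neg hcol'.ne', if_pos hcol', one_smul, add_mul, smul_mul_assoc]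
    exact add_sub_smul_eq_sub_sub_smul (M := Module.End K (Config (Fin (N + 2)) →₀ K)) _ _ _ _
  | c5 a b hab =>
    have hrow : a.1.1 < b.1.1 := (rowIdx_lt_colIdx a).trans_eq hab
    have hcol : colIdx a < colIdx b := hab.trans_lt (rowIdx_lt_colIdx b)
    have he : colIdx a = rowIdx b := Fin.ext hab
    simp only [map_mul, map_smul, FreeAlgebra.lift_ι_apply]
    rw [gen_mul_gen_of_le hp _ hrow.le, gen_mul_gen hp, colFactor, if_pos he,
      entry_mul_entry hpr hrow, entry_eq_zero (j := colIdx a) _ _ hab.le,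
      (colScale_commute _ (rowIdx b) (rowIdx a)).eq]
    simp [swapCoeff, hcol.ne']

/-- The representation of the homogenized Jimbo algebra on configurations. -/
noncomputable def rep {q : K} (hq : q ≠ 0) :
    Ah K q N →ₐ[K] Module.End K (Config (Fin (N + 2)) →₀ K) :=
  RingQuot.liftAlgHom K ⟨FreeAlgebra.lift K (gen (q ^ 2) (q ^ 2)⁻¹), fun _ _ => lift_gen_eq hq⟩

lemma rep_xh {q : K} (hq : q ≠ 0) (a : Lam N) :
    rep hq (xh K q N a) = gen (q ^ 2) (q ^ 2)⁻¹ a := by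
  simp [rep, xh]

/-- The configuration counting the occurrences of each generator in a word. -/
def wordConfig (l : List (Lam N)) : Config (Fin (N + 2)) :=
  fun i j => l.countP fun a => a.1.1 = i ∧ colIdx a = j

lemma wordConfig_cons (a : Lam N) (l : List (Lam N)) :
    wordConfig (a :: l) = Function.update (wordConfig l) a.1.1
      (wordConfig l a.1.1 + Pi.single (colIdx a) 1) := by
  ext i j
  by_cases hi : i = a.1.1
  · subst hi
    by_cases hj : j = colIdx a
    · subst hj; simp [wordConfig]
    · simp [wordConfig, hj, Ne.symm hj]
  · simp [wordConfig, hi, Ne.symm hi]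

lemma wordConfig_apply (l : List (Lam N)) (a : Lam N) :
    wordConfig l a.1.1 (colIdx a) = l.count a := by
  refine List.countP_congr fun b _ => ?_
  have h : a.1.1 = b.1.1 ∧ colIdx a = colIdx b ↔ a = b := by
    refine ⟨fun h => Subtype.ext (Prod.ext h.1 (congrArg Fin.val h.2)), fun h => by simp [h]⟩
  have h' : b.1.1 = a.1.1 ∧ colIdx b = colIdx a ↔ b = a := by
    rw [eq_comm, @eq_comm _ (colIdx b), h, eq_comm]
  simp [h']

lemma lam_lt_iff (a b : Lam N) :
    a < b ↔ a.1.1 < b.1.1 ∨ a.1.1 = b.1.1 ∧ a.1.2 < b.1.2 :=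
  Prod.Lex.toLex_lt_toLex

lemma prod_gen_apply {p : K} (hp : p ≠ 0) (r : K) {l : List (Lam N)}
    (hl : l.Pairwise (· ≤ ·)) :
    ∃ c : K, c ≠ 0 ∧ (l.map (gen p r)).prod (Finsupp.single 0 1) =
      c • Finsupp.single (wordConfig l) 1 := by
  induction l with
  | nil => exact ⟨1, one_ne_zero, by simp; rfl⟩
  | cons a l ih =>
    obtain ⟨c, hc, h⟩ := ih hl.of_cons
    have hle : ∀ b ∈ l, ¬ b < a := fun b hb => (List.rel_of_pairwise_cons hl hb).not_gt
    refine ⟨c * p ^ colWeight (rowIdx a) (wordConfig l), mul_ne_zero hc (pow_ne_zero _ hp), ?_⟩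
    have hs : Finsupp.single (wordConfig l) (1 * p ^ colWeight (rowIdx a) (wordConfig l)) =
        p ^ colWeight (rowIdx a) (wordConfig l) • Finsupp.single (wordConfig l) (1 : K) := by
      simp
    rw [List.map_cons, List.prod_cons, Module.End.mul_apply, h, map_smul, gen,
      Module.End.mul_apply, colScale_single, hs, map_smul,
      entry_single p r (rowIdx_lt_colIdx a) ?_ ?_, wordConfig_cons, smul_smul]
    · refine fun i hi => funext fun j => List.countP_eq_zero.2 fun b hb => ?_
      have := hle b hb
      rw [lam_lt_iff] at this
      simp only [decide_eq_true_eq]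
      rintro ⟨rfl, -⟩
      exact this (Or.inl hi)
    · refine fun j hj => List.countP_eq_zero.2 fun b hb => ?_
      have := hle b hb
      rw [lam_lt_iff] at this
      simp only [decide_eq_true_eq]
      rintro ⟨hab, rfl⟩
      exact this (Or.inr ⟨hab, hj⟩)

/-- The sorted word with given multiplicities. -/
noncomputable def sortedWord (α : Lam N →₀ ℕ) : List (Lam N) :=
  (α.support.sort (· ≤ ·)).flatMap fun a => List.replicate (α a) a

lemma pairwise_sortedWord (α : Lam N →₀ ℕ) : (sortedWord α).Pairwise (· ≤ ·) := by
  rw [sortedWord, List.pairwise_flatMap]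
  refine ⟨fun a _ => List.pairwise_replicate.2 (Or.inr le_rfl),
    (Finset.pairwise_sort _ _).imp fun hab x hx y hy => ?_⟩
  rw [List.eq_of_mem_replicate hx, List.eq_of_mem_replicate hy]
  exact hab

lemma count_sortedWord (α : Lam N →₀ ℕ) (a : Lam N) : (sortedWord α).count a = α a := by
  rw [sortedWord, List.count_flatMap, ← Multiset.sum_coe, ← Multiset.map_coe, Finset.sort_eq]
  change ∑ b ∈ α.support, (List.replicate (α b) b).count a = α a
  rw [Finset.sum_eq_single a]
  · simp
  · intro b _ hb
    simp [List.count_replicate, hb]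
  · intro ha
    simpa using ha

lemma monH_eq_prod (q : K) (α : Lam N →₀ ℕ) :
    monH K q N α = ((sortedWord α).map (xh K q N)).prod := by
  rw [monH, sortedWord, List.map_flatMap]
  induction α.support.sort (· ≤ ·) with
  | nil => simp
  | cons a l ih => simp [ih]

lemma exists_sortedWord_eq {l : List (Lam N)} (hl : l.Pairwise (· ≤ ·)) :
    ∃ α, sortedWord α = l := by
  refine ⟨Multiset.toFinsupp (l : Multiset (Lam N)), ?_⟩
  refine List.Perm.eq_of_pairwise (le := (· ≤ ·)) (fun a b _ _ => le_antisymm)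
    (pairwise_sortedWord _) hl (List.perm_iff_count.2 fun a => ?_)
  rw [count_sortedWord]
  simp

theorem linearIndependent_monH {q : K} (hq : q ≠ 0) : LinearIndependent K (monH K q N) := by
  have hp : q ^ 2 ≠ 0 := pow_ne_zero 2 hq
  choose c hc h using fun α : Lam N →₀ ℕ =>
    prod_gen_apply hp (q ^ 2)⁻¹ (pairwise_sortedWord α)
  have hinj : Function.Injective fun α : Lam N →₀ ℕ => wordConfig (sortedWord α) := by
    intro α β hαβ
    ext a
    rw [← count_sortedWord α, ← count_sortedWord β, ← wordConfig_apply, ← wordConfig_apply]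
    exact congrFun (congrFun hαβ _) _
  let φ : Ah K q N →ₗ[K] (Config (Fin (N + 2)) →₀ K) :=
    LinearMap.applyₗ (Finsupp.single 0 1) ∘ₗ (rep hq).toLinearMap
  refine LinearIndependent.of_comp φ ?_
  have hφ : φ ∘ monH K q N = (fun α => Units.mk0 (c α) (hc α)) •
      fun α => Finsupp.single (wordConfig (sortedWord α)) (1 : K) := by
    funext α
    have hrep : rep hq ∘ xh K q N = gen (q ^ 2) (q ^ 2)⁻¹ := funext (rep_xh hq)
    change rep hq (monH K q N α) (Finsupp.single 0 1) = c α • Finsupp.single _ (1 : K)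
    rw [monH_eq_prod, map_list_prod, List.map_map, hrep, h]
  rw [hφ, LinearIndependent.units_smul_iff]
  exact (Finsupp.linearIndependent_single_one K _).comp _ hinj

lemma xh_mul_xh_mem_span {q : K} {a b : Lam N} (hab : a < b) :
    xh K q N b * xh K q N a ∈ Submodule.span K
      {z | ∃ c d, c < b ∧ z = xh K q N c * xh K q N d} := by
  have hrel : ∀ {x y}, HJimboRel K q N x y → RingQuot.mkAlgHom K (HJimboRel K q N) x =
      RingQuot.mkAlgHom K (HJimboRel K q N) y := fun h => RingQuot.mkAlgHom_rel K h
  have hmem : ∀ c d : Lam N, c < b → xh K q N c * xh K q N d ∈ Submodule.span K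
      {z | ∃ c d, c < b ∧ z = xh K q N c * xh K q N d} :=
    fun c d h => Submodule.subset_span ⟨c, d, h, rfl⟩
  have hsmul := fun s : K => Submodule.smul_mem _ s (hmem a b hab)
  rw [lam_lt_iff] at hab
  have ha := a.2
  have hb := b.2
  rcases hab with hrow | ⟨hrow, hcol⟩
  · rcases lt_trichotomy a.1.2 b.1.2 with hcol | hcol | hcol
    · rcases lt_trichotomy a.1.2 b.1.1 with h | h | h
      · have := hrel (.c6 a b h)
        simp only [map_mul] at this
        rw [xh, xh, this]
        exact hmem a b ((lam_lt_iff _ _).2 (Or.inl hrow))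
      · have := hrel (.c5 a b h)
        simp only [map_mul, map_smul] at this
        rw [xh, xh, this]
        exact hsmul _
      · let c : Lam N := ⟨(a.1.1, b.1.2), by lia⟩
        let d : Lam N := ⟨(b.1.1, a.1.2), by lia⟩
        have := hrel (.c4 a b c d hrow h hcol rfl rfl)
        simp only [map_mul, map_smul, map_sub] at this
        rw [xh, xh, this]
        exact sub_mem (hmem a b ((lam_lt_iff _ _).2 (Or.inl hrow)))
          (Submodule.smul_mem _ _ (hmem c d ((lam_lt_iff _ _).2 (Or.inl hrow))))
    · have := hrel (.c3 a b hrow hcol)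
      simp only [map_mul, map_smul] at this
      rw [xh, xh, this]
      exact hsmul _
    · have := hrel (.c2 a b hrow hcol)
      simp only [map_mul] at this
      rw [xh, xh, this]
      exact hmem a b ((lam_lt_iff _ _).2 (Or.inl hrow))
  · have := hrel (.c1 a b hrow hcol)
    simp only [map_mul, map_smul] at this
    rw [xh, xh, this]
    exact hsmul _

instance : Finite (Lam N) :=
  Finite.of_injective (fun a => (rowIdx a, colIdx a)) fun _ _ h =>
    Subtype.ext (Prod.ext (congrArg (fun x => x.1.val) h) (congrArg (fun x => x.2.val) h))

lemma prod_xh_mem_span (q : K) (l : List (Lam N)) :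
    (l.map (xh K q N)).prod ∈ Submodule.span K (Set.range (monH K q N)) := by
  have : Finite {w : List (Lam N) // w.length = l.length} := List.finite_length_eq _ _
  suffices H : ∀ w : {w : List (Lam N) // w.length = l.length},
      (w.1.map (xh K q N)).prod ∈ Submodule.span K (Set.range (monH K q N)) from H ⟨l, rfl⟩
  intro w
  induction w using WellFoundedLT.induction with
  | ind w ih =>
  obtain ⟨w, hw⟩ := w
  by_cases hs : w.Pairwise (· ≤ ·)
  · obtain ⟨α, rfl⟩ := exists_sortedWord_eq hs
    exact Submodule.subset_span ⟨α, monH_eq_prod q α⟩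
  rw [← List.isChain_iff_pairwise, List.isChain_iff_forall_rel_of_append_cons_cons] at hs
  push Not at hs
  obtain ⟨b, a, u, v, rfl, hab⟩ := hs
  let f : Ah K q N →ₗ[K] Ah K q N := LinearMap.mulLeft K (u.map (xh K q N)).prod ∘ₗ
    LinearMap.mulRight K (v.map (xh K q N)).prod
  have hf : ∀ c d, f (xh K q N c * xh K q N d) = ((u ++ c :: d :: v).map (xh K q N)).prod :=
    fun c d => by simp [f, mul_assoc]
  rw [← hf]
  have := Submodule.mem_map_of_mem (f := f) (xh_mul_xh_mem_span (K := K) (q := q) hab)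
  rw [Submodule.map_span] at this
  refine Submodule.span_le.2 ?_ this
  rintro _ ⟨_, ⟨c, d, hc, rfl⟩, rfl⟩
  rw [hf]
  refine ih ⟨u ++ c :: d :: v, by simpa using hw⟩ ?_
  change u ++ c :: d :: v < u ++ b :: a :: v
  exact List.Lex.append_left _ (List.Lex.rel hc) _

theorem span_monH (q : K) : Submodule.span K (Set.range (monH K q N)) = ⊤ := by
  refine eq_top_iff.2 fun z _ => ?_
  obtain ⟨y, rfl⟩ := RingQuot.mkAlgHom_surjective K (HJimboRel K q N) z
  have hz : RingQuot.mkAlgHom K (HJimboRel K q N) y ∈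
      Algebra.adjoin K (Set.range (xh K q N)) := by
    have h := congrArg (Subalgebra.map (RingQuot.mkAlgHom K (HJimboRel K q N)))
      (FreeAlgebra.adjoin_range_ι K (Lam N))
    rw [AlgHom.map_adjoin, ← Set.range_comp] at h
    exact h.ge ⟨y, Algebra.mem_top, rfl⟩
  rw [← Subalgebra.mem_toSubmodule, Algebra.adjoin_eq_span] at hz
  refine Submodule.span_le.2 (fun w hw => ?_) hz
  obtain ⟨l, hl, rfl⟩ := Submonoid.exists_list_of_mem_closure hw
  obtain ⟨l, rfl⟩ : l ∈ Set.range (List.map (xh K q N)) := by rwa [Set.range_list_map]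
  exact prod_xh_mem_span q l

end Jimbo

end QuantumMatrix

/-- If q^8 ≠ 1, the ordered monomials of A_h, indexed by the finitely
supported functions α : Λ_N → ℕ, form a K-basis of A_h. -/
theorem ah_pbwBasis (K : Type) [Field K] (q : K) (hq0 : q ≠ 0)
    (hq8 : q ^ 8 ≠ 1) (N : ℕ) (hN : 1 ≤ N) :
    LinearIndependent K (monH K q N) ∧
    Submodule.span K (Set.range (monH K q N)) = ⊤ := by
  exact ⟨QuantumMatrix.linearIndependent_monH hq0, QuantumMatrix.span_monH q⟩
end

section
/- Suppose q^8 ≠ 1 and let A_h be the quotient of K⟨X_{ij} : (i,j) ∈ Λ_N⟩ by the two-sided ideal generated by the homogenized Jimbo relations: X_{mn}X_{ij} − q^{−2}X_{ij}X_{mn} when i = m < j < n or i < m < j = n; X_{mn}X_{ij} − X_{ij}X_{mn} when i < m < n < j or i < j < m < n; X_{mn}X_{ij} − X_{ij}X_{mn} + (q² − q^{−2})X_{in}X_{mj} when i < m < j < n; and X_{mn}X_{ij} − q²X_{ij}X_{mn} when i < j = m < n. Then A_h is a domain and is left and right Noetherian. -/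
/-- `S` is generated by the image of `R` and an element `x` such that
`x R + R = R x + R` inside `S`. -/
structure IsOreGen {R S : Type*} [Ring R] [Ring S] (f : R →+* S) (x : S) : Prop where
  left : ∀ r, ∃ s u, x * f r = f s * x + f u
  right : ∀ r, ∃ s u, f r * x = x * f s + f u
  gen : ∀ y, y ∈ Subring.closure (insert x (Set.range f))

namespace IsOreGen

variable {R S : Type*} [Ring R] [Ring S]

/-- The additive subgroup `∑_{i < n} x ^ i R`. -/
def filt (f : R →+* S) (x : S) : ℕ → AddSubgroup S
  | 0 => ⊥
  | n + 1 => filt f x n ⊔ ((AddMonoidHom.mulLeft (x ^ n)).comp f.toAddMonoidHom).range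

variable {f : R →+* S} {x : S}

lemma mem_filt_succ {n : ℕ} {y : S} :
    y ∈ filt f x (n + 1) ↔ ∃ g ∈ filt f x n, ∃ r, y = g + x ^ n * f r := by
  simp only [filt, AddSubgroup.mem_sup, AddMonoidHom.mem_range]
  constructor
  · rintro ⟨g, hg, _, ⟨r, rfl⟩, rfl⟩
    exact ⟨g, hg, r, rfl⟩
  · rintro ⟨g, hg, r, rfl⟩
    exact ⟨g, hg, _, ⟨r, rfl⟩, rfl⟩

lemma filt_mono : Monotone (filt f x) :=
  monotone_nat_of_le_succ fun _ => le_sup_left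

lemma pow_mul_mem_filt (n : ℕ) (r : R) : x ^ n * f r ∈ filt f x (n + 1) :=
  mem_filt_succ.2 ⟨0, zero_mem _, r, by simp⟩

lemma filt_mul_right {n : ℕ} {y : S} (hy : y ∈ filt f x n) (r : R) : y * f r ∈ filt f x n := by
  induction n generalizing y with
  | zero => simp_all [filt]
  | succ n ih =>
    obtain ⟨g, hg, s, rfl⟩ := mem_filt_succ.1 hy
    exact mem_filt_succ.2 ⟨_, ih hg, s * r, by rw [map_mul]; noncomm_ring⟩

lemma mul_filt {n : ℕ} {y : S} (hy : y ∈ filt f x n) : x * y ∈ filt f x (n + 1) := by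
  induction n generalizing y with
  | zero => simp_all [filt]
  | succ n ih =>
    obtain ⟨g, hg, s, rfl⟩ := mem_filt_succ.1 hy
    exact mem_filt_succ.2 ⟨_, ih hg, s, by rw [pow_succ']; noncomm_ring⟩

lemma filt_mul (h : IsOreGen f x) {n : ℕ} {y : S} (hy : y ∈ filt f x n) :
    y * x ∈ filt f x (n + 1) := by
  induction n generalizing y with
  | zero => simp_all [filt]
  | succ n ih =>
    obtain ⟨g, hg, r, rfl⟩ := mem_filt_succ.1 hy
    obtain ⟨s, u, hsu⟩ := h.right r
    have : (g + x ^ n * f r) * x = (g * x + x ^ n * f u) + x ^ (n + 1) * f s := by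
      rw [add_mul, mul_assoc, hsu, pow_succ]; noncomm_ring
    exact mem_filt_succ.2 ⟨_, add_mem (ih hg) (pow_mul_mem_filt n u), s, this⟩

lemma mul_left_filt (h : IsOreGen f x) {n : ℕ} {y : S} (hy : y ∈ filt f x n) (r : R) :
    f r * y ∈ filt f x n := by
  induction n generalizing y r with
  | zero => simp_all [filt]
  | succ n ih =>
    obtain ⟨g, hg, t, rfl⟩ := mem_filt_succ.1 hy
    rw [mul_add]
    refine add_mem (filt_mono n.le_succ (ih hg r)) ?_
    cases n with
    | zero =>
      simpa using pow_mul_mem_filt (f := f) (x := x) 0 (r * t)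
    | succ n =>
      obtain ⟨s, u, hsu⟩ := h.right r
      have : f r * (x ^ (n + 1) * f t) = x * (f s * (x ^ n * f t)) + f u * (x ^ n * f t) := by
        rw [pow_succ', ← mul_assoc, ← mul_assoc, hsu]; noncomm_ring
      rw [this]
      exact add_mem (mul_filt (ih (pow_mul_mem_filt n t) s))
        (filt_mono (Nat.le_succ _) (ih (pow_mul_mem_filt n t) u))

lemma exists_pow_mul (h : IsOreGen f x) (n : ℕ) (r : R) :
    ∃ s, f s * x ^ n - x ^ n * f r ∈ filt f x n := by
  induction n generalizing r with
  | zero => exact ⟨r, by simp [filt]⟩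
  | succ n ih =>
    obtain ⟨s, u, hsu⟩ := h.left r
    obtain ⟨t, ht⟩ := ih s
    refine ⟨t, ?_⟩
    have : f t * x ^ (n + 1) - x ^ (n + 1) * f r
        = (f t * x ^ n - x ^ n * f s) * x - x ^ n * f u := by
      rw [pow_succ, mul_assoc (x ^ n) x, hsu]; noncomm_ring
    rw [this]
    exact sub_mem (h.filt_mul ht) (pow_mul_mem_filt n u)

lemma exists_mem_filt (h : IsOreGen f x) (y : S) : ∃ n, y ∈ filt f x n := by
  suffices H : ∀ y, y ∈ Subring.closure (insert x (Set.range f)) →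
      ∀ z, (∃ n, z ∈ filt f x n) → ∃ n, y * z ∈ filt f x n by
    have h1 : (1 : S) ∈ filt f x 1 := by
      simpa using pow_mul_mem_filt (f := f) (x := x) 0 1
    simpa using H y (h.gen y) 1 ⟨1, h1⟩
  intro y hy
  induction hy using Subring.closure_induction with
  | mem y hy =>
    rintro z ⟨n, hz⟩
    rcases hy with rfl | ⟨r, rfl⟩
    · exact ⟨_, mul_filt hz⟩
    · exact ⟨_, h.mul_left_filt hz r⟩
  | zero => exact fun z _ => ⟨0, by simp⟩
  | one => simp
  | add a b _ _ ha hb =>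
    intro z hz
    obtain ⟨n, hn⟩ := ha z hz
    obtain ⟨m, hm⟩ := hb z hz
    exact ⟨max n m, by
      rw [add_mul]
      exact add_mem (filt_mono (le_max_left _ _) hn) (filt_mono (le_max_right _ _) hm)⟩
  | neg a _ ha =>
    intro z hz
    obtain ⟨n, hn⟩ := ha z hz
    exact ⟨n, by rw [neg_mul]; exact neg_mem hn⟩
  | mul a b _ _ ha hb =>
    intro z hz
    rw [mul_assoc]
    exact ha _ (hb z hz)

/-- The left ideal of leading coefficients in degree `n` of a left ideal of `S`. -/
def lead (h : IsOreGen f x) (n : ℕ) (I : Submodule S S) : Submodule R R where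
  carrier := {r | ∃ y ∈ I, y - x ^ n * f r ∈ filt f x n}
  add_mem' := by
    rintro a b ⟨y, hy, hya⟩ ⟨z, hz, hzb⟩
    refine ⟨y + z, add_mem hy hz, ?_⟩
    have : y + z - x ^ n * f (a + b) = (y - x ^ n * f a) + (z - x ^ n * f b) := by
      rw [map_add]; noncomm_ring
    rw [this]
    exact add_mem hya hzb
  zero_mem' := ⟨0, zero_mem _, by simp⟩
  smul_mem' := by
    rintro r a ⟨y, hy, hya⟩
    obtain ⟨s, hs⟩ := h.exists_pow_mul n r
    refine ⟨f s * y, I.smul_mem _ hy, ?_⟩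
    have : f s * y - x ^ n * f (r • a)
        = f s * (y - x ^ n * f a) + (f s * x ^ n - x ^ n * f r) * f a := by
      rw [smul_eq_mul, map_mul]; noncomm_ring
    rw [this]
    exact add_mem (h.mul_left_filt hya s) (filt_mul_right hs a)

lemma lead_mono_right (h : IsOreGen f x) (n : ℕ) : Monotone (h.lead n) := by
  rintro I J hIJ r ⟨y, hy, hyr⟩
  exact ⟨y, hIJ hy, hyr⟩

lemma lead_mono_left (h : IsOreGen f x) (I : Submodule S S) : Monotone (fun n => h.lead n I) := by
  refine monotone_nat_of_le_succ ?_
  rintro n r ⟨y, hy, hyr⟩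
  refine ⟨x * y, I.smul_mem _ hy, ?_⟩
  have : x * y - x ^ (n + 1) * f r = x * (y - x ^ n * f r) := by
    rw [pow_succ']; noncomm_ring
  rw [this]
  exact mul_filt hyr

lemma eq_of_lead_eq (h : IsOreGen f x) {I J : Submodule S S} (hIJ : I ≤ J)
    (hl : ∀ n, h.lead n I = h.lead n J) : I = J := by
  refine le_antisymm hIJ fun y hy => ?_
  obtain ⟨n, hn⟩ := h.exists_mem_filt y
  induction n generalizing y with
  | zero =>
    have : y = 0 := by simpa [filt] using hn
    exact this ▸ zero_mem _
  | succ n ih =>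
    obtain ⟨g, hg, r, rfl⟩ := mem_filt_succ.1 hn
    have hr : r ∈ h.lead n J := ⟨_, hy, by simpa using hg⟩
    rw [← hl] at hr
    obtain ⟨z, hz, hzr⟩ := hr
    have := ih _ (sub_mem hy (hIJ hz)) (by
      have : g + x ^ n * f r - z = g - (z - x ^ n * f r) := by abel
      rw [this]
      exact sub_mem hg hzr)
    simpa using add_mem this hz

/-- Hilbert's basis theorem for a (not necessarily free) Ore-type extension. -/
theorem isNoetherianRing (h : IsOreGen f x) [IsNoetherianRing R] : IsNoetherianRing S := by
  refine monotone_stabilizes_iff_noetherian.1 fun c => ?_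
  obtain ⟨m, hm⟩ := monotone_stabilizes_iff_noetherian.2 (inferInstanceAs (IsNoetherian R R))
    ⟨fun k => h.lead k (c k), fun a b hab =>
      (h.lead_mono_left (c a) hab).trans (h.lead_mono_right b (c.mono hab))⟩
  have hs : ∀ n, ∃ k, ∀ l, k ≤ l → h.lead n (c k) = h.lead n (c l) := fun n =>
    monotone_stabilizes_iff_noetherian.2 (inferInstanceAs (IsNoetherian R R))
      ⟨fun k => h.lead n (c k), fun a b hab => h.lead_mono_right n (c.mono hab)⟩
  choose k hk using hs
  let M := max m ((Finset.range m).sup k)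
  refine ⟨M, fun l hl => h.eq_of_lead_eq (c.mono hl) fun n => ?_⟩
  by_cases hn : n < m
  · have hkM : k n ≤ M := le_max_of_le_right (Finset.le_sup (Finset.mem_range.2 hn))
    rw [← hk n M hkM, ← hk n l (hkM.trans hl)]
  · push Not at hn
    have key : ∀ j, m ≤ j → h.lead n (c j) = h.lead m (c m) := by
      intro j hj
      refine le_antisymm ?_ ((h.lead_mono_left (c m) hn).trans (h.lead_mono_right n (c.mono hj)))
      refine ((h.lead_mono_left (c j) (le_max_left n j)).trans
        (h.lead_mono_right _ (c.mono (le_max_right n j)))).trans ?_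
      exact (hm (max n j) (hn.trans (le_max_left _ _))).ge
    rw [key M (le_max_left _ _), key l ((le_max_left _ _).trans hl)]

end IsOreGen

theorem Set.univ_of_Iio_Iic {ι : Type*} [LinearOrder ι] [Finite ι] {P : Set ι → Prop}
    (h0 : P ∅) (h : ∀ b, P (Set.Iio b) → P (Set.Iic b)) : P Set.univ := by
  classical
  have := Fintype.ofFinite ι
  suffices H : ∀ s : Finset ι, IsLowerSet (s : Set ι) → P s by
    simpa using H Finset.univ (by simpa using isLowerSet_univ)
  intro s
  induction s using Finset.induction_on_max with
  | empty => exact fun _ => by simpa using h0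
  | insert b s hs ih =>
    intro hl
    have hsb : (s : Set ι) = Set.Iio b := by
      ext y
      refine ⟨hs y, fun hy => ?_⟩
      have := hl (show y ≤ b from hy.le) (by simp)
      simpa [ne_of_lt (show y < b from hy)] using this
    have hb : ((insert b s : Finset ι) : Set ι) = Set.Iic b := by
      rw [Finset.coe_insert, hsb, Set.Iio_insert]
    rw [hb]
    refine h b (hsb ▸ ih ?_)
    rw [hsb]
    exact isLowerSet_Iio b

/-- Generators which commute up to nonzero scalars and up to elements of the subalgebra generated
by the strictly smaller generators. -/
def IsOreTower {K A ι : Type*} [Field K] [Ring A] [Algebra K A] [LinearOrder ι] (x : ι → A) :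
    Prop :=
  ∀ a b, a < b → ∃ c : K, c ≠ 0 ∧
    x b * x a - c • (x a * x b) ∈ Algebra.adjoin K (x '' Set.Iio b)

namespace IsOreTower

variable {K A ι : Type*} [Field K] [Ring A] [Algebra K A] [LinearOrder ι] {x : ι → A}

theorem isOreGen (h : IsOreTower (K := K) x) (b : ι)
    (hb : x b ∈ Algebra.adjoin K (x '' Set.Iic b))
    (hle : Algebra.adjoin K (x '' Set.Iio b) ≤ Algebra.adjoin K (x '' Set.Iic b)) :
    IsOreGen (Subalgebra.inclusion hle).toRingHom
      (⟨x b, hb⟩ : Algebra.adjoin K (x '' Set.Iic b)) where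
  left := by
    suffices H : ∀ r ∈ Algebra.adjoin K (x '' Set.Iio b),
        ∃ s ∈ Algebra.adjoin K (x '' Set.Iio b), ∃ u ∈ Algebra.adjoin K (x '' Set.Iio b),
          x b * r = s * x b + u by
      rintro ⟨r, hr⟩
      obtain ⟨s, hs, u, hu, e⟩ := H r hr
      exact ⟨⟨s, hs⟩, ⟨u, hu⟩, Subtype.ext e⟩
    intro r hr
    induction hr using Algebra.adjoin_induction with
    | mem r hr =>
      obtain ⟨a, ha, rfl⟩ := hr
      obtain ⟨c, -, hcm⟩ := h a b ha
      refine ⟨c • x a, Subalgebra.smul_mem _ (Algebra.subset_adjoin (Set.mem_image_of_mem x ha)) c,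
        _, hcm, ?_⟩
      rw [smul_mul_assoc]; abel
    | algebraMap k =>
      exact ⟨_, Subalgebra.algebraMap_mem _ k, 0, zero_mem _, by
        rw [add_zero]; exact (Algebra.commutes k _).symm⟩
    | add r r' _ _ h₁ h₂ =>
      obtain ⟨s, hs, u, hu, e⟩ := h₁
      obtain ⟨s', hs', u', hu', e'⟩ := h₂
      exact ⟨s + s', add_mem hs hs', u + u', add_mem hu hu', by
        rw [mul_add, e, e']; noncomm_ring⟩
    | mul r r' _ hr' h₁ h₂ =>
      obtain ⟨s, hs, u, hu, e⟩ := h₁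
      obtain ⟨s', hs', u', hu', e'⟩ := h₂
      exact ⟨s * s', mul_mem hs hs', s * u' + u * r', add_mem (mul_mem hs hu') (mul_mem hu hr'), by
        rw [← mul_assoc, e, add_mul, mul_assoc s, e']; noncomm_ring⟩
  right := by
    suffices H : ∀ r ∈ Algebra.adjoin K (x '' Set.Iio b),
        ∃ s ∈ Algebra.adjoin K (x '' Set.Iio b), ∃ u ∈ Algebra.adjoin K (x '' Set.Iio b),
          r * x b = x b * s + u by
      rintro ⟨r, hr⟩
      obtain ⟨s, hs, u, hu, e⟩ := H r hr
      exact ⟨⟨s, hs⟩, ⟨u, hu⟩, Subtype.ext e⟩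
    intro r hr
    induction hr using Algebra.adjoin_induction with
    | mem r hr =>
      obtain ⟨a, ha, rfl⟩ := hr
      obtain ⟨c, hc, hcm⟩ := h a b ha
      refine ⟨c⁻¹ • x a,
        Subalgebra.smul_mem _ (Algebra.subset_adjoin (Set.mem_image_of_mem x ha)) _,
        _, Subalgebra.smul_mem _ hcm (-c⁻¹), ?_⟩
      rw [mul_smul_comm, neg_smul, smul_sub, smul_smul, inv_mul_cancel₀ hc, one_smul]; abel
    | algebraMap k =>
      exact ⟨_, Subalgebra.algebraMap_mem _ k, 0, zero_mem _, by
        rw [add_zero]; exact Algebra.commutes k _⟩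
    | add r r' _ _ h₁ h₂ =>
      obtain ⟨s, hs, u, hu, e⟩ := h₁
      obtain ⟨s', hs', u', hu', e'⟩ := h₂
      exact ⟨s + s', add_mem hs hs', u + u', add_mem hu hu', by
        rw [add_mul, e, e']; noncomm_ring⟩
    | mul r r' hr _ h₁ h₂ =>
      obtain ⟨s, hs, u, hu, e⟩ := h₁
      obtain ⟨s', hs', u', hu', e'⟩ := h₂
      exact ⟨s * s', mul_mem hs hs', u * s' + r * u', add_mem (mul_mem hu hs') (mul_mem hr hu'), by
        rw [mul_assoc, e', mul_add, ← mul_assoc, e]; noncomm_ring⟩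
  gen := by
    rintro ⟨y, hy⟩
    induction hy using Algebra.adjoin_induction with
    | mem y hy =>
      obtain ⟨a, ha, rfl⟩ := hy
      rcases (show a ≤ b from ha).eq_or_lt with rfl | hab
      · exact Subring.subset_closure (Set.mem_insert _ _)
      · exact Subring.subset_closure (Set.mem_insert_of_mem _
          ⟨⟨x a, Algebra.subset_adjoin ⟨a, hab, rfl⟩⟩, rfl⟩)
    | algebraMap k =>
      exact Subring.subset_closure (Set.mem_insert_of_mem _ ⟨algebraMap K _ k, rfl⟩)
    | add y z _ _ hy hz => exact add_mem hy hz
    | mul y z _ _ hy hz => exact mul_mem hy hz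

theorem isNoetherianRing [Finite ι] (h : IsOreTower (K := K) x)
    (hx : Algebra.adjoin K (Set.range x) = ⊤) : IsNoetherianRing A := by
  have : IsNoetherianRing (Algebra.adjoin K (x '' Set.univ)) := by
    refine Set.univ_of_Iio_Iic (P := fun s => IsNoetherianRing (Algebra.adjoin K (x '' s)))
      ?_ fun b ih => ?_
    · rw [Set.image_empty, Algebra.adjoin_empty]
      exact isNoetherianRing_of_surjective K _ (algebraMap K (⊥ : Subalgebra K A))
        fun ⟨y, k, hk⟩ => ⟨k, Subtype.ext hk⟩
    · exact (h.isOreGen b (Algebra.subset_adjoin ⟨b, Set.self_mem_Iic, rfl⟩)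
        (Algebra.adjoin_mono (Set.image_mono Set.Iio_subset_Iic_self))).isNoetherianRing
  rw [Set.image_univ, hx] at this
  exact isNoetherianRing_of_surjective _ _ (Subalgebra.topEquiv (R := K) (A := A)).toRingHom
    Subalgebra.topEquiv.surjective

theorem op (h : IsOreTower (K := K) x) : IsOreTower (K := K) fun a => MulOpposite.op (x a) := by
  intro a b hab
  obtain ⟨c, hc, hcm⟩ := h a b hab
  refine ⟨c⁻¹, inv_ne_zero hc, ?_⟩
  have H : ∀ y ∈ Algebra.adjoin K (x '' Set.Iio b),
      MulOpposite.op y ∈ Algebra.adjoin K ((fun a => MulOpposite.op (x a)) '' Set.Iio b) := by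
    intro y hy
    induction hy using Algebra.adjoin_induction with
    | mem y hy =>
      obtain ⟨d, hd, rfl⟩ := hy
      exact Algebra.subset_adjoin ⟨d, hd, rfl⟩
    | algebraMap k => exact Subalgebra.algebraMap_mem _ k
    | add y z _ _ hy hz => exact add_mem hy hz
    | mul y z _ _ hy hz => exact mul_mem hz hy
  convert Subalgebra.smul_mem _ (H _ hcm) (-c⁻¹) using 1
  rw [← MulOpposite.op_mul, ← MulOpposite.op_mul, ← MulOpposite.op_smul, ← MulOpposite.op_sub,
    ← MulOpposite.op_smul, neg_smul, smul_sub, smul_smul, inv_mul_cancel₀ hc, one_smul, neg_sub]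

theorem isNoetherianRing_op [Finite ι] (h : IsOreTower (K := K) x)
    (hx : Algebra.adjoin K (Set.range x) = ⊤) : IsNoetherianRing Aᵐᵒᵖ := by
  refine h.op.isNoetherianRing (eq_top_iff.2 fun y _ => ?_)
  obtain ⟨y, rfl⟩ := MulOpposite.op_surjective y
  have hy : y ∈ Algebra.adjoin K (Set.range x) := hx ▸ Algebra.mem_top
  induction hy using Algebra.adjoin_induction with
  | mem y hy =>
    obtain ⟨d, rfl⟩ := hy
    exact Algebra.subset_adjoin ⟨d, rfl⟩
  | algebraMap k => exact Subalgebra.algebraMap_mem _ k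
  | add y z _ _ hy hz => exact add_mem (hy trivial) (hz trivial)
  | mul y z _ _ hy hz => exact mul_mem (hz trivial) (hy trivial)

end IsOreTower

/-- A linear endomorphism of `G →₀ K` shifts all leading exponents by `e`. -/
def HasLead {K G : Type*} [Field K] [LinearOrder G] [Add G] (L : Module.End K (G →₀ K)) (e : G) :
    Prop :=
  ∀ (v : G →₀ K) (d : G), v d ≠ 0 → (∀ d', v d' ≠ 0 → d' ≤ d) →
    L v (e + d) ≠ 0 ∧ ∀ d', L v d' ≠ 0 → d' ≤ e + d

namespace HasLead

variable {K G : Type*} [Field K] [LinearOrder G] [AddCommMonoid G]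
  {L M : Module.End K (G →₀ K)} {e f : G}

theorem one : HasLead (1 : Module.End K (G →₀ K)) (0 : G) := by
  intro v d hd hv
  simpa using ⟨hd, hv⟩

theorem mul (hL : HasLead L e) (hM : HasLead M f) : HasLead (L * M) (e + f) := by
  intro v d hd hv
  obtain ⟨h₁, h₂⟩ := hM v d hd hv
  simpa [add_assoc] using hL (M v) (f + d) h₁ h₂

theorem pow (hL : HasLead L e) (n : ℕ) : HasLead (L ^ n) (n • e) := by
  induction n with
  | zero => simpa using one
  | succ n ih => rw [pow_succ, succ_nsmul]; exact ih.mul hL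

theorem smul {c : K} (hc : c ≠ 0) (hL : HasLead L e) : HasLead (c • L) e := by
  intro v d hd hv
  simpa [hc] using hL v d hd hv

theorem add_of_lt [IsOrderedCancelAddMonoid G] (hL : HasLead L e) (hM : HasLead M f)
    (hfe : f < e) : HasLead (L + M) e := by
  intro v d hd hv
  obtain ⟨h₁, h₂⟩ := hL v d hd hv
  obtain ⟨h₃, h₄⟩ := hM v d hd hv
  have hlt : f + d < e + d := by gcongr
  have h0 : M v (e + d) = 0 := by
    by_contra hne
    exact (h₄ _ hne).not_gt hlt
  refine ⟨by simpa [h0] using h₁, fun d' hd' => ?_⟩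
  by_cases hLd : L v d' = 0
  · exact (h₄ d' (by simpa [hLd] using hd')).trans hlt.le
  · exact h₂ d' hLd

theorem add_of_ne [IsOrderedCancelAddMonoid G] (hL : HasLead L e) (hM : HasLead M f) (hfe : f ≠ e) :
    HasLead (L + M) (max e f) := by
  rcases hfe.lt_or_gt with h | h
  · rw [max_eq_left h.le]; exact hL.add_of_lt hM h
  · rw [max_eq_right h.le, add_comm]; exact hM.add_of_lt hL h

theorem add_sum_of_lt [IsOrderedCancelAddMonoid G] {α : Type*} (s : Finset α)
    {F : α → Module.End K (G →₀ K)} {φ : α → G}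
    (hL : HasLead L e) (h : ∀ i ∈ s, F i ≠ 0 → HasLead (F i) (φ i) ∧ φ i < e) :
    HasLead (L + ∑ i ∈ s, F i) e := by
  classical
  induction s using Finset.induction_on with
  | empty => simpa using hL
  | insert i s hi ih =>
    have ih' := ih fun j hj => h j (Finset.mem_insert_of_mem hj)
    rw [Finset.sum_insert hi, add_left_comm, add_comm]
    by_cases h0 : F i = 0
    · simpa [h0] using ih'
    · obtain ⟨h₁, h₂⟩ := h i (Finset.mem_insert_self _ _) h0
      exact ih'.add_of_lt h₁ h₂

theorem ne_zero (hL : HasLead L e) : L ≠ 0 := by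
  rintro rfl
  have := (hL (Finsupp.single 0 1) 0 (by simp) (by
    intro d' hd'
    by_contra hne
    exact hd' (Finsupp.single_eq_of_ne (by rintro rfl; exact hne le_rfl)))).1
  simp at this

end HasLead

theorem IsOreTower.exists_hasLead {K A G ι : Type*} [Field K] [Ring A] [Algebra K A]
    [LinearOrder ι] [Finite ι] {x : ι → A}
    [LinearOrder G] [AddCommMonoid G] [IsOrderedCancelAddMonoid G]
    (h : IsOreTower (K := K) x) (hx : Algebra.adjoin K (Set.range x) = ⊤)
    (φ : A →ₐ[K] Module.End K (G →₀ K)) (ε : ι → G) (hε : ∀ a, HasLead (φ (x a)) (ε a))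
    (ℓ : ι → G →+ ℤ) (hℓ : ∀ a b, ℓ a (ε b) = if a = b then 1 else 0) (y : A) (hy : y ≠ 0) :
    ∃ e, HasLead (φ y) e := by
  have key : ∀ y ∈ Algebra.adjoin K (x '' Set.univ), y = 0 ∨
      ∃ e, HasLead (φ y) e ∧ ∀ a ∉ Set.univ, ℓ a e = 0 := by
    refine Set.univ_of_Iio_Iic (P := fun s => ∀ y ∈ Algebra.adjoin K (x '' s), y = 0 ∨
      ∃ e, HasLead (φ y) e ∧ ∀ a ∉ s, ℓ a e = 0) ?_ fun b ih => ?_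
    · intro y hy
      rw [Set.image_empty, Algebra.adjoin_empty] at hy
      obtain ⟨k, rfl⟩ := hy
      by_cases hk : k = 0
      · simp [hk]
      · refine Or.inr ⟨0, ?_, by simp⟩
        have : φ (algebraMap K A k) = k • 1 := by
          rw [AlgHom.commutes, Algebra.algebraMap_eq_smul_one]
        exact this ▸ HasLead.one.smul hk
    · have hle : Algebra.adjoin K (x '' Set.Iio b) ≤ Algebra.adjoin K (x '' Set.Iic b) :=
        Algebra.adjoin_mono (Set.image_mono Set.Iio_subset_Iic_self)
      have hb : x b ∈ Algebra.adjoin K (x '' Set.Iic b) :=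
        Algebra.subset_adjoin ⟨b, Set.self_mem_Iic, rfl⟩
      have hO := h.isOreGen b hb hle
      intro y hy
      obtain ⟨n, hn⟩ := hO.exists_mem_filt ⟨y, hy⟩
      suffices H : ∀ z : Algebra.adjoin K (x '' Set.Iic b),
          z ∈ IsOreGen.filt (Subalgebra.inclusion hle).toRingHom ⟨x b, hb⟩ n → (z : A) = 0 ∨
          ∃ e, HasLead (φ z) e ∧ (∀ a ∉ Set.Iic b, ℓ a e = 0) ∧ ℓ b e < n by
        rcases H _ hn with h0 | ⟨e, he, hea, -⟩
        · exact Or.inl h0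
        · exact Or.inr ⟨e, he, hea⟩
      clear hn hy y
      induction n with
      | zero =>
        intro z hz
        left
        have : z = 0 := by simpa [IsOreGen.filt] using hz
        simp [this]
      | succ n ihn =>
        intro z hz
        obtain ⟨g, hg, ⟨r, hr⟩, rfl⟩ := IsOreGen.mem_filt_succ.1 hz
        have hval : ((g + ⟨x b, hb⟩ ^ n * (Subalgebra.inclusion hle).toRingHom ⟨r, hr⟩ :
            Algebra.adjoin K (x '' Set.Iic b)) : A) = g + x b ^ n * r := rfl
        rw [hval]
        have hg' : (g : A) = 0 ∨ ∃ e, HasLead (φ g) e ∧ (∀ a ∉ Set.Iic b, ℓ a e = 0) ∧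
            ℓ b e < n := ihn g hg
        rcases ih r hr with rfl | ⟨e, he, hea⟩
        · rcases hg' with h0 | ⟨e, he, hea, heb⟩
          · simp [h0]
          · exact Or.inr ⟨e, by simpa using he, hea, by push_cast; omega⟩
        · right
          have h₁ : HasLead (φ (x b ^ n * r)) (n • ε b + e) := by
            rw [map_mul, map_pow]; exact ((hε b).pow n).mul he
          have h₂ : ∀ a ∉ Set.Iic b, ℓ a (n • ε b + e) = 0 := by
            intro a ha
            have hab : a ≠ b := by rintro rfl; exact ha Set.self_mem_Iic
            simp [hℓ, hab, hea a fun h => ha (Set.Iio_subset_Iic_self h)]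
          have h₃ : ℓ b (n • ε b + e) = n := by simp [hℓ, hea b (lt_irrefl b)]
          rcases hg' with h0 | ⟨e', he', hea', heb'⟩
          · exact ⟨_, by simpa [h0] using h₁, h₂, by rw [h₃]; push_cast; omega⟩
          · have hne : n • ε b + e ≠ e' := by
              rintro rfl
              omega
            rw [map_add]
            rcases max_choice e' (n • ε b + e) with hm | hm
            · exact ⟨_, hm ▸ he'.add_of_ne h₁ hne, hea', by push_cast; omega⟩
            · exact ⟨_, hm ▸ he'.add_of_ne h₁ hne, h₂, by rw [h₃]; push_cast; omega⟩
  rw [Set.image_univ, hx] at key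
  rcases key y Algebra.mem_top with h0 | ⟨e, he, -⟩
  · exact absurd h0 hy
  · exact ⟨e, he⟩

theorem mul_ne_zero_of_hasLead {K A G : Type*} [Field K] [Ring A] [Algebra K A]
    [LinearOrder G] [AddCommMonoid G]
    (φ : A →ₐ[K] Module.End K (G →₀ K)) (h : ∀ y ≠ 0, ∃ e, HasLead (φ y) e) {y z : A}
    (hy : y ≠ 0) (hz : z ≠ 0) : y * z ≠ 0 := by
  obtain ⟨e, he⟩ := h y hy
  obtain ⟨f, hf⟩ := h z hz
  intro h0
  apply (he.mul hf).ne_zero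
  rw [← map_mul, h0, map_zero]

/-- The FRT relation for a matrix `X`, written out in entries: `X` intertwines the braiding
of `GL_p` with itself. -/
def IsQuantumMatrix {K A : Type*} [Field K] [Ring A] [Algebra K A] (p : K) (X : ℕ → ℕ → A) : Prop :=
  ∀ i m j n, (if i = m then p else 1) • (X m j * X i n)
      + (if i < m then p - p⁻¹ else 0) • (X i j * X m n)
    = (if j = n then p else 1) • (X i n * X m j)
      + (if j < n then p - p⁻¹ else 0) • (X i j * X m n)

namespace IsQuantumMatrix

variable {K A : Type*} [Field K] [Ring A] [Algebra K A] {p : K}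

theorem one : IsQuantumMatrix p (fun i j => if i = j then (1 : A) else 0) := by
  intro i m j n
  by_cases h₁ : m = j <;> by_cases h₂ : i = n <;> by_cases h₃ : i = j <;> by_cases h₄ : m = n <;>
    subst_vars <;> simp_all [eq_comm]

theorem mul {Y Z : ℕ → ℕ → A} (hY : IsQuantumMatrix p Y) (hZ : IsQuantumMatrix p Z)
    (hYZ : ∀ i j k l, Commute (Y i j) (Z k l)) (M : ℕ) :
    IsQuantumMatrix p (fun i j => ∑ s ∈ Finset.range M, Y i s * Z s j) := by
  have expand : ∀ i j m n, (∑ s ∈ Finset.range M, Y i s * Z s j) *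
      (∑ u ∈ Finset.range M, Y m u * Z u n) = ∑ s ∈ Finset.range M, ∑ u ∈ Finset.range M,
        (Y i s * Y m u) * (Z s j * Z u n) := by
    intro i j m n
    rw [Finset.sum_mul_sum]
    refine Finset.sum_congr rfl fun s _ => Finset.sum_congr rfl fun u _ => ?_
    rw [mul_assoc, ← mul_assoc (Z s j), ← (hYZ m u s j).eq]
    noncomm_ring
  have swap : ∀ F : ℕ → ℕ → A, ∑ s ∈ Finset.range M, ∑ u ∈ Finset.range M, F s u =
      ∑ s ∈ Finset.range M, ∑ u ∈ Finset.range M, F u s := fun F => Finset.sum_comm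
  intro i m j n
  simp only [expand]
  calc _ = ∑ s ∈ Finset.range M, ∑ u ∈ Finset.range M,
        ((if i = m then p else 1) • (Y m s * Y i u)
          + (if i < m then p - p⁻¹ else 0) • (Y i s * Y m u)) * (Z s j * Z u n) := by
        simp only [Finset.smul_sum, ← Finset.sum_add_distrib, add_mul, smul_mul_assoc]
    _ = ∑ s ∈ Finset.range M, ∑ u ∈ Finset.range M, (Y i u * Y m s) *
          ((if s = u then p else 1) • (Z s j * Z u n))
        + ∑ s ∈ Finset.range M, ∑ u ∈ Finset.range M, (Y i s * Y m u) *
          ((if s < u then p - p⁻¹ else 0) • (Z s j * Z u n)) := by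
        simp only [hY i m, ← Finset.sum_add_distrib, add_mul, smul_mul_assoc, mul_smul_comm]
    _ = ∑ s ∈ Finset.range M, ∑ u ∈ Finset.range M, (Y i s * Y m u) *
          ((if s = u then p else 1) • (Z u j * Z s n)
            + (if s < u then p - p⁻¹ else 0) • (Z s j * Z u n)) := by
        rw [swap]
        simp only [← Finset.sum_add_distrib, mul_add, eq_comm]
    _ = _ := by
        simp only [Finset.smul_sum, ← Finset.sum_add_distrib]
        refine Finset.sum_congr rfl fun s _ => Finset.sum_congr rfl fun u _ => ?_
        rw [hZ s u j n, mul_add, mul_smul_comm, mul_smul_comm]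

variable {X : ℕ → ℕ → A} (hX : IsQuantumMatrix p X)
include hX

theorem row {i j n : ℕ} (h : j < n) : X i n * X i j = p⁻¹ • (X i j * X i n) := by
  have := hX i i j n
  simp only [if_true, lt_irrefl, if_false, h.ne, h, zero_smul, add_zero, one_smul, sub_smul] at this
  rw [← sub_eq_zero] at this ⊢
  rw [← neg_eq_zero, ← this]
  abel

theorem col {i m j : ℕ} (h : i < m) : X m j * X i j = p⁻¹ • (X i j * X m j) := by
  have := hX i m j j
  simp only [if_true, lt_irrefl, if_false, h.ne, h, zero_smul, add_zero, one_smul, sub_smul] at this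
  rw [← sub_eq_zero] at this ⊢
  rw [← this]
  abel

theorem antidiag {i m j n : ℕ} (h₁ : i < m) (h₂ : j < n) : X m j * X i n = X i n * X m j := by
  have := hX i m j n
  simpa [h₁, h₁.ne, h₂, h₂.ne] using this

theorem diag {i m j n : ℕ} (h₁ : i < m) (h₂ : j < n) :
    X m n * X i j = X i j * X m n - (p - p⁻¹) • (X i n * X m j) := by
  have := hX i m n j
  simp only [h₁, h₁.ne, h₂.ne', h₂.not_gt, if_true, if_false, one_smul, zero_smul, add_zero] at this
  exact eq_sub_of_add_eq this

theorem mul_diag (y : A) {i m j n : ℕ} (h₁ : i < m) (h₂ : j < n) :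
    y * (X m n * X i j) = y * (X i j * X m n) - (p - p⁻¹) • (y * (X i n * X m j)) := by
  rw [hX.diag h₁ h₂, mul_sub, mul_smul_comm]

theorem diag_of_eq_zero {i m j n : ℕ} (h₁ : i < m) (h₂ : j < n) (h₀ : X m j = 0) :
    X m n * X i j = X i j * X m n := by
  rw [hX.diag h₁ h₂, h₀, mul_zero, smul_zero, sub_zero]

end IsQuantumMatrix

/-- The upper triangular matrix with entries `c s * t j` for `s ≤ j ≤ r`, extended by an
identity block. -/
def cornerMatrix {A : Type*} [Ring A] (r : ℕ) (c t : ℕ → A) (s j : ℕ) : A :=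
  if r < j then (if s = j then 1 else 0) else if s ≤ j then c s * t j else 0

theorem corner_scalar_identity {K : Type*} [Field K] {p : K} (hp : p ≠ 0) (i m j n : ℕ) :
    (if i = m then p else 1) * (if m ≤ j ∧ i ≤ n then if j < i then p⁻¹ * p⁻¹ else 1 else 0) *
        (if i < m then p⁻¹ else if i = m then 1 else p)
      + (if i < m then p - p⁻¹ else 0) *
        (if i ≤ j ∧ m ≤ n then if j < m then p⁻¹ * p⁻¹ else 1 else 0)
    = (if j = n then p else 1) * (if i ≤ n ∧ m ≤ j then if n < m then p⁻¹ * p⁻¹ else 1 else 0) *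
        (if j < n then p⁻¹ else if j = n then 1 else p)
      + (if j < n then p - p⁻¹ else 0) *
        (if i ≤ j ∧ m ≤ n then if j < m then p⁻¹ * p⁻¹ else 1 else 0) := by
  rcases lt_trichotomy i m with h₁ | h₁ | h₁ <;> rcases lt_trichotomy j n with h₂ | h₂ | h₂ <;>
    first
      | (have h₁' := h₁.ne; have h₁'' := h₁.ne'; have h₁t := h₁.not_gt)
      | subst h₁
  all_goals first
      | (have h₂' := h₂.ne; have h₂'' := h₂.ne'; have h₂t := h₂.not_gt)
      | subst h₂
  all_goals
    simp only [*, lt_irrefl, if_true, if_false, zero_mul, one_mul, mul_one, add_zero] <;>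
    split_ifs <;> first | (exfalso; omega) | (field_simp; done) | (field_simp; ring)

theorem isQuantumMatrix_cornerMatrix {K A : Type*} [Field K] [Ring A] [Algebra K A] {p : K}
    (hp : p ≠ 0) (r : ℕ) {c t : ℕ → A}
    (hc : ∀ i m, i < m → c m * c i = p⁻¹ • (c i * c m))
    (ht : ∀ j n, j < n → t n * t j = p⁻¹ • (t j * t n))
    (htc : ∀ i j, t j * c i = (if j < i then p⁻¹ * p⁻¹ else 1) • (c i * t j)) :
    IsQuantumMatrix p (cornerMatrix r c t) := by
  have hc' : ∀ i m, c m * c i =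
      (if i < m then p⁻¹ else if i = m then 1 else p) • (c i * c m) := by
    intro i m
    rcases lt_trichotomy i m with h | rfl | h
    · simp [h, hc i m h]
    · simp
    · rw [hc m i h, smul_smul]; simp [h.not_gt, h.ne', hp]
  have ht' : ∀ i m, t m * t i =
      (if i < m then p⁻¹ else if i = m then 1 else p) • (t i * t m) := by
    intro i m
    rcases lt_trichotomy i m with h | rfl | h
    · simp [h, ht i m h]
    · simp
    · rw [ht m i h, smul_smul]; simp [h.not_gt, h.ne', hp]
  have prod : ∀ i j m n, j ≤ r → n ≤ r → cornerMatrix r c t i j * cornerMatrix r c t m n =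
      (if i ≤ j ∧ m ≤ n then if j < m then p⁻¹ * p⁻¹ else 1 else 0) •
        (c i * c m * (t j * t n)) := by
    intro i j m n hj hn
    simp only [cornerMatrix, hj.not_gt, hn.not_gt, if_false]
    by_cases h₁ : i ≤ j <;> by_cases h₂ : m ≤ n <;> simp only [h₁, h₂, if_true, if_false,
      and_true, and_false, zero_smul, mul_zero, zero_mul]
    rw [mul_assoc, ← mul_assoc (t j), htc, smul_mul_assoc, mul_smul_comm]
    noncomm_ring
  intro i m j n
  rcases le_or_gt j r with hj | hj <;> rcases le_or_gt n r with hn | hn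
  · rw [prod m j i n hj hn, prod i j m n hj hn, prod i n m j hn hj, hc' i m, ht' j n]
    rw [smul_mul_assoc, mul_smul_comm]
    generalize c i * c m * (t j * t n) = w
    rw [smul_smul, smul_smul, smul_smul, smul_smul, smul_smul, smul_smul, ← add_smul, ← add_smul]
    congr 1
    exact corner_scalar_identity hp i m j n
  · simp only [cornerMatrix, hj.not_gt, hn, if_false, if_true]
    split_ifs <;> first | (exfalso; omega) | simp
  · simp only [cornerMatrix, hn.not_gt, hj, if_false, if_true]
    split_ifs <;> first | (exfalso; omega) | simp
  · have := IsQuantumMatrix.one (A := A) (p := p) i m j n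
    simpa only [cornerMatrix, hn, hj, if_true] using this

section QuantumTorus

/-- Labels of the generators of the quantum torus: level, kind and index. -/
abbrev TorusIndex : Type := ℕ ×ₗ (ℕ ×ₗ ℕ)

/-- The label with the given level, kind and index. -/
abbrev torusIndex (k d i : ℕ) : TorusIndex := toLex (k, toLex (d, i))

/-- Exponents of monomials in the quantum torus, ordered lexicographically. -/
abbrev TorusExp : Type := Lex (TorusIndex →₀ ℕ)

/-- The exponent of a generator. -/
noncomputable def torusGen (k d i : ℕ) : TorusExp := toLex (Finsupp.single (torusIndex k d i) 1)

/-- The exponent of `p` in the commutation of two generators. Kinds `0` and `1` are the row and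
column variables of a level, kinds `2` and `3` those of the final twist. -/
def torusForm (a b : TorusIndex) : ℤ :=
  if a.1 ≠ b.1 then 0
  else if a.2.1 = b.2.1 ∧ a.2.1 ≤ 1 then (if b.2.2 < a.2.2 then -1 else 0)
  else if a.2.1 = 1 ∧ b.2.1 = 0 then (if a.2.2 < b.2.2 then -2 else 0)
  else if a.2.1 = 3 ∧ b.2.1 = 2 then (if a.2.2 = b.2.2 then -1 else 0)
  else 0

lemma torusForm_mk (k d i k' d' i' : ℕ) :
    torusForm (torusIndex k d i) (torusIndex k' d' i') =
      if k ≠ k' then 0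
      else if d = d' ∧ d ≤ 1 then (if i' < i then -1 else 0)
      else if d = 1 ∧ d' = 0 then (if i < i' then -2 else 0)
      else if d = 3 ∧ d' = 2 then (if i = i' then -1 else 0)
      else 0 :=
  rfl

/-- `torusForm a` extended additively in the second variable. -/
noncomputable def torusPairing (a : TorusIndex) : TorusExp →+ ℤ :=
  (Finsupp.liftAddHom fun b => (AddMonoidHom.mulRight (torusForm a b)).comp
    (Nat.castAddMonoidHom ℤ)).comp (ofLexAddEquiv (TorusIndex →₀ ℕ)).toAddMonoidHom

lemma torusPairing_gen (a : TorusIndex) (k d i : ℕ) :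
    torusPairing a (torusGen k d i) = torusForm a (torusIndex k d i) := by
  simp [torusPairing, torusGen]

variable {K : Type*} [Field K] (p : K)

/-- A generator of the quantum torus, acting on the span of all monomials. -/
noncomputable def torusOp (k d i : ℕ) : Module.End K (TorusExp →₀ K) :=
  Finsupp.linearCombination K fun v =>
    Finsupp.single (torusGen k d i + v) (p ^ torusPairing (torusIndex k d i) v)

lemma torusOp_single (k d i : ℕ) (v : TorusExp) (x : K) :
    torusOp p k d i (Finsupp.single v x) =
      Finsupp.single (torusGen k d i + v) (x * p ^ torusPairing (torusIndex k d i) v) := by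
  simp [torusOp]

variable {p}

lemma torusOp_mul (hp : p ≠ 0) (k d i k' d' i' : ℕ) :
    torusOp p k d i * torusOp p k' d' i' =
      p ^ (torusForm (torusIndex k d i) (torusIndex k' d' i')
        - torusForm (torusIndex k' d' i') (torusIndex k d i)) •
        (torusOp p k' d' i' * torusOp p k d i) := by
  refine Finsupp.lhom_ext fun v x => ?_
  simp only [Module.End.mul_apply, LinearMap.smul_apply, torusOp_single, map_add,
    torusPairing_gen, Finsupp.smul_single, smul_eq_mul]
  rw [add_left_comm]
  congr 1
  rw [zpow_sub₀ hp, zpow_add₀ hp, zpow_add₀ hp]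
  have := zpow_ne_zero (torusForm (torusIndex k' d' i') (torusIndex k d i)) hp
  field_simp

lemma torusOp_mul_of_form (hp : p ≠ 0) {k d i k' d' i' : ℕ} {z : ℤ}
    (h : torusForm (torusIndex k d i) (torusIndex k' d' i')
        - torusForm (torusIndex k' d' i') (torusIndex k d i) = z) :
    torusOp p k d i * torusOp p k' d' i' = p ^ z • (torusOp p k' d' i' * torusOp p k d i) :=
  h ▸ torusOp_mul hp k d i k' d' i'

lemma torusOp_commute (hp : p ≠ 0) {k d i k' d' i' : ℕ}
    (h : torusForm (torusIndex k d i) (torusIndex k' d' i')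
        = torusForm (torusIndex k' d' i') (torusIndex k d i)) :
    Commute (torusOp p k d i) (torusOp p k' d' i') := by
  have := torusOp_mul_of_form hp (sub_eq_zero.2 h)
  rwa [zpow_zero, one_smul] at this

lemma hasLead_torusOp (hp : p ≠ 0) (k d i : ℕ) : HasLead (torusOp p k d i) (torusGen k d i) := by
  intro v e he hv
  have h₁ : ∀ (v : TorusExp →₀ K) (e : TorusExp), torusOp p k d i v (torusGen k d i + e) =
      v e * p ^ torusPairing (torusIndex k d i) e := by
    intro v e
    induction v using Finsupp.induction_linear with
    | zero => simp
    | add v w hv hw => simp [hv, hw, add_mul]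
    | single u x =>
      rw [torusOp_single]
      by_cases hu : u = e
      · simp [hu]
      · rw [Finsupp.single_eq_of_ne (by simpa [eq_comm] using hu),
          Finsupp.single_eq_of_ne (Ne.symm hu), zero_mul]
  have h₂ : ∀ (v : TorusExp →₀ K) (e' : TorusExp), (∀ e, e' ≠ torusGen k d i + e) →
      torusOp p k d i v e' = 0 := by
    intro v e' he'
    induction v using Finsupp.induction_linear with
    | zero => simp
    | add v w hv hw => simp [hv, hw]
    | single u x => rw [torusOp_single, Finsupp.single_eq_of_ne (he' u)]
  refine ⟨by rw [h₁]; exact mul_ne_zero he (zpow_ne_zero _ hp), fun e' he' => ?_⟩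
  by_cases hr : ∃ u, e' = torusGen k d i + u
  · obtain ⟨u, rfl⟩ := hr
    rw [h₁] at he'
    have := hv u (left_ne_zero_of_mul he')
    gcongr
  · exact absurd (h₂ v e' (not_exists.1 hr)) he'

variable (p)

/-- An upper triangular quantum matrix over the quantum torus, built as a product of `r` corner
matrices; only the rows and columns below `r` differ from the identity matrix. -/
noncomputable def torusMatrix (M : ℕ) : ℕ → ℕ → ℕ → Module.End K (TorusExp →₀ K)
  | 0, i, j => if i = j then 1 else 0
  | r + 1, i, j => ∑ s ∈ Finset.range M,
      cornerMatrix r (torusOp p r 0) (torusOp p r 1) i s * torusMatrix M r s j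

variable {p}

lemma commute_cornerMatrix {A : Type*} [Ring A] {r : ℕ} {c t : ℕ → A} {y : A}
    (hc : ∀ i, Commute y (c i)) (ht : ∀ i, Commute y (t i)) (i j : ℕ) :
    Commute y (cornerMatrix r c t i j) := by
  unfold cornerMatrix
  split_ifs
  · exact Commute.one_right _
  · exact Commute.zero_right _
  · exact (hc i).mul_right (ht j)
  · exact Commute.zero_right _

lemma commute_torusMatrix {M r : ℕ} {y : Module.End K (TorusExp →₀ K)}
    (h : ∀ k < r, ∀ d < 2, ∀ i, Commute y (torusOp p k d i)) (i j : ℕ) :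
    Commute y (torusMatrix p M r i j) := by
  induction r generalizing i with
  | zero =>
    unfold torusMatrix
    split_ifs
    · exact Commute.one_right _
    · exact Commute.zero_right _
  | succ r ih =>
    unfold torusMatrix
    refine Commute.sum_right _ _ _ fun s _ => Commute.mul_right ?_
      (ih (fun k hk => h k (hk.trans r.lt_succ_self)) s)
    exact commute_cornerMatrix (h r r.lt_succ_self 0 (by norm_num))
      (h r r.lt_succ_self 1 (by norm_num)) _ _

theorem isQuantumMatrix_torusMatrix (hp : p ≠ 0) (M r : ℕ) :
    IsQuantumMatrix p (torusMatrix p M r) := by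
  induction r with
  | zero => exact IsQuantumMatrix.one
  | succ r ih =>
    have hform : ∀ k < r, ∀ d d' i i', torusForm (torusIndex r d i) (torusIndex k d' i') =
        torusForm (torusIndex k d' i') (torusIndex r d i) := by
      intro k hk d d' i i'
      simp [torusForm_mk, hk.ne, hk.ne']
    refine IsQuantumMatrix.mul (isQuantumMatrix_cornerMatrix hp r ?_ ?_ ?_) ih ?_ M
    · intro i m him
      rw [torusOp_mul_of_form hp (z := -1) (by simp [torusForm_mk, him, him.not_gt]), zpow_neg_one]
    · intro i m him
      rw [torusOp_mul_of_form hp (z := -1) (by simp [torusForm_mk, him, him.not_gt]), zpow_neg_one]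
    · intro i j
      rw [torusOp_mul_of_form hp (z := if j < i then -2 else 0) (by simp [torusForm_mk])]
      split_ifs
      · rw [zpow_neg]; simp [zpow_ofNat, pow_two]
      · simp
    · intro i j k l
      refine commute_torusMatrix (fun k' hk' d _ i' => ?_) k l
      exact (commute_cornerMatrix (fun _ => torusOp_commute hp (hform k' hk' _ _ _ _).symm)
        (fun _ => torusOp_commute hp (hform k' hk' _ _ _ _).symm) i j).symm

lemma torusMatrix_of_le {M r : ℕ} (i : ℕ) {j : ℕ} (hr : r ≤ j) (hj : j < M) :
    torusMatrix p M r i j = if i = j then 1 else 0 := by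
  induction r generalizing i with
  | zero => rfl
  | succ r ih =>
    unfold torusMatrix
    simp only [ih _ (Nat.le_of_succ_le hr), mul_ite, mul_one, mul_zero, Finset.sum_ite_eq',
      Finset.mem_range, hj, if_true]
    simp [cornerMatrix, Nat.lt_of_succ_le hr]

lemma torusMatrix_of_gt {M : ℕ} (r : ℕ) {i j : ℕ} (hij : j < i) : torusMatrix p M r i j = 0 := by
  induction r generalizing i with
  | zero => simp [torusMatrix, hij.ne']
  | succ r ih =>
    unfold torusMatrix
    refine Finset.sum_eq_zero fun s _ => ?_
    rcases lt_or_ge j s with hs | hs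
    · rw [ih hs, mul_zero]
    · have : ¬ i ≤ s := by omega
      have : ¬ i = s := by omega
      simp [cornerMatrix, *]

/-- The leading exponent of an entry of `torusMatrix`. -/
noncomputable def torusMatrixExp : ℕ → ℕ → ℕ → TorusExp
  | 0, _, _ => 0
  | r + 1, i, j => torusGen r 0 i +
      if j = r then torusGen r 1 r else torusGen r 1 i + torusMatrixExp r i j

lemma torusGen_apply (k d i k' d' i' : ℕ) : ofLex (torusGen k d i) (torusIndex k' d' i') =
    if k = k' ∧ d = d' ∧ i = i' then 1 else 0 := by
  simp [torusGen, Finsupp.single_apply]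

lemma torusMatrixExp_zero_kind {r j : ℕ} (hj : j < r) (i k l : ℕ) :
    ofLex (torusMatrixExp r i j) (torusIndex k 0 l) =
      if i = l ∧ j ≤ k ∧ k < r then 1 else 0 := by
  induction r with
  | zero => omega
  | succ r ih =>
    unfold torusMatrixExp
    by_cases hjr : j = r
    · subst hjr
      simp only [if_true, ofLex_add, Finsupp.add_apply, torusGen_apply]
      grind
    · have := ih (by omega)
      simp only [hjr, if_false, ofLex_add, Finsupp.add_apply, torusGen_apply, this]
      grind

lemma torusMatrixExp_of_level_lt {r j : ℕ} (i k d l : ℕ)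
    (hk : k < j) (hj : j < r) : ofLex (torusMatrixExp r i j) (torusIndex k d l) = 0 := by
  induction r with
  | zero => omega
  | succ r ih =>
    unfold torusMatrixExp
    by_cases hjr : j = r
    · subst hjr
      simp [torusGen_apply, hk.ne']
    · have := ih (by omega)
      have : r ≠ k := by omega
      simp [torusGen_apply, *]

lemma torusMatrixExp_lt {r i s j : ℕ} (his : i < s) (hj : j < r) :
    torusGen r 0 i + torusGen r 1 s + torusMatrixExp r s j <
      torusGen r 0 i + torusGen r 1 i + torusMatrixExp r i j := by
  rw [Finsupp.Lex.lt_iff]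
  have hrj : r ≠ j := hj.ne'
  refine ⟨torusIndex j 0 i, fun a ha => ?_, ?_⟩
  · obtain ⟨k, d, l, rfl⟩ : ∃ k d l, a = torusIndex k d l := ⟨a.1, a.2.1, a.2.2, rfl⟩
    rw [Prod.Lex.toLex_lt_toLex, Prod.Lex.toLex_lt_toLex] at ha
    simp only [ofLex_add, Finsupp.add_apply, torusGen_apply]
    have hkr : r ≠ k := by omega
    rcases lt_or_ge k j with hk | hk
    · simp [hkr, torusMatrixExp_of_level_lt _ _ _ _ hk hj]
    · obtain rfl : d = 0 := by omega
      simp only [torusMatrixExp_zero_kind hj]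
      grind
  · simp only [ofLex_add, Finsupp.add_apply, torusGen_apply, torusMatrixExp_zero_kind hj]
    grind

theorem hasLead_torusMatrix (hp : p ≠ 0) {M r i j : ℕ} (hij : i ≤ j) (hj : j < r) (hr : r ≤ M) :
    HasLead (torusMatrix p M r i j) (torusMatrixExp r i j) := by
  induction r generalizing i with
  | zero => omega
  | succ r ih =>
    unfold torusMatrix torusMatrixExp
    by_cases hjr : j = r
    · subst hjr
      simp only [torusMatrix_of_le _ le_rfl (Nat.lt_of_succ_le hr), mul_ite, mul_one, mul_zero,
        Finset.sum_ite_eq', Finset.mem_range, Nat.lt_of_succ_le hr, if_true]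
      simpa [cornerMatrix, hij] using (hasLead_torusOp hp j 0 i).mul (hasLead_torusOp hp j 1 j)
    · have hjr' : j < r := by omega
      rw [if_neg hjr, ← add_assoc, ← Finset.add_sum_erase _ _ (Finset.mem_range.2
        (show i < M by omega))]
      refine HasLead.add_sum_of_lt (φ := fun s => torusGen r 0 i + torusGen r 1 s +
        torusMatrixExp r s j) _ ?_ ?_
      · have : ¬ r < i := by omega
        simpa [cornerMatrix, this] using ((hasLead_torusOp hp r 0 i).mul
          (hasLead_torusOp hp r 1 i)).mul (ih hij hjr' (by omega))
      · intro s hs hne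
        have hsj : s ≤ j := by
          by_contra hlt
          exact hne (by rw [torusMatrix_of_gt r (not_le.1 hlt), mul_zero])
        have hsr : ¬ r < s := by omega
        have his : i ≤ s := by
          by_contra hlt
          exact hne (by simp [cornerMatrix, hsr, hlt])
        have his' : i < s := lt_of_le_of_ne his (Finset.ne_of_mem_erase hs).symm
        refine ⟨?_, torusMatrixExp_lt his' hjr'⟩
        simpa [cornerMatrix, hsr, his] using ((hasLead_torusOp hp r 0 i).mul
          (hasLead_torusOp hp r 1 s)).mul (ih hsj hjr' (by omega))

end QuantumTorus

instance (N : ℕ) : Finite (Lam N) :=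
  Set.Finite.to_subtype <| ((Set.finite_Iic (N + 1)).prod (Set.finite_Iic (N + 1))).subset
    fun _ h => ⟨h.2.1.le.trans h.2.2, h.2.2⟩

lemma Lam.lt_iff {N : ℕ} {a b : Lam N} :
    a < b ↔ a.1.1 < b.1.1 ∨ a.1.1 = b.1.1 ∧ a.1.2 < b.1.2 :=
  Prod.Lex.toLex_lt_toLex (x := a.1) (y := b.1)

section HomogenizedJimbo

variable {K : Type} [Field K] {q : K} {N : ℕ}

lemma adjoin_range_xh : Algebra.adjoin K (Set.range (xh K q N)) = ⊤ := by
  have : Set.range (xh K q N) =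
      RingQuot.mkAlgHom K (HJimboRel K q N) '' Set.range (FreeAlgebra.ι K) := by
    rw [← Set.range_comp]; rfl
  rw [this, ← AlgHom.map_adjoin, FreeAlgebra.adjoin_range_ι, Algebra.map_top,
    AlgHom.range_eq_top]
  exact RingQuot.mkAlgHom_surjective K _

lemma isOreTower_xh (hq : q ≠ 0) : IsOreTower (K := K) (xh K q N) := by
  intro a b hab
  have hq2 : q ^ 2 ≠ 0 := pow_ne_zero 2 hq
  have of_eq : ∀ c : K, c ≠ 0 → HJimboRel K q N (FreeAlgebra.ι K b * FreeAlgebra.ι K a)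
      (c • (FreeAlgebra.ι K a * FreeAlgebra.ι K b)) → ∃ c : K, c ≠ 0 ∧
      xh K q N b * xh K q N a - c • (xh K q N a * xh K q N b) ∈
        Algebra.adjoin K (xh K q N '' Set.Iio b) := by
    intro c hc h
    have := RingQuot.mkAlgHom_rel K h
    rw [map_mul, map_smul, map_mul] at this
    exact ⟨c, hc, by rw [xh, xh, this, sub_self]; exact zero_mem _⟩
  obtain ⟨ha₁, ha₂, ha₃⟩ := a.2
  obtain ⟨hb₁, hb₂, hb₃⟩ := b.2
  rcases Lam.lt_iff.1 hab with him | ⟨him, hjn⟩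
  swap
  · exact of_eq _ (inv_ne_zero hq2) (.c1 a b him hjn)
  rcases lt_trichotomy a.1.2 b.1.1 with h | h | h
  · exact of_eq 1 one_ne_zero (by rw [one_smul]; exact .c6 a b h)
  · exact of_eq _ hq2 (.c5 a b h)
  rcases lt_trichotomy a.1.2 b.1.2 with h' | h' | h'
  · let c : Lam N := ⟨(a.1.1, b.1.2), ha₁, him.trans hb₂, hb₃⟩
    let d : Lam N := ⟨(b.1.1, a.1.2), hb₁, h, ha₃⟩
    have := RingQuot.mkAlgHom_rel K (HJimboRel.c4 (q := q) a b c d him h h' rfl rfl)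
    rw [map_mul, map_sub, map_smul, map_mul, map_mul] at this
    refine ⟨1, one_ne_zero, ?_⟩
    rw [xh, xh, this, one_smul, sub_sub_cancel_left]
    refine neg_mem (Subalgebra.smul_mem _ (mul_mem ?_ ?_) _)
    · exact Algebra.subset_adjoin ⟨c, Lam.lt_iff.2 (Or.inl him), rfl⟩
    · exact Algebra.subset_adjoin ⟨d, Lam.lt_iff.2 (Or.inr ⟨rfl, h'⟩), rfl⟩
  · exact of_eq _ (inv_ne_zero hq2) (.c3 a b him h')
  · exact of_eq 1 one_ne_zero (by rw [one_smul]; exact .c2 a b him h')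

/-- The twist factor for the generator `x_{ij}`. -/
noncomputable def torusTwist (p : K) (i j : ℕ) : Module.End K (TorusExp →₀ K) :=
  torusOp p 0 2 i * torusOp p 0 3 j

lemma torusTwist_mul {p : K} (hp : p ≠ 0) (i j m n : ℕ) :
    torusTwist p i j * torusTwist p m n = (if j = m then p⁻¹ else 1) •
      (torusOp p 0 2 i * torusOp p 0 2 m * (torusOp p 0 3 j * torusOp p 0 3 n)) := by
  have h := torusOp_mul_of_form hp (k := 0) (d := 3) (i := j) (k' := 0) (d' := 2) (i' := m)
    (z := if j = m then -1 else 0) (by simp [torusForm_mk])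
  have h' : p ^ (if j = m then -1 else 0 : ℤ) = if j = m then p⁻¹ else 1 := by
    split_ifs <;> simp
  rw [h'] at h
  rw [torusTwist, torusTwist, mul_assoc, ← mul_assoc (torusOp p 0 3 j), h]
  simp only [smul_mul_assoc, mul_smul_comm, mul_assoc]

lemma torusTwist_mul_comm {p : K} (hp : p ≠ 0) {i j m n : ℕ} (hin : n ≠ i) :
    torusTwist p i j * torusTwist p m n =
      (if j = m then p⁻¹ else 1) • (torusTwist p m n * torusTwist p i j) := by
  have h₂ : Commute (torusOp p 0 2 i) (torusOp p 0 2 m) :=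
    torusOp_commute hp (by simp [torusForm_mk])
  have h₃ : Commute (torusOp p 0 3 j) (torusOp p 0 3 n) :=
    torusOp_commute hp (by simp [torusForm_mk])
  rw [torusTwist_mul hp, torusTwist_mul hp m, if_neg hin, one_smul, h₂.eq, h₃.eq]

lemma commute_torusTwist {p : K} (hp : p ≠ 0) (M r i j k l : ℕ) :
    Commute (torusTwist p i j) (torusMatrix p M r k l) := by
  refine commute_torusMatrix (fun s _ d hd t => .mul_left ?_ ?_) k l <;>
  · refine torusOp_commute hp ?_
    rw [torusForm_mk, torusForm_mk]
    grind

/-- The image of `x_{ij}` in the quantum torus. -/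
noncomputable def torusImage (p : K) (N i j : ℕ) : Module.End K (TorusExp →₀ K) :=
  torusTwist p i j * torusMatrix p (N + 1) (N + 1) i (j - 1)

lemma torusImage_mul {p : K} (hp : p ≠ 0) (N i j m n : ℕ) :
    torusImage p N i j * torusImage p N m n = torusTwist p i j * torusTwist p m n *
      (torusMatrix p (N + 1) (N + 1) i (j - 1) * torusMatrix p (N + 1) (N + 1) m (n - 1)) := by
  rw [torusImage, torusImage, mul_assoc, ← mul_assoc (torusMatrix _ _ _ _ _),
    ← (commute_torusTwist hp _ _ _ _ _ _).eq]
  simp only [mul_assoc]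

lemma torusImage_rel (hq : q ≠ 0) ⦃x y : FreeAlgebra K (Lam N)⦄ (h : HJimboRel K q N x y) :
    FreeAlgebra.lift K (fun a : Lam N => torusImage (q ^ 2) N a.1.1 a.1.2) x =
      FreeAlgebra.lift K (fun a : Lam N => torusImage (q ^ 2) N a.1.1 a.1.2) y := by
  have hp : q ^ 2 ≠ 0 := pow_ne_zero 2 hq
  have hX := isQuantumMatrix_torusMatrix hp (N + 1) (N + 1)
  have comm : ∀ a b : Lam N, a.1.1 ≤ b.1.1 →
      torusTwist (q ^ 2) a.1.1 a.1.2 * torusTwist (q ^ 2) b.1.1 b.1.2 =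
        (if a.1.2 = b.1.1 then (q ^ 2)⁻¹ else 1) •
          (torusTwist (q ^ 2) b.1.1 b.1.2 * torusTwist (q ^ 2) a.1.1 a.1.2) := fun a b h =>
    torusTwist_mul_comm hp (h.trans_lt b.2.2.1).ne'
  cases h with
  | c1 a b h h' =>
    simp only [map_mul, map_smul, FreeAlgebra.lift_ι_apply, torusImage_mul hp]
    have := a.2
    rw [comm a b h.le, if_neg (by omega), one_smul, ← h, hX.row (by omega), mul_smul_comm]
  | c3 a b h h' =>
    simp only [map_mul, map_smul, FreeAlgebra.lift_ι_apply, torusImage_mul hp]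
    have := b.2
    rw [comm a b h.le, if_neg (by omega), one_smul, h', hX.col h, mul_smul_comm]
  | c2 a b h h' =>
    simp only [map_mul, FreeAlgebra.lift_ι_apply, torusImage_mul hp]
    have := b.2
    rw [comm a b h.le, if_neg (by omega), one_smul, hX.antidiag h (by omega)]
  | c6 a b h =>
    simp only [map_mul, FreeAlgebra.lift_ι_apply, torusImage_mul hp]
    have := a.2
    have := b.2
    rw [comm a b (by omega), if_neg (by omega), one_smul, hX.diag_of_eq_zero (by omega) (by omega)
        (torusMatrix_of_gt _ (by omega))]
  | c5 a b h =>
    simp only [map_mul, map_smul, FreeAlgebra.lift_ι_apply, torusImage_mul hp]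
    have := a.2
    have := b.2
    rw [comm a b (by omega), if_pos h, smul_mul_assoc, smul_smul, mul_inv_cancel₀ hp, one_smul,
      hX.diag_of_eq_zero (by omega) (by omega)
        (torusMatrix_of_gt _ (by omega))]
  | c4 a b c d h h' h'' hc hd =>
    simp only [map_mul, map_smul, map_sub, FreeAlgebra.lift_ι_apply, torusImage_mul hp, hc, hd]
    have := a.2
    have := b.2
    have h₃ : torusTwist (q ^ 2) a.1.1 b.1.2 * torusTwist (q ^ 2) b.1.1 a.1.2 =
        torusTwist (q ^ 2) b.1.1 b.1.2 * torusTwist (q ^ 2) a.1.1 a.1.2 := by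
      have h₂ : Commute (torusOp (q ^ 2) 0 2 a.1.1) (torusOp (q ^ 2) 0 2 b.1.1) :=
        torusOp_commute hp (by simp [torusForm_mk])
      rw [torusTwist_mul hp, torusTwist_mul hp, if_neg (by omega), if_neg (by omega), h₂.eq]
    rw [comm a b h.le, if_neg (by omega), one_smul, h₃, hX.mul_diag _ h (by omega)]

/-- The representation of `Ah` on the span of the monomials in the quantum torus. -/
noncomputable def torusRep (N : ℕ) (hq : q ≠ 0) : Ah K q N →ₐ[K] Module.End K (TorusExp →₀ K) :=
  RingQuot.liftAlgHom K ⟨_, torusImage_rel hq⟩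

/-- The leading exponent of `torusImage`. -/
noncomputable def torusImageExp (N i j : ℕ) : TorusExp :=
  torusGen 0 2 i + torusGen 0 3 j + torusMatrixExp (N + 1) i (j - 1)

lemma hasLead_torusRep (hq : q ≠ 0) (a : Lam N) :
    HasLead (torusRep N hq (xh K q N a)) (torusImageExp N a.1.1 a.1.2) := by
  have hp : q ^ 2 ≠ 0 := pow_ne_zero 2 hq
  have ha := a.2
  have : torusRep N hq (xh K q N a) = torusImage (q ^ 2) N a.1.1 a.1.2 := by
    rw [torusRep, xh, RingQuot.liftAlgHom_mkAlgHom_apply, FreeAlgebra.lift_ι_apply]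
  rw [this]
  exact ((hasLead_torusOp hp _ _ _).mul (hasLead_torusOp hp _ _ _)).mul
    (hasLead_torusMatrix hp (by omega) (by omega) le_rfl)

/-- The exponent of a generator, as an additive functional. -/
noncomputable def torusCoord (k d i : ℕ) : TorusExp →+ ℤ :=
  (Nat.castAddMonoidHom ℤ).comp <| (Finsupp.applyAddHom (torusIndex k d i)).comp
    (ofLexAddEquiv (TorusIndex →₀ ℕ)).toAddMonoidHom

lemma torusCoord_apply (k d i : ℕ) (v : TorusExp) :
    torusCoord k d i v = (ofLex v (torusIndex k d i) : ℤ) :=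
  rfl

lemma torusCoord_sub_torusImageExp (a b : Lam N) :
    (torusCoord (a.1.2 - 1) 0 a.1.1 - torusCoord (a.1.2 - 1 - 1) 0 a.1.1)
      (torusImageExp N b.1.1 b.1.2) = if a = b then 1 else 0 := by
  have ha := a.2
  have hb := b.2
  have hab : a = b ↔ b.1.1 = a.1.1 ∧ b.1.2 = a.1.2 := by
    rw [eq_comm]
    exact Subtype.ext_iff.trans Prod.ext_iff
  have hb' : b.1.2 - 1 < N + 1 := by omega
  simp only [AddMonoidHom.sub_apply, torusCoord_apply, torusImageExp, ofLex_add,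
    Finsupp.add_apply, torusGen_apply, torusMatrixExp_zero_kind hb', hab]
  grind

end HomogenizedJimbo

/-- If q^8 ≠ 1 then A_h is a domain and is left and right Noetherian. -/
theorem ah_domain_noetherian (K : Type) [Field K] (q : K) (hq0 : q ≠ 0)
    (hq8 : q ^ 8 ≠ 1) (N : ℕ) (hN : 1 ≤ N) :
    Nontrivial (Ah K q N) ∧
    (∀ f g : Ah K q N, f * g = 0 → f = 0 ∨ g = 0) ∧
    (∀ c : ℕ →o Submodule (Ah K q N) (Ah K q N), ∃ n, ∀ m, n ≤ m → c n = c m) ∧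
    (∀ c : ℕ →o Submodule (Ah K q N)ᵐᵒᵖ (Ah K q N), ∃ n, ∀ m, n ≤ m → c n = c m) := by
  have hT : IsOreTower (K := K) (xh K q N) := isOreTower_xh hq0
  have hlead := hT.exists_hasLead adjoin_range_xh (torusRep N hq0) _ (hasLead_torusRep hq0) _
    torusCoord_sub_torusImageExp
  refine ⟨(torusRep N hq0).toRingHom.domain_nontrivial, fun f g hfg => ?_,
    monotone_stabilizes_iff_noetherian.2 (hT.isNoetherianRing adjoin_range_xh),
    monotone_stabilizes_iff_noetherian.2 ?_⟩
  · by_contra! h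
    exact mul_ne_zero_of_hasLead _ hlead h.1 h.2 hfg
  · have := hT.isNoetherianRing_op adjoin_range_xh
    have e : Ah K q N ≃ₗ[(Ah K q N)ᵐᵒᵖ] (Ah K q N)ᵐᵒᵖ :=
      { MulOpposite.opAddEquiv with map_smul' := fun _ _ => rfl }
    exact isNoetherian_of_linearEquiv e.symm
end

section
/- If q^8 ≠ 1, then U_q^-(A_N), the (−)-part presented by the quantum Serre relations, is a domain and is left and right Noetherian. -/
/-- The quantum Serre relations defining U_q^-(A_N): the generators F_0, …, F_{N-1}
(representing F_1, …, F_N) satisfy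
F_i²F_j − (q² + q^{−2})F_iF_jF_i + F_jF_i² = 0 for |i − j| = 1, and
F_iF_j = F_jF_i for |i − j| ≥ 2. -/
inductive SerreRel (K : Type) [Field K] (q : K) (N : ℕ) :
    FreeAlgebra K (Fin N) → FreeAlgebra K (Fin N) → Prop
  | serre : ∀ i j : Fin N, ((i : ℕ) + 1 = (j : ℕ) ∨ (j : ℕ) + 1 = (i : ℕ)) →
      SerreRel K q N
        (FreeAlgebra.ι K i * FreeAlgebra.ι K i * FreeAlgebra.ι K j
          - (q ^ 2 + (q ^ 2)⁻¹) • (FreeAlgebra.ι K i * FreeAlgebra.ι K j * FreeAlgebra.ι K i)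
          + FreeAlgebra.ι K j * FreeAlgebra.ι K i * FreeAlgebra.ι K i) 0
  | comm : ∀ i j : Fin N, ((i : ℕ) + 2 ≤ (j : ℕ) ∨ (j : ℕ) + 2 ≤ (i : ℕ)) →
      SerreRel K q N (FreeAlgebra.ι K i * FreeAlgebra.ι K j)
        (FreeAlgebra.ι K j * FreeAlgebra.ι K i)

/-- U_q^-(A_N): the free algebra on F_1, …, F_N modulo the quantum Serre relations. -/
abbrev UqMinus (K : Type) [Field K] (q : K) (N : ℕ) := RingQuot (SerreRel K q N)

/-- The image of the generator F_i in U_q^-(A_N). -/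
noncomputable def fg (K : Type) [Field K] (q : K) (N : ℕ) (i : Fin N) : UqMinus K q N :=
  RingQuot.mkAlgHom K (SerreRel K q N) (FreeAlgebra.ι K i)

section Ore

variable {A R : Type*} [Ring A] [Ring R] (φ : A →+* R) (x : R)

/-- The left `A`-span of the powers `x ^ i` with `i < n`. -/
def powSpan : ℕ → AddSubgroup R
  | 0 => ⊥
  | n + 1 =>
    { carrier := {y | ∃ a, y - φ a * x ^ n ∈ powSpan n}
      zero_mem' := ⟨0, by simp⟩
      add_mem' := by
        rintro y z ⟨a, ha⟩ ⟨b, hb⟩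
        refine ⟨a + b, ?_⟩
        have := add_mem ha hb
        rwa [show y - φ a * x ^ n + (z - φ b * x ^ n) = y + z - φ (a + b) * x ^ n by
          rw [map_add]; noncomm_ring] at this
      neg_mem' := by
        rintro y ⟨a, ha⟩
        refine ⟨-a, ?_⟩
        have := neg_mem ha
        rwa [show -(y - φ a * x ^ n) = -y - φ (-a) * x ^ n by
          rw [map_neg]; noncomm_ring] at this }

variable {φ x}

theorem powSpan_le_succ (n : ℕ) : powSpan φ x n ≤ powSpan φ x (n + 1) :=
  fun y hy => ⟨0, by simpa using hy⟩

theorem powSpan_mono : Monotone (powSpan φ x) := monotone_nat_of_le_succ powSpan_le_succ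

theorem coeff_mul_pow_mem_powSpan (a : A) (n : ℕ) : φ a * x ^ n ∈ powSpan φ x (n + 1) :=
  ⟨a, by simp⟩

/-- To prove that an additive map sends `powSpan n` into a subgroup, it suffices to do so on
the spanning elements. -/
theorem powSpan_le {n : ℕ} {S : AddSubgroup R} (h : ∀ a, ∀ i < n, φ a * x ^ i ∈ S) :
    powSpan φ x n ≤ S := by
  induction n with
  | zero => exact bot_le
  | succ n ih =>
    rintro y ⟨a, ha⟩
    have := add_mem (ih (fun a i hi => h a i (by lia)) ha) (h a n (by lia))
    simpa using this

theorem coeff_mul_mem_powSpan (b : A) {n : ℕ} {y : R} (hy : y ∈ powSpan φ x n) :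
    φ b * y ∈ powSpan φ x n := by
  refine powSpan_le (S := (powSpan φ x n).comap (AddMonoidHom.mulLeft (φ b))) ?_ hy
  intro a i hi
  have := coeff_mul_pow_mem_powSpan (φ := φ) (x := x) (b * a) i
  rw [map_mul, mul_assoc] at this
  exact powSpan_mono hi this

theorem mul_var_mem_powSpan {n : ℕ} {y : R} (hy : y ∈ powSpan φ x n) :
    y * x ∈ powSpan φ x (n + 1) := by
  refine powSpan_le (S := (powSpan φ x (n + 1)).comap (AddMonoidHom.mulRight x)) ?_ hy
  intro a i hi
  have := coeff_mul_pow_mem_powSpan (φ := φ) (x := x) a (i + 1)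
  rw [pow_succ, ← mul_assoc] at this
  exact powSpan_mono (show i + 1 + 1 ≤ n + 1 by lia) this

variable (φ x) in
/-- `x * A ⊆ A * x + A`. -/
def LeftMoves : Prop := ∀ a, ∃ a' c, x * φ a = φ a' * x + φ c

variable (φ x) in
/-- `A * x ⊆ x * A + A`. -/
def RightMoves : Prop := ∀ a, ∃ a' c, φ a * x = x * φ a' + φ c

theorem LeftMoves.var_mul_mem_powSpan (h : LeftMoves φ x) {n : ℕ} {y : R}
    (hy : y ∈ powSpan φ x n) : x * y ∈ powSpan φ x (n + 1) := by
  refine powSpan_le (S := (powSpan φ x (n + 1)).comap (AddMonoidHom.mulLeft x)) ?_ hy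
  intro a i hi
  obtain ⟨a', c, e⟩ := h a
  have h1 := coeff_mul_pow_mem_powSpan (φ := φ) (x := x) a' (i + 1)
  have h2 := coeff_mul_pow_mem_powSpan (φ := φ) (x := x) c i
  have := add_mem (powSpan_mono (show i + 1 + 1 ≤ n + 1 by lia) h1)
    (powSpan_mono (show i + 1 ≤ n + 1 by lia) h2)
  rwa [pow_succ', ← mul_assoc, ← add_mul, ← e, mul_assoc] at this

theorem LeftMoves.exists_pow_mul_sub_mem (h : LeftMoves φ x) (b : A) (n : ℕ) :
    ∃ b', x ^ n * φ b - φ b' * x ^ n ∈ powSpan φ x n := by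
  induction n with
  | zero => exact ⟨b, by simp⟩
  | succ n ih =>
    obtain ⟨b', hb'⟩ := ih
    obtain ⟨b'', c, e⟩ := h b'
    refine ⟨b'', ?_⟩
    have := add_mem (h.var_mul_mem_powSpan hb') (coeff_mul_pow_mem_powSpan c n)
    rwa [show x * (x ^ n * φ b - φ b' * x ^ n) + φ c * x ^ n =
      x ^ (n + 1) * φ b - φ b'' * x ^ (n + 1) by
        rw [mul_sub, ← mul_assoc x (φ b'), e, pow_succ']; noncomm_ring] at this

theorem LeftMoves.pow_mul_coeff_mem (h : LeftMoves φ x) (b : A) (n : ℕ) :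
    x ^ n * φ b ∈ powSpan φ x (n + 1) := by
  obtain ⟨b', hb'⟩ := h.exists_pow_mul_sub_mem b n
  exact ⟨b', hb'⟩

theorem LeftMoves.mul_coeff_mem_powSpan (h : LeftMoves φ x) (b : A) {n : ℕ} {y : R}
    (hy : y ∈ powSpan φ x n) : y * φ b ∈ powSpan φ x n := by
  refine powSpan_le (S := (powSpan φ x n).comap (AddMonoidHom.mulRight (φ b))) ?_ hy
  intro a i hi
  have := coeff_mul_mem_powSpan a (h.pow_mul_coeff_mem b i)
  rw [← mul_assoc] at this
  exact powSpan_mono hi this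

theorem RightMoves.exists_mul_pow_sub_mem (h : RightMoves φ x) (hl : LeftMoves φ x) (b : A)
    (n : ℕ) : ∃ b', φ b * x ^ n - x ^ n * φ b' ∈ powSpan φ x n := by
  induction n with
  | zero => exact ⟨b, by simp⟩
  | succ n ih =>
    obtain ⟨b', hb'⟩ := ih
    obtain ⟨b'', c, e⟩ := h b'
    refine ⟨b'', ?_⟩
    have := add_mem (mul_var_mem_powSpan hb') (hl.pow_mul_coeff_mem c n)
    rwa [show (φ b * x ^ n - x ^ n * φ b') * x + x ^ n * φ c =
      φ b * x ^ (n + 1) - x ^ (n + 1) * φ b'' by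
        rw [sub_mul, mul_assoc (x ^ n) (φ b'), e, pow_succ]; noncomm_ring] at this

/-- The elements `a` such that the left ideal `I` contains an element `x ^ n * a + y` with `y` of
lower degree. -/
def leadingIdeal (hl : LeftMoves φ x) (I : Ideal R) (n : ℕ) : Ideal A where
  carrier := {a | ∃ y ∈ I, y - x ^ n * φ a ∈ powSpan φ x n}
  zero_mem' := ⟨0, by simp⟩
  add_mem' := by
    rintro a b ⟨y, hy, hya⟩ ⟨z, hz, hzb⟩
    refine ⟨y + z, add_mem hy hz, ?_⟩
    have := add_mem hya hzb
    rwa [show y - x ^ n * φ a + (z - x ^ n * φ b) = y + z - x ^ n * φ (a + b) by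
      rw [map_add]; noncomm_ring] at this
  smul_mem' := by
    rintro b a ⟨y, hy, hya⟩
    obtain ⟨b', hb'⟩ := hl.exists_pow_mul_sub_mem b n
    refine ⟨φ b' * y, I.mul_mem_left _ hy, ?_⟩
    have := sub_mem (coeff_mul_mem_powSpan b' hya) (hl.mul_coeff_mem_powSpan a hb')
    rwa [show φ b' * (y - x ^ n * φ a) - (x ^ n * φ b - φ b' * x ^ n) * φ a =
      φ b' * y - x ^ n * φ (b • a) by
        rw [smul_eq_mul, map_mul]; noncomm_ring] at this

theorem leadingIdeal_le_succ (hl : LeftMoves φ x) (I : Ideal R) (n : ℕ) :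
    leadingIdeal hl I n ≤ leadingIdeal hl I (n + 1) := by
  rintro a ⟨y, hy, hya⟩
  refine ⟨x * y, I.mul_mem_left _ hy, ?_⟩
  have := hl.var_mul_mem_powSpan hya
  rwa [mul_sub, ← mul_assoc, ← pow_succ'] at this

theorem le_of_leadingIdeal_le (hl : LeftMoves φ x) (hr : RightMoves φ x)
    (htop : ∀ y, ∃ n, y ∈ powSpan φ x n) {I J : Ideal R} (hJI : J ≤ I)
    (h : ∀ n, leadingIdeal hl I n ≤ leadingIdeal hl J n) : I ≤ J := by
  suffices ∀ n, ∀ y ∈ powSpan φ x n, y ∈ I → y ∈ J by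
    intro y hy
    obtain ⟨n, hn⟩ := htop y
    exact this n y hn hy
  intro n
  induction n with
  | zero =>
    intro y hy _
    rw [show y = 0 from hy]
    exact J.zero_mem
  | succ n ih =>
    rintro y ⟨a, ha⟩ hyI
    obtain ⟨a', ha'⟩ := hr.exists_mul_pow_sub_mem hl a n
    have hy : y - x ^ n * φ a' ∈ powSpan φ x n := by simpa using add_mem ha ha'
    obtain ⟨z, hz, hza⟩ := h n ⟨y, hyI, hy⟩
    have hyz := ih (y - z) (by simpa using sub_mem hy hza) (sub_mem hyI (hJI hz))
    simpa using add_mem hyz hz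

/-- The Hilbert basis theorem for a ring generated over a left Noetherian ring by an element `x`
with `x * A + A = A * x + A`. -/
theorem isNoetherianRing_of_moves [IsNoetherianRing A] (hl : LeftMoves φ x)
    (hr : RightMoves φ x) (htop : ∀ y, ∃ n, y ∈ powSpan φ x n) : IsNoetherianRing R := by
  refine (isNoetherianRing_iff_ideal_fg R).2 fun I => ?_
  obtain ⟨n₀, hn₀⟩ := monotone_stabilizes_iff_noetherian.2 ‹IsNoetherianRing A›
    ⟨leadingIdeal hl I, monotone_nat_of_le_succ (leadingIdeal_le_succ hl I)⟩
  choose s hs using fun n => IsNoetherian.noetherian (leadingIdeal hl I n)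
  have hlift : ∀ n a, ∃ y, a ∈ leadingIdeal hl I n →
      y ∈ I ∧ y - x ^ n * φ a ∈ powSpan φ x n := by
    intro n a
    by_cases h : a ∈ leadingIdeal hl I n
    · obtain ⟨y, hy⟩ := h
      exact ⟨y, fun _ => hy⟩
    · exact ⟨0, fun h' => (h h').elim⟩
  choose g hg using hlift
  classical
  let t : Finset R := (Finset.range (n₀ + 1)).biUnion fun n => (s n).image (g n)
  have hmem : ∀ n, ∀ a ∈ s n, a ∈ leadingIdeal hl I n := fun n a ha => by
    rw [← hs n]; exact Submodule.subset_span ha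
  have hJI : Ideal.span (t : Set R) ≤ I := by
    refine Ideal.span_le.2 fun y hy => ?_
    simp only [t, Finset.coe_biUnion, Finset.coe_image, Set.mem_iUnion, Set.mem_image] at hy
    obtain ⟨n, -, a, ha, rfl⟩ := hy
    exact (hg n a (hmem n a ha)).1
  have hle : ∀ n ≤ n₀, leadingIdeal hl I n ≤ leadingIdeal hl (Ideal.span (t : Set R)) n := by
    intro n hn
    rw [← hs n]
    refine Submodule.span_le.2 fun a ha => ⟨g n a, Ideal.subset_span ?_, (hg n a (hmem n a ha)).2⟩
    simp only [t, Finset.coe_biUnion, Finset.coe_image, Set.mem_iUnion, Set.mem_image]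
    exact ⟨n, by simpa using Nat.lt_succ_of_le hn, a, ha, rfl⟩
  refine ⟨t, le_antisymm hJI (le_of_leadingIdeal_le hl hr htop hJI fun n => ?_)⟩
  rcases le_total n n₀ with hn | hn
  · exact hle n hn
  · calc leadingIdeal hl I n = leadingIdeal hl I n₀ := (hn₀ n hn).symm
      _ ≤ leadingIdeal hl (Ideal.span (t : Set R)) n₀ := hle n₀ le_rfl
      _ ≤ _ := monotone_nat_of_le_succ (leadingIdeal_le_succ hl _) hn

end Ore

section SerreFamily

variable {K A : Type*} [Field K] [Ring A] [Algebra K A] {v : K}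

/-- The cubic quantum Serre relation with parameter `v`. -/
def CubicRel (v : K) (a b : A) : Prop :=
  a * a * b - (v + v⁻¹) • (a * b * a) + b * a * a = 0

/-- A sequence satisfying the quantum Serre relations of type `A` with parameter `v`. -/
structure SerreFamily (v : K) (f : ℕ → A) : Prop where
  cubic_succ : ∀ i, CubicRel v (f i) (f (i + 1))
  cubic_pred : ∀ i, CubicRel v (f (i + 1)) (f i)
  commute : ∀ i j, i + 2 ≤ j → Commute (f i) (f j)

/-- The `v`-commutator. -/
def vcomm (v : K) (a b : A) : A := a * b - v • (b * a)

theorem CubicRel.mul_vcomm {a b : A} (h : CubicRel v a b) (hv : v ≠ 0) :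
    vcomm v a b * a = v • (a * vcomm v a b) := by
  have : vcomm v a b * a - v • (a * vcomm v a b) =
      -v • (a * a * b - (v + v⁻¹) • (a * b * a) + b * a * a) := by
    simp only [vcomm, mul_sub, sub_mul, smul_mul_assoc, mul_smul_comm, mul_assoc]
    match_scalars <;> field_simp
    ring
  rw [CubicRel] at h
  rw [h, smul_zero, sub_eq_zero] at this
  exact this

theorem CubicRel.mul_vcomm' {b c : A} (h : CubicRel v c b) (hv : v ≠ 0) :
    c * vcomm v b c = v • (vcomm v b c * c) := by
  have : c * vcomm v b c - v • (vcomm v b c * c) =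
      -v • (c * c * b - (v + v⁻¹) • (c * b * c) + b * c * c) := by
    simp only [vcomm, mul_sub, sub_mul, smul_mul_assoc, mul_smul_comm, mul_assoc]
    match_scalars <;> field_simp
    ring
  rw [CubicRel] at h
  rw [h, smul_zero, sub_eq_zero] at this
  exact this

theorem CubicRel.vcomm_right {a b c : A} (h : CubicRel v a b) (hac : Commute a c) :
    CubicRel v a (vcomm v b c) := by
  have hac' : ∀ y, c * (a * y) = a * (c * y) := fun y => by
    rw [← mul_assoc, ← hac.eq, mul_assoc]
  have : a * a * vcomm v b c - (v + v⁻¹) • (a * vcomm v b c * a) + vcomm v b c * a * a =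
      (a * a * b - (v + v⁻¹) • (a * b * a) + b * a * a) * c
      - v • (c * (a * a * b - (v + v⁻¹) • (a * b * a) + b * a * a)) := by
    simp only [vcomm, mul_sub, sub_mul, mul_add, add_mul, smul_mul_assoc, mul_smul_comm,
      mul_assoc, smul_sub, smul_add, hac', ← hac.eq]
    module
  rw [CubicRel] at h ⊢
  rw [this, h]
  simp

theorem Commute.vcomm_right {a b c : A} (hb : Commute a b) (hc : Commute a c) :
    Commute a (vcomm v b c) :=
  (hb.mul_right hc).sub_right ((hc.mul_right hb).smul_right v)

theorem commute_vcomm_vcomm {a b c : A} (hv : v ≠ 0) (h2 : v + v⁻¹ ≠ 0) (hac : Commute a c)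
    (ha : CubicRel v b a) (hc : CubicRel v b c) :
    Commute b (vcomm v a (vcomm v b c)) := by
  have hac' : ∀ y, c * (a * y) = a * (c * y) := fun y => by
    rw [← mul_assoc, ← hac.eq, mul_assoc]
  have key : (v + v⁻¹) • (b * vcomm v a (vcomm v b c) - vcomm v a (vcomm v b c) * b) =
      a * (b * b * c - (v + v⁻¹) • (b * c * b) + c * b * b)
      - v ^ 2 • ((b * b * c - (v + v⁻¹) • (b * c * b) + c * b * b) * a)
      + v ^ 2 • (c * (b * b * a - (v + v⁻¹) • (b * a * b) + a * b * b))
      - (b * b * a - (v + v⁻¹) • (b * a * b) + a * b * b) * c := by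
    simp only [vcomm, mul_sub, sub_mul, mul_add, add_mul, smul_mul_assoc, mul_smul_comm,
      mul_assoc, smul_sub, smul_add, hac', ← hac.eq]
    match_scalars <;> field_simp <;> ring
  rw [CubicRel] at ha hc
  rw [ha, hc] at key
  simp only [mul_zero, zero_mul, smul_zero, sub_zero, add_zero] at key
  exact sub_eq_zero.1 ((smul_eq_zero.1 key).resolve_left h2)

theorem vcomm_mul_of_mul {a c e : A} (hac : Commute a c) (he : c * e = v • (e * c)) :
    c * vcomm v a e = v • (vcomm v a e * c) := by
  have h1 : c * (a * e) = v • (a * (e * c)) := by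
    rw [← mul_assoc, ← hac.eq, mul_assoc, he, mul_smul_comm]
  have h2 : c * (e * a) = v • (e * (a * c)) := by
    rw [← mul_assoc, he, smul_mul_assoc, mul_assoc, hac.eq]
  simp only [vcomm, mul_sub, sub_mul, mul_smul_comm, smul_mul_assoc, h1, h2, mul_assoc]
  module

theorem vcomm_mul_of_commute {b c x : A} (hb : Commute b x) (hc : c * x = v • (x * c)) :
    vcomm v b c * x = v • (x * vcomm v b c) := by
  have h1 : b * (c * x) = v • (x * (b * c)) := by
    rw [hc, mul_smul_comm, ← mul_assoc, hb.eq, mul_assoc]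
  have h2 : c * (b * x) = v • (x * (c * b)) := by
    rw [hb.eq, ← mul_assoc, hc, smul_mul_assoc, mul_assoc]
  simp only [vcomm, mul_sub, sub_mul, mul_smul_comm, smul_mul_assoc, h1, h2, mul_assoc]
  module

/-- The root vectors `[f k, [f (k - 1), …, f 0]]` built from iterated `v`-commutators. -/
def rootVec (v : K) (f : ℕ → A) : ℕ → A
  | 0 => f 0
  | k + 1 => vcomm v (f (k + 1)) (rootVec v f k)

namespace SerreFamily

variable {f : ℕ → A}

theorem commute_rootVec_of_lt (hf : SerreFamily v f) {i k : ℕ} (h : k + 2 ≤ i) :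
    Commute (f i) (rootVec v f k) := by
  induction k with
  | zero => exact (hf.commute _ _ h).symm
  | succ k ih => exact (hf.commute _ _ h).symm.vcomm_right (ih (by lia))

theorem cubic_rootVec (hf : SerreFamily v f) (k : ℕ) :
    CubicRel v (f (k + 1)) (rootVec v f k) := by
  cases k with
  | zero => exact hf.cubic_pred 0
  | succ k => exact (hf.cubic_pred (k + 1)).vcomm_right (hf.commute_rootVec_of_lt le_rfl)

theorem rootVec_mul_self (hf : SerreFamily v f) (hv : v ≠ 0) (k : ℕ) :
    rootVec v f (k + 1) * f (k + 1) = v • (f (k + 1) * rootVec v f (k + 1)) :=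
  (hf.cubic_rootVec k).mul_vcomm hv

theorem commute_rootVec_of_gt (hf : SerreFamily v f) (hv : v ≠ 0) (h2 : v + v⁻¹ ≠ 0) {i k : ℕ}
    (h : i + 1 < k) : Commute (f (i + 1)) (rootVec v f k) := by
  induction k, h using Nat.le_induction with
  | base =>
    exact commute_vcomm_vcomm hv h2 (hf.commute_rootVec_of_lt le_rfl)
      (hf.cubic_succ (i + 1)) (hf.cubic_rootVec i)
  | succ k hk ih =>
    exact (hf.commute (i + 1) (k + 1) (by lia)).vcomm_right ih

theorem rootVec_mul_rootVec (hf : SerreFamily v f) (hv : v ≠ 0) (h2 : v + v⁻¹ ≠ 0) {j k : ℕ}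
    (h : j < k) : rootVec v f j * rootVec v f k = v • (rootVec v f k * rootVec v f j) := by
  induction j generalizing k with
  | zero =>
    induction k, h using Nat.le_induction with
    | base => exact (hf.cubic_succ 0).mul_vcomm' hv
    | succ k hk ih => exact vcomm_mul_of_mul (hf.commute_rootVec_of_lt (by lia)) ih
  | succ j ihj =>
    induction k, h using Nat.le_induction with
    | base =>
      exact vcomm_mul_of_commute (hf.commute_rootVec_of_gt hv h2 (by lia)) (ihj (by lia))
    | succ k hk ih => exact vcomm_mul_of_mul (hf.commute_rootVec_of_lt (by lia)) ih

theorem rootVec_mul_succ (hv : v ≠ 0) (f : ℕ → A) (k : ℕ) :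
    rootVec v f k * f (k + 1) =
      v⁻¹ • (f (k + 1) * rootVec v f k) + (-v⁻¹) • rootVec v f (k + 1) := by
  simp only [rootVec, vcomm]
  match_scalars <;> field_simp
  ring

theorem rootVec_eq_zero {N : ℕ} (hN : ∀ i, N ≤ i → f i = 0) : rootVec v f N = 0 := by
  cases N with
  | zero => exact hN 0 le_rfl
  | succ N => simp [rootVec, vcomm, hN (N + 1) le_rfl]

end SerreFamily

end SerreFamily

section Twist

variable {K A : Type*} [Field K] [Ring A] [Algebra K A] {v : K}

theorem CubicRel.add {x y z w : A} {s : K} (hv : v ≠ 0) (h : CubicRel v x y)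
    (hzx : z * x = v ^ 2 • (x * z)) (hzy : z * y = v⁻¹ • (y * z)) (hwx : w * x = v⁻¹ • (x * w))
    (hwz : w * z = s • (z * w)) (hs : s ^ 2 - (v + v⁻¹) * s + 1 = 0) :
    CubicRel v (x + z) (y + w) := by
  have hzx' : ∀ t, z * (x * t) = v ^ 2 • (x * (z * t)) := fun t => by
    rw [← mul_assoc, hzx, smul_mul_assoc, mul_assoc]
  have hzy' : ∀ t, z * (y * t) = v⁻¹ • (y * (z * t)) := fun t => by
    rw [← mul_assoc, hzy, smul_mul_assoc, mul_assoc]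
  have : (x + z) * (x + z) * (y + w) - (v + v⁻¹) • ((x + z) * (y + w) * (x + z)) +
      (y + w) * (x + z) * (x + z) =
      (x * x * y - (v + v⁻¹) • (x * y * x) + y * x * x) +
      (s ^ 2 - (v + v⁻¹) * s + 1) • (z * z * w) := by
    simp only [mul_add, add_mul, mul_assoc, smul_mul_assoc, mul_smul_comm, smul_add, hzx, hzx',
      hzy, hzy', hwx, hwz]
    match_scalars <;> field_simp <;> ring
  rw [CubicRel] at h ⊢
  rw [this, h, hs]
  simp

/-- The Cartan matrix of type `A`. -/
def cartan (i j : ℕ) : ℤ :=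
  if i = j then 2 else if i + 1 = j ∨ j + 1 = i then -1 else 0

/-- Two sequences in an algebra related by the commutation rules of `f ⊗ 1` and `1 ⊗ z` in a
twisted tensor product with a quantum affine space. -/
structure TwistedPair (v : K) (f z : ℕ → A) : Prop where
  serre : SerreFamily v f
  twist : ∀ i j, z i * f j = v ^ cartan i j • (f j * z i)
  mul_succ : ∀ i, z i * z (i + 1) = v • (z (i + 1) * z i)
  commute : ∀ i j, i + 2 ≤ j → Commute (z i) (z j)

namespace TwistedPair

variable {f z : ℕ → A}

theorem commute_left (h : TwistedPair v f z) {i j : ℕ} (hij : i + 2 ≤ j ∨ j + 2 ≤ i) :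
    Commute (z i) (f j) := by
  have := h.twist i j
  rwa [cartan, if_neg (by lia), if_neg (by lia), zpow_zero, one_smul] at this

theorem serreFamily_add (h : TwistedPair v f z) (hv : v ≠ 0) :
    SerreFamily v fun i => f i + z i := by
  have h0 : ∀ i, z i * f i = v ^ 2 • (f i * z i) := fun i => by
    simpa [cartan] using h.twist i i
  have h1 : ∀ i, z i * f (i + 1) = v⁻¹ • (f (i + 1) * z i) := fun i => by
    simpa [cartan] using h.twist i (i + 1)
  have h2 : ∀ i, z (i + 1) * f i = v⁻¹ • (f i * z (i + 1)) := fun i => by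
    simpa [cartan] using h.twist (i + 1) i
  have hz : ∀ i, z (i + 1) * z i = v⁻¹ • (z i * z (i + 1)) := fun i => by
    rw [h.mul_succ, inv_smul_smul₀ hv]
  refine ⟨fun i => ?_, fun i => ?_, fun i j hij => ?_⟩
  · exact (h.serre.cubic_succ i).add hv (h0 i) (h1 i) (h2 i) (hz i) (by field_simp; ring)
  · exact (h.serre.cubic_pred i).add hv (h0 _) (h2 i) (h1 i) (h.mul_succ i) (by field_simp; ring)
  · exact ((h.serre.commute i j hij).add_left (h.commute_left (.inl hij))).add_right
      ((h.commute_left (.inr hij)).symm.add_left (h.commute i j hij))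

/-- The product `z k * … * z 0`. -/
def descProd (z : ℕ → A) : ℕ → A
  | 0 => z 0
  | k + 1 => z (k + 1) * descProd z k

theorem rootVec_add (h : TwistedPair v f z) (hv : v ≠ 0) (hf : f 0 = 0) (k : ℕ) :
    rootVec v (fun i => f i + z i) k = (1 - v ^ 2) ^ k • descProd z k := by
  have hcf : ∀ k j, k + 2 ≤ j → Commute (descProd z k) (f j) := fun k j hj => by
    induction k with
    | zero => exact h.commute_left (.inl hj)
    | succ k ih => exact (h.commute_left (.inl hj)).mul_left (ih (by lia))
  have hcz : ∀ k j, k + 2 ≤ j → Commute (descProd z k) (z j) := fun k j hj => by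
    induction k with
    | zero => exact h.commute 0 j hj
    | succ k ih => exact (h.commute _ _ hj).mul_left (ih (by lia))
  have hf1 : ∀ k, descProd z k * f (k + 1) = v⁻¹ • (f (k + 1) * descProd z k) := fun k => by
    have h1 : z k * f (k + 1) = v⁻¹ • (f (k + 1) * z k) := by
      simpa [cartan] using h.twist k (k + 1)
    cases k with
    | zero => exact h1
    | succ k =>
      rw [descProd, mul_assoc, (hcf k (k + 2) le_rfl).eq, ← mul_assoc, h1, smul_mul_assoc,
        mul_assoc]
  have hz1 : ∀ k, descProd z k * z (k + 1) = v • (z (k + 1) * descProd z k) := fun k => by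
    cases k with
    | zero => exact h.mul_succ 0
    | succ k =>
      rw [descProd, mul_assoc, (hcz k (k + 2) le_rfl).eq, ← mul_assoc, h.mul_succ,
        smul_mul_assoc, mul_assoc]
  induction k with
  | zero => simp [rootVec, descProd, hf]
  | succ k ih =>
    rw [rootVec, ih, vcomm, smul_mul_assoc, mul_add, hf1, hz1, descProd]
    simp only [add_mul, mul_smul_comm]
    match_scalars <;> field_simp <;> ring

end TwistedPair

end Twist

section Operators

variable {K U : Type*} [Field K] [Ring U] [Algebra K U]

/-- Exponents of Laurent monomials, ordered lexicographically. -/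
abbrev LexExp := Lex (ℕ → ℤ)

/-- The exponent of the `i`-th variable. -/
def LexExp.unit (i : ℕ) : LexExp := toLex (Pi.single i 1)

theorem LexExp.unit_pos (i : ℕ) : 0 < LexExp.unit i :=
  ⟨i, fun _ hj => (Pi.single_eq_of_ne (M := fun _ => ℤ) (ne_of_lt hj) 1).symm,
    (zero_lt_one' ℤ).trans_eq (Pi.single_eq_same (M := fun _ => ℤ) i 1).symm⟩

/-- Coefficientwise left multiplication by `u`. -/
def coeffMul (K : Type*) [Field K] {U : Type*} [Ring U] [Algebra K U] (u : U) :
    Module.End K (LexExp → U) where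
  toFun m a := u * m a
  map_add' _ _ := funext fun _ => mul_add _ _ _
  map_smul' _ _ := funext fun _ => mul_smul_comm _ _ _

/-- Left multiplication by the `i`-th variable, which `v`-commutes with the next one and acts
on coefficients by the endomorphism `τ i`. -/
def varMul (v : K) (τ : ℕ → U →ₐ[K] U) (i : ℕ) : Module.End K (LexExp → U) where
  toFun m a := v ^ ofLex a (i + 1) • τ i (m (a - LexExp.unit i))
  map_add' _ _ := funext fun _ => by simp
  map_smul' c _ := funext fun _ => by simp [smul_comm c]

theorem coeffMul_apply (u : U) (m : LexExp → U) (a : LexExp) : coeffMul K u m a = u * m a := rfl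

theorem varMul_apply (v : K) (τ : ℕ → U →ₐ[K] U) (i : ℕ) (m : LexExp → U) (a : LexExp) :
    varMul v τ i m a = v ^ ofLex a (i + 1) • τ i (m (a - LexExp.unit i)) := rfl

variable (K U) in
/-- `coeffMul` as an algebra homomorphism. -/
def coeffMulHom : U →ₐ[K] Module.End K (LexExp → U) where
  toFun := coeffMul K
  map_one' := LinearMap.ext fun _ => funext fun _ => one_mul _
  map_mul' _ _ := LinearMap.ext fun _ => funext fun _ => mul_assoc _ _ _
  map_zero' := LinearMap.ext fun _ => funext fun _ => zero_mul _
  map_add' _ _ := LinearMap.ext fun _ => funext fun _ => add_mul _ _ _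
  commutes' c := LinearMap.ext fun m => funext fun a => (Algebra.smul_def c (m a)).symm

theorem CubicRel.map {A B : Type*} [Ring A] [Algebra K A] [Ring B] [Algebra K B] {v : K}
    {a b : A} (h : CubicRel v a b) (φ : A →ₐ[K] B) : CubicRel v (φ a) (φ b) := by
  simpa [CubicRel] using congrArg φ h

theorem SerreFamily.map {A B : Type*} [Ring A] [Algebra K A] [Ring B] [Algebra K B] {v : K}
    {f : ℕ → A} (h : SerreFamily v f) (φ : A →ₐ[K] B) : SerreFamily v fun i => φ (f i) :=
  ⟨fun i => (h.cubic_succ i).map φ, fun i => (h.cubic_pred i).map φ,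
    fun i j hij => (h.commute i j hij).map φ⟩

theorem rootVec_map {A B : Type*} [Ring A] [Algebra K A] [Ring B] [Algebra K B] (v : K)
    (f : ℕ → A) (φ : A →ₐ[K] B) (k : ℕ) : φ (rootVec v f k) = rootVec v (fun i => φ (f i)) k := by
  induction k with
  | zero => rfl
  | succ k ih => simp [rootVec, vcomm, ih]

theorem twistedPair_operators {v : K} (hv : v ≠ 0) {f : ℕ → U} (hf : SerreFamily v f)
    {τ : ℕ → U →ₐ[K] U} (hτ : ∀ i j, τ i (f j) = v ^ cartan i j • f j)
    (hcomm : ∀ i j u, τ i (τ j u) = τ j (τ i u)) :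
    TwistedPair v (fun i => coeffMul K (f i)) (varMul v τ) where
  serre := hf.map (coeffMulHom K U)
  twist i j := by
    refine LinearMap.ext fun m => funext fun a => ?_
    simp only [Module.End.mul_apply, LinearMap.smul_apply, Pi.smul_apply, coeffMul_apply,
      varMul_apply, map_mul, hτ, smul_mul_assoc, mul_smul_comm]
    rw [smul_comm]
  mul_succ i := by
    refine LinearMap.ext fun m => funext fun a => ?_
    simp only [Module.End.mul_apply, LinearMap.smul_apply, Pi.smul_apply, varMul_apply, map_smul,
      hcomm i (i + 1), smul_smul, sub_right_comm a (LexExp.unit i)]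
    congr 1
    simp only [ofLex_sub, Pi.sub_apply, LexExp.unit, ofLex_toLex]
    rw [Pi.single_eq_same, Pi.single_eq_of_ne (by lia), sub_zero, mul_left_comm,
      ← zpow_one_add₀ hv, add_sub_cancel, mul_comm]
  commute i j hij := by
    refine LinearMap.ext fun m => funext fun a => ?_
    simp only [Module.End.mul_apply, varMul_apply, map_smul,
      hcomm i j, smul_smul, sub_right_comm a (LexExp.unit i)]
    congr 1
    simp only [ofLex_sub, Pi.sub_apply, LexExp.unit, ofLex_toLex]
    rw [Pi.single_eq_of_ne (by lia), Pi.single_eq_of_ne (by lia)]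
    simp [mul_comm]

/-- The operator `φ` multiplies lowest terms by a monomial of exponent `p`, up to an injective
map on coefficients. -/
def Shifts (p : LexExp) (φ : Module.End K (LexExp → U)) : Prop :=
  ∀ b m, (∀ a < b, m a = 0) → (∀ a < p + b, φ m a = 0) ∧ (m b ≠ 0 → φ m (p + b) ≠ 0)

namespace Shifts

variable {p p' : LexExp} {φ ψ : Module.End K (LexExp → U)}

protected theorem one : Shifts 0 (1 : Module.End K (LexExp → U)) := fun b m hm => by
  simpa using hm

protected theorem mul (hφ : Shifts p φ) (hψ : Shifts p' ψ) : Shifts (p + p') (φ * ψ) :=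
  fun b m hm => by
    obtain ⟨h1, h2⟩ := hψ b m hm
    obtain ⟨h3, h4⟩ := hφ _ _ h1
    rw [add_assoc]
    exact ⟨h3, fun h => h4 (h2 h)⟩

protected theorem pow (hφ : Shifts p φ) (n : ℕ) : Shifts (n • p) (φ ^ n) := by
  induction n with
  | zero => simpa using Shifts.one
  | succ n ih =>
    rw [succ_nsmul, pow_succ]
    exact ih.mul hφ

protected theorem smul (hφ : Shifts p φ) {c : K} (hc : c ≠ 0) : Shifts p (c • φ) :=
  fun b m hm => by
    obtain ⟨h1, h2⟩ := hφ b m hm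
    exact ⟨fun a ha => by simp [h1 a ha], fun h => by simpa [hc] using h2 h⟩

theorem add_of_lt (hφ : Shifts p φ) (hψ : Shifts p' ψ) (h : p < p') : Shifts p (φ + ψ) :=
  fun b m hm => by
    obtain ⟨h1, h2⟩ := hφ b m hm
    obtain ⟨h3, -⟩ := hψ b m hm
    have hb : p + b < p' + b := by gcongr
    exact ⟨fun a ha => by simp [h1 a ha, h3 a (ha.trans hb)], fun h => by simp [h3 _ hb, h2 h]⟩

theorem add_of_ne (hφ : Shifts p φ) (hψ : Shifts p' ψ) (h : p ≠ p') :
    Shifts p (φ + ψ) ∨ Shifts p' (φ + ψ) := by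
  rcases h.lt_or_gt with h | h
  · exact .inl (hφ.add_of_lt hψ h)
  · exact .inr (add_comm φ ψ ▸ hψ.add_of_lt hφ h)

theorem ne_zero [Nontrivial U] (hφ : Shifts p φ) : φ ≠ 0 := by
  rintro rfl
  exact (hφ 0 (Pi.single 0 1) fun a ha => by simp [Pi.single_eq_of_ne ha.ne]).2 (by simp) rfl

theorem varMul {v : K} (hv : v ≠ 0) {τ : ℕ → U →ₐ[K] U} {i : ℕ}
    (hτ : Function.Injective (τ i)) : Shifts (LexExp.unit i) (varMul v τ i) := fun b m hm => by
  refine ⟨fun a ha => ?_, fun h => ?_⟩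
  · rw [varMul_apply, hm _ (sub_lt_iff_lt_add'.2 ha), map_zero, smul_zero]
  · rw [varMul_apply, add_sub_cancel_left]
    exact smul_ne_zero (zpow_ne_zero _ hv) ((map_ne_zero_iff _ hτ).2 h)

theorem descProd {v : K} (hv : v ≠ 0) {τ : ℕ → U →ₐ[K] U}
    (hτ : ∀ i, Function.Injective (τ i)) (k : ℕ) :
    ∃ p : LexExp, (∀ i, ofLex p i = if i ≤ k then 1 else 0) ∧
      Shifts p (TwistedPair.descProd (_root_.varMul v τ) k) := by
  induction k with
  | zero =>
    exact ⟨_, fun i => by simp [LexExp.unit, Pi.single_apply], Shifts.varMul hv (hτ 0)⟩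
  | succ k ih =>
    obtain ⟨p, hp, h⟩ := ih
    refine ⟨_, fun i => ?_, (Shifts.varMul hv (hτ (k + 1))).mul h⟩
    simp only [ofLex_add, Pi.add_apply, hp, LexExp.unit, ofLex_toLex, Pi.single_apply]
    split_ifs <;> lia

end Shifts

end Operators

section Ladder

variable {K T : Type*} [Field K] [Ring T] [Algebra K T] {v : K}

theorem LeftMoves.mul_mem_powSpan {A R : Type*} [Ring A] [Ring R] {φ : A →+* R} {x : R}
    (hl : LeftMoves φ x) {n k : ℕ} {y z : R} (hy : y ∈ powSpan φ x n) (hz : z ∈ powSpan φ x k) :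
    y * z ∈ powSpan φ x (n + k) := by
  refine powSpan_le (S := (powSpan φ x (n + k)).comap (AddMonoidHom.mulLeft y)) ?_ hz
  intro a i hi
  have : ∀ i, y * φ a * x ^ i ∈ powSpan φ x (n + i) := fun i => by
    induction i with
    | zero => simpa using hl.mul_coeff_mem_powSpan a hy
    | succ i ih =>
      rw [pow_succ, ← mul_assoc]
      exact mul_var_mem_powSpan ih
  rw [AddSubgroup.mem_comap, AddMonoidHom.coe_mulLeft, ← mul_assoc]
  exact powSpan_mono (by lia) (this i)

theorem exists_mul_eq_of_mem_adjoin {S : Set T} {x : T}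
    (h : ∀ s ∈ S, ∃ a ∈ Algebra.adjoin K S, ∃ c ∈ Algebra.adjoin K S, x * s = a * x + c)
    {b : T} (hb : b ∈ Algebra.adjoin K S) :
    ∃ a ∈ Algebra.adjoin K S, ∃ c ∈ Algebra.adjoin K S, x * b = a * x + c := by
  induction hb using Algebra.adjoin_induction with
  | mem s hs => exact h s hs
  | algebraMap r =>
    exact ⟨_, algebraMap_mem _ r, 0, zero_mem _, by rw [add_zero, Algebra.commutes]⟩
  | add y z _ _ hy hz =>
    obtain ⟨a, ha, c, hc, e⟩ := hy
    obtain ⟨a', ha', c', hc', e'⟩ := hz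
    exact ⟨_, add_mem ha ha', _, add_mem hc hc', by rw [mul_add, e, e']; noncomm_ring⟩
  | mul y z hym hzm hy hz =>
    obtain ⟨a, ha, c, hc, e⟩ := hy
    obtain ⟨a', ha', c', hc', e'⟩ := hz
    refine ⟨_, mul_mem ha ha', _, add_mem (mul_mem ha hc') (mul_mem hc hzm), ?_⟩
    rw [← mul_assoc, e, add_mul, mul_assoc a, e']
    noncomm_ring

theorem exists_mul_eq_of_mem_adjoin' {S : Set T} {x : T}
    (h : ∀ s ∈ S, ∃ a ∈ Algebra.adjoin K S, ∃ c ∈ Algebra.adjoin K S, s * x = x * a + c)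
    {b : T} (hb : b ∈ Algebra.adjoin K S) :
    ∃ a ∈ Algebra.adjoin K S, ∃ c ∈ Algebra.adjoin K S, b * x = x * a + c := by
  induction hb using Algebra.adjoin_induction with
  | mem s hs => exact h s hs
  | algebraMap r =>
    exact ⟨_, algebraMap_mem _ r, 0, zero_mem _, by rw [add_zero, Algebra.commutes]⟩
  | add y z _ _ hy hz =>
    obtain ⟨a, ha, c, hc, e⟩ := hy
    obtain ⟨a', ha', c', hc', e'⟩ := hz
    exact ⟨_, add_mem ha ha', _, add_mem hc hc', by rw [add_mul, e, e']; noncomm_ring⟩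
  | mul y z hym hzm hy hz =>
    obtain ⟨a, ha, c, hc, e⟩ := hy
    obtain ⟨a', ha', c', hc', e'⟩ := hz
    refine ⟨_, mul_mem ha ha', _, add_mem (mul_mem hc ha') (mul_mem hym hc'), ?_⟩
    rw [mul_assoc, e', mul_add, ← mul_assoc y, e]
    noncomm_ring

theorem leftMoves_inclusion {A B : Subalgebra K T} (h : A ≤ B) (x : B)
    (hx : ∀ b ∈ A, ∃ a ∈ A, ∃ c ∈ A, x * b = a * x + c) :
    LeftMoves (Subalgebra.inclusion h).toRingHom x := fun b => by
  obtain ⟨a, ha, c, hc, e⟩ := hx b b.2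
  exact ⟨⟨a, ha⟩, ⟨c, hc⟩, Subtype.ext e⟩

theorem rightMoves_inclusion {A B : Subalgebra K T} (h : A ≤ B) (x : B)
    (hx : ∀ b ∈ A, ∃ a ∈ A, ∃ c ∈ A, b * x = x * a + c) :
    RightMoves (Subalgebra.inclusion h).toRingHom x := fun b => by
  obtain ⟨a, ha, c, hc, e⟩ := hx b b.2
  exact ⟨⟨a, ha⟩, ⟨c, hc⟩, Subtype.ext e⟩

/-- The generators `f i` with `i ≥ 1` together with the root vectors of index at least `k`. -/
def ladderGens (v : K) (f : ℕ → T) (k : ℕ) : Set T :=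
  Set.range (fun i => f (i + 1)) ∪ rootVec v f '' Set.Ici k

/-- The subalgebra generated by `ladderGens`. -/
def ladder (v : K) (f : ℕ → T) (k : ℕ) : Subalgebra K T := Algebra.adjoin K (ladderGens v f k)

variable {f : ℕ → T}

theorem gen_mem_ladder (i k : ℕ) : f (i + 1) ∈ ladder v f k :=
  Algebra.subset_adjoin (.inl ⟨i, rfl⟩)

theorem rootVec_mem_ladder {j k : ℕ} (h : k ≤ j) : rootVec v f j ∈ ladder v f k :=
  Algebra.subset_adjoin (.inr ⟨j, h, rfl⟩)

theorem ladder_succ_le (k : ℕ) : ladder v f (k + 1) ≤ ladder v f k :=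
  Algebra.adjoin_mono (Set.union_subset_union_right _
    (Set.image_mono (Set.Ici_subset_Ici.2 k.le_succ)))

theorem SerreFamily.rootVec_mul_ladderGen (hf : SerreFamily v f) (hv : v ≠ 0) (h2 : v + v⁻¹ ≠ 0)
    {k : ℕ} {s : T} (hs : s ∈ ladderGens v f (k + 1)) :
    ∃ c : K, c ≠ 0 ∧ ∃ d ∈ ladder v f (k + 1),
      rootVec v f k * s = c • (s * rootVec v f k) + d := by
  rcases hs with ⟨i, rfl⟩ | ⟨j, hj, rfl⟩
  · rcases lt_trichotomy (i + 1) k with h | h | h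
    · exact ⟨1, one_ne_zero, 0, zero_mem _, by simp [(hf.commute_rootVec_of_gt hv h2 h).eq]⟩
    · subst h
      exact ⟨v, hv, 0, zero_mem _, by simp [hf.rootVec_mul_self hv i]⟩
    · rcases (show k ≤ i by lia).eq_or_lt with h | h
      · subst h
        exact ⟨v⁻¹, inv_ne_zero hv, _, Subalgebra.smul_mem _ (rootVec_mem_ladder le_rfl) _,
          SerreFamily.rootVec_mul_succ hv f k⟩
      · exact ⟨1, one_ne_zero, 0, zero_mem _, by
          simp [(hf.commute_rootVec_of_lt (show k + 2 ≤ i + 1 by lia)).eq]⟩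
  · exact ⟨v, hv, 0, zero_mem _, by simp [hf.rootVec_mul_rootVec hv h2 hj]⟩

/-- The inclusion of consecutive terms of the ladder. -/
def ladderIncl (v : K) (f : ℕ → T) (k : ℕ) : ladder v f (k + 1) →+* ladder v f k :=
  (Subalgebra.inclusion (ladder_succ_le k)).toRingHom

/-- The root vector of index `k` as an element of the `k`-th term of the ladder. -/
def ladderVar (v : K) (f : ℕ → T) (k : ℕ) : ladder v f k :=
  ⟨rootVec v f k, rootVec_mem_ladder le_rfl⟩

theorem coe_ladderIncl (k : ℕ) (a : ladder v f (k + 1)) : (ladderIncl v f k a : T) = a :=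
  Subalgebra.coe_inclusion _ a

theorem SerreFamily.leftMoves (hf : SerreFamily v f) (hv : v ≠ 0) (h2 : v + v⁻¹ ≠ 0) (k : ℕ) :
    LeftMoves (ladderIncl v f k) (ladderVar v f k) := by
  refine leftMoves_inclusion _ _ fun b hb => exists_mul_eq_of_mem_adjoin (fun s hs => ?_) hb
  obtain ⟨c, -, d, hd, e⟩ := hf.rootVec_mul_ladderGen hv h2 hs
  exact ⟨c • s, Subalgebra.smul_mem _ (Algebra.subset_adjoin hs) _, d, hd, by
    rw [smul_mul_assoc]; exact e⟩

theorem SerreFamily.rightMoves (hf : SerreFamily v f) (hv : v ≠ 0) (h2 : v + v⁻¹ ≠ 0) (k : ℕ) :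
    RightMoves (ladderIncl v f k) (ladderVar v f k) := by
  refine rightMoves_inclusion _ _ fun b hb => exists_mul_eq_of_mem_adjoin' (fun s hs => ?_) hb
  obtain ⟨c, hc, d, hd, e⟩ := hf.rootVec_mul_ladderGen hv h2 hs
  refine ⟨c⁻¹ • s, Subalgebra.smul_mem _ (Algebra.subset_adjoin hs) _, -(c⁻¹ • d),
    neg_mem (Subalgebra.smul_mem _ hd _), ?_⟩
  change s * rootVec v f k = rootVec v f k * c⁻¹ • s + _
  rw [mul_smul_comm, e, smul_add, inv_smul_smul₀ hc, add_neg_cancel_right]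

theorem SerreFamily.exists_mem_powSpan (hf : SerreFamily v f) (hv : v ≠ 0) (h2 : v + v⁻¹ ≠ 0)
    (k : ℕ) (y : ladder v f k) :
    ∃ n, y ∈ powSpan (ladderIncl v f k) (ladderVar v f k) n := by
  have hcoeff : ∀ a, ladderIncl v f k a ∈ powSpan (ladderIncl v f k) (ladderVar v f k) 1 :=
    fun a => by simpa using coeff_mul_pow_mem_powSpan (x := ladderVar v f k) a 0
  obtain ⟨y, hy⟩ := y
  induction hy using Algebra.adjoin_induction with
  | mem s hs =>
    rcases hs with ⟨i, rfl⟩ | ⟨j, hj, rfl⟩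
    · exact ⟨1, hcoeff ⟨_, gen_mem_ladder i _⟩⟩
    · rcases (show k ≤ j from hj).eq_or_lt with rfl | h
      · have := coeff_mul_pow_mem_powSpan (φ := ladderIncl v f k) (x := ladderVar v f k) 1 1
        rw [map_one, one_mul, pow_one] at this
        exact ⟨2, this⟩
      · exact ⟨1, hcoeff ⟨_, rootVec_mem_ladder h⟩⟩
  | algebraMap r => exact ⟨1, hcoeff (algebraMap K _ r)⟩
  | add y z hym hzm hy hz =>
    obtain ⟨n, hn⟩ := hy
    obtain ⟨l, hl⟩ := hz
    exact ⟨max n l, add_mem (powSpan_mono (le_max_left n l) hn)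
      (powSpan_mono (le_max_right n l) hl)⟩
  | mul y z hym hzm hy hz =>
    obtain ⟨n, hn⟩ := hy
    obtain ⟨l, hl⟩ := hz
    exact ⟨n + l, (hf.leftMoves hv h2 k).mul_mem_powSpan hn hl⟩

theorem SerreFamily.isNoetherianRing_ladder (hf : SerreFamily v f) (hv : v ≠ 0)
    (h2 : v + v⁻¹ ≠ 0) {N : ℕ} (hN : IsNoetherianRing (ladder v f N)) :
    ∀ k ≤ N, IsNoetherianRing (ladder v f k) := fun k hk => by
  induction hk using Nat.decreasingInduction with
  | self => exact hN
  | of_succ k _ ih =>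
    exact isNoetherianRing_of_moves (hf.leftMoves hv h2 k) (hf.rightMoves hv h2 k)
      (hf.exists_mem_powSpan hv h2 k)

/-- If `ρ` sends the root vectors to multiples of the products `z k * … * z 0`, then nonzero
elements of the ladder act by operators that shift lowest terms. -/
theorem SerreFamily.exists_shifts {U : Type*} [Ring U] [Algebra K U] (hf : SerreFamily v f)
    (hv : v ≠ 0) (h2 : v + v⁻¹ ≠ 0) (ρ : T →ₐ[K] Module.End K (LexExp → U))
    {N : ℕ} (hρ : ∀ k < N, ∃ p : LexExp, (∀ i, ofLex p i = if i ≤ k then 1 else 0) ∧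
      Shifts p (ρ (rootVec v f k)))
    (hN : ∀ y ∈ ladder v f N, y ≠ 0 → Shifts 0 (ρ y)) {k : ℕ} (hk : k ≤ N) :
    ∀ y ∈ ladder v f k, y ≠ 0 →
      ∃ p : LexExp, (∀ i < k, ofLex p i = ofLex p (i + 1)) ∧ Shifts p (ρ y) := by
  induction hk using Nat.decreasingInduction with
  | self => exact fun y hy hy0 => ⟨0, fun _ _ => rfl, hN y hy hy0⟩
  | of_succ k hk ih =>
    obtain ⟨r, hr, hrs⟩ := hρ k hk
    suffices ∀ n, ∀ y ∈ powSpan (ladderIncl v f k) (ladderVar v f k) n, y ≠ 0 →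
        ∃ p : LexExp, (∀ i < k, ofLex p i = ofLex p (i + 1)) ∧
          ofLex p k < ofLex p (k + 1) + n ∧ Shifts p (ρ y) by
      intro y hy hy0
      obtain ⟨n, hn⟩ := hf.exists_mem_powSpan hv h2 k ⟨y, hy⟩
      obtain ⟨p, hp, -, hs⟩ := this n _ hn (fun h => hy0 (congrArg Subtype.val h))
      exact ⟨p, hp, hs⟩
    intro n
    induction n with
    | zero => exact fun y hy hy0 => (hy0 hy).elim
    | succ n ihn =>
      rintro y ⟨a, ha⟩ hy0
      obtain ⟨z, hz⟩ : ∃ z, z = y - ladderIncl v f k a * ladderVar v f k ^ n := ⟨_, rfl⟩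
      rw [← hz] at ha
      have hyz : (y : T) = a * rootVec v f k ^ n + z := by
        rw [hz]
        simp [ladderVar, coe_ladderIncl]
      have hlead : a ≠ 0 → ∃ p : LexExp, (∀ i < k, ofLex p i = ofLex p (i + 1)) ∧
          ofLex p k = ofLex p (k + 1) + n ∧ Shifts p (ρ (a * rootVec v f k ^ n)) := by
        intro ha0
        obtain ⟨p, hp, hs⟩ := ih a a.2 (fun h => ha0 (Subtype.ext h))
        have hpr : ∀ i, ofLex (p + n • r) i = ofLex p i + n * ofLex r i := fun i => by
          rw [← nsmul_eq_mul]; rfl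
        refine ⟨p + n • r, fun i hi => ?_, ?_, by
          rw [map_mul, map_pow]; exact hs.mul (hrs.pow n)⟩
        · rw [hpr, hpr, hr, hr, hp i (by lia), if_pos (by lia), if_pos (by lia)]
        · rw [hpr, hpr, hr, hr, hp k (by lia), if_pos le_rfl, if_neg (by lia)]
          ring
      rw [hyz, map_add]
      by_cases ha0 : a = 0
      · obtain ⟨p, hp, hp', hs⟩ := ihn z ha (by
          rintro rfl
          exact hy0 (Subtype.ext (by simp [hyz, ha0])))
        exact ⟨p, hp, by push_cast; lia, by simpa [ha0] using hs⟩
      obtain ⟨p, hp, hp', hs⟩ := hlead ha0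
      by_cases hz0 : z = 0
      · exact ⟨p, hp, by push_cast; lia, by simpa [hz0] using hs⟩
      obtain ⟨p₁, hp₁, hp₁', hs₁⟩ := ihn z ha hz0
      rcases hs.add_of_ne hs₁ (by rintro rfl; lia) with h | h
      · exact ⟨p, hp, by push_cast; lia, h⟩
      · exact ⟨p₁, hp₁, by push_cast; lia, h⟩

end Ladder

section Generators

variable {K : Type} [Field K] {q : K}

theorem rootVec_congr {A : Type*} [Ring A] [Algebra K A] {v : K} {f g : ℕ → A} {k : ℕ}
    (h : ∀ i ≤ k, f i = g i) : rootVec v f k = rootVec v g k := by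
  induction k with
  | zero => exact h 0 le_rfl
  | succ k ih => rw [rootVec, rootVec, h _ le_rfl, ih fun i hi => h i (by lia)]

theorem SerreFamily.smul {A : Type*} [Ring A] [Algebra K A] {v : K} {f : ℕ → A}
    (h : SerreFamily v f) (t : ℕ → K) : SerreFamily v fun i => t i • f i := by
  have hc : ∀ {a b : A} (r s : K), CubicRel v a b → CubicRel v (r • a) (s • b) := by
    intro a b r s hab
    have : r • a * r • a * s • b - (v + v⁻¹) • (r • a * s • b * r • a) + s • b * r • a * r • a =
        (r * r * s) • (a * a * b - (v + v⁻¹) • (a * b * a) + b * a * a) := by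
      simp only [smul_mul_assoc, mul_smul_comm]
      module
    rw [CubicRel] at hab ⊢
    rw [this, hab, smul_zero]
  exact ⟨fun i => hc _ _ (h.cubic_succ i), fun i => hc _ _ (h.cubic_pred i),
    fun i j hij => ((h.commute i j hij).smul_left _).smul_right _⟩

theorem SerreFamily.op {A : Type*} [Ring A] [Algebra K A] {v : K} {f : ℕ → A}
    (h : SerreFamily v f) : SerreFamily v fun i => MulOpposite.op (f i) := by
  have hc : ∀ {a b : A}, CubicRel v a b → CubicRel v (MulOpposite.op a) (MulOpposite.op b) := by
    intro a b hab
    have := congrArg MulOpposite.op hab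
    simp only [CubicRel, ← MulOpposite.op_mul, ← MulOpposite.op_smul, ← MulOpposite.op_sub,
      ← MulOpposite.op_add, ← MulOpposite.op_zero, mul_assoc] at this ⊢
    rw [← this]
    congr 1
    abel
  exact ⟨fun i => hc (h.cubic_succ i), fun i => hc (h.cubic_pred i),
    fun i j hij => (h.commute i j hij).op⟩

/-- The shifted sequence `0, f 0, f 1, …`. -/
def consZero {A : Type*} [Zero A] (f : ℕ → A) : ℕ → A
  | 0 => 0
  | i + 1 => f i

theorem SerreFamily.consZero {A : Type*} [Ring A] [Algebra K A] {v : K} {f : ℕ → A}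
    (h : SerreFamily v f) : SerreFamily v (consZero f) := by
  refine ⟨fun i => ?_, fun i => ?_, fun i j hij => ?_⟩
  · cases i with
    | zero => simp [CubicRel, _root_.consZero]
    | succ i => exact h.cubic_succ i
  · cases i with
    | zero => simp [CubicRel, _root_.consZero]
    | succ i => exact h.cubic_pred i
  · cases i with
    | zero => exact Commute.zero_left _
    | succ i =>
      obtain ⟨j, rfl⟩ : ∃ l, j = l + 1 := ⟨j - 1, by lia⟩
      exact h.commute i j (by lia)

namespace UqMinus

variable (K q) in
/-- The generators of `UqMinus K q N`, extended by zero. -/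
noncomputable def gen (N i : ℕ) : UqMinus K q N :=
  if h : i < N then fg K q N ⟨i, h⟩ else 0

variable {N : ℕ}

theorem gen_of_lt {i : ℕ} (h : i < N) : gen K q N i = fg K q N ⟨i, h⟩ := dif_pos h

theorem gen_of_le {i : ℕ} (h : N ≤ i) : gen K q N i = 0 := dif_neg (not_lt.2 h)

theorem serreFamily_gen : SerreFamily (q ^ 2) (gen K q N) := by
  have hc : ∀ i j, (i + 1 = j ∨ j + 1 = i) → CubicRel (q ^ 2) (gen K q N i) (gen K q N j) := by
    intro i j hij
    rcases le_or_gt N i with hi | hi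
    · simp [CubicRel, gen_of_le hi]
    rcases le_or_gt N j with hj | hj
    · simp [CubicRel, gen_of_le hj]
    have := RingQuot.mkAlgHom_rel K (SerreRel.serre (q := q) ⟨i, hi⟩ ⟨j, hj⟩ hij)
    simpa [CubicRel, gen_of_lt, hi, hj, fg] using this
  refine ⟨fun i => hc _ _ (.inl rfl), fun i => hc _ _ (.inr rfl), fun i j hij => ?_⟩
  rcases le_or_gt N j with hj | hj
  · simp [gen_of_le hj]
  have := RingQuot.mkAlgHom_rel K
    (SerreRel.comm (q := q) ⟨i, by lia⟩ ⟨j, hj⟩ (.inl hij))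
  rw [gen_of_lt (show i < N by lia), gen_of_lt hj]
  simpa [Commute, SemiconjBy, fg] using this

variable {A : Type*} [Ring A] [Algebra K A]

/-- The universal property of `UqMinus`. -/
noncomputable def lift (f : ℕ → A) (hf : SerreFamily (q ^ 2) f) : UqMinus K q N →ₐ[K] A :=
  RingQuot.liftAlgHom K ⟨FreeAlgebra.lift K fun i => f i, fun {x y} h => by
    induction h with
    | serre i j hij =>
      simp only [map_add, map_sub, map_smul, map_mul, FreeAlgebra.lift_ι_apply, map_zero]
      rcases hij with h | h
      · rw [← h]
        exact hf.cubic_succ i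
      · rw [← h]
        exact hf.cubic_pred j
    | comm i j hij =>
      simp only [map_mul, FreeAlgebra.lift_ι_apply]
      rcases hij with h | h
      · exact hf.commute i j h
      · exact (hf.commute j i h).symm⟩

theorem lift_gen (f : ℕ → A) (hf : SerreFamily (q ^ 2) f) {i : ℕ} (hi : i < N) :
    lift f hf (gen K q N i) = f i := by
  rw [gen_of_lt hi, fg, lift, RingQuot.liftAlgHom_mkAlgHom_apply, FreeAlgebra.lift_ι_apply]

protected theorem induction {p : UqMinus K q N → Prop} (algebraMap : ∀ r, p (algebraMap K _ r))
    (gen : ∀ i < N, p (gen K q N i)) (add : ∀ x y, p x → p y → p (x + y))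
    (mul : ∀ x y, p x → p y → p (x * y)) (u : UqMinus K q N) : p u := by
  obtain ⟨a, rfl⟩ := RingQuot.mkAlgHom_surjective K (SerreRel K q N) u
  induction a using FreeAlgebra.induction with
  | grade0 r => rw [AlgHom.commutes]; exact algebraMap r
  | grade1 i => simpa [gen_of_lt i.2, fg] using gen i i.2
  | mul a b ha hb => rw [map_mul]; exact mul _ _ ha hb
  | add a b ha hb => rw [map_add]; exact add _ _ ha hb

theorem algHom_ext {φ ψ : UqMinus K q N →ₐ[K] A}
    (h : ∀ i < N, φ (gen K q N i) = ψ (gen K q N i)) : φ = ψ := by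
  refine AlgHom.ext fun u => ?_
  induction u using UqMinus.induction with
  | algebraMap r => simp
  | gen i hi => exact h i hi
  | add x y hx hy => rw [map_add, map_add, hx, hy]
  | mul x y hx hy => rw [map_mul, map_mul, hx, hy]

theorem surjective_of_gen_mem {φ : A →ₐ[K] UqMinus K q N}
    (h : ∀ i < N, gen K q N i ∈ φ.range) : Function.Surjective φ := fun u => by
  change u ∈ φ.range
  induction u using UqMinus.induction with
  | algebraMap r => exact algebraMap_mem _ r
  | gen i hi => exact h i hi
  | add x y hx hy => exact add_mem hx hy
  | mul x y hx hy => exact mul_mem hx hy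

instance nontrivial : Nontrivial (UqMinus K q N) :=
  (lift (q := q) (N := N) (fun _ => (0 : K))
    ⟨fun _ => by simp [CubicRel], fun _ => by simp [CubicRel],
      fun _ _ _ => Commute.zero_left _⟩).toRingHom.domain_nontrivial

/-- The endomorphism rescaling the generators. -/
noncomputable def scale (t : ℕ → K) : UqMinus K q N →ₐ[K] UqMinus K q N :=
  lift (fun i => t i • gen K q N i) (serreFamily_gen.smul t)

theorem scale_gen (t : ℕ → K) (i : ℕ) : scale t (gen K q N i) = t i • gen K q N i := by
  rcases le_or_gt N i with hi | hi
  · simp [gen_of_le hi]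
  · exact lift_gen _ _ hi

theorem scale_comm (s t : ℕ → K) (u : UqMinus K q N) :
    scale s (scale t u) = scale t (scale s u) := by
  have : (scale s).comp (scale t) = (scale t).comp (scale (q := q) (N := N) s) :=
    algHom_ext fun i _ => by simp [scale_gen, smul_comm (s i)]
  exact DFunLike.congr_fun this u

theorem scale_injective {t : ℕ → K} (ht : ∀ i, t i ≠ 0) :
    Function.Injective (scale (q := q) (N := N) t) := by
  have : (scale fun i => (t i)⁻¹).comp (scale t) = AlgHom.id K (UqMinus K q N) :=
    algHom_ext fun i _ => by simp [scale_gen, ht]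
  exact Function.LeftInverse.injective (g := scale fun i => (t i)⁻¹) (DFunLike.congr_fun this)

/-- The algebra homomorphism sending each generator to the next one. -/
noncomputable def succHom (K : Type) [Field K] (q : K) (N : ℕ) :
    UqMinus K q N →ₐ[K] UqMinus K q (N + 1) :=
  lift (fun i => gen K q (N + 1) (i + 1))
    ⟨fun i => serreFamily_gen.cubic_succ (i + 1), fun i => serreFamily_gen.cubic_pred (i + 1),
      fun i j hij => serreFamily_gen.commute (i + 1) (j + 1) (by lia)⟩

theorem succHom_gen (i : ℕ) : succHom K q N (gen K q N i) = gen K q (N + 1) (i + 1) := by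
  rcases le_or_gt N i with hi | hi
  · rw [gen_of_le hi, gen_of_le (by lia), map_zero]
  · exact lift_gen _ _ hi

theorem ladder_le_range :
    ladder (q ^ 2) (gen K q (N + 1)) (N + 1) ≤ (succHom K q N).range := by
  refine Algebra.adjoin_le ?_
  rintro _ (⟨i, rfl⟩ | ⟨j, hj, rfl⟩)
  · exact ⟨gen K q N i, succHom_gen i⟩
  · have : rootVec (q ^ 2) (gen K q (N + 1)) j = 0 :=
      SerreFamily.rootVec_eq_zero fun i hi => gen_of_le (le_trans hj hi)
    rw [this]
    exact zero_mem _

theorem range_le_ladder :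
    (succHom K q N).range ≤ ladder (q ^ 2) (gen K q (N + 1)) (N + 1) := by
  rintro _ ⟨u, rfl⟩
  induction u using UqMinus.induction with
  | algebraMap r => simp
  | gen i hi =>
    simpa [succHom_gen] using gen_mem_ladder i (N + 1)
  | add x y hx hy => rw [map_add]; exact add_mem hx hy
  | mul x y hx hy => rw [map_mul]; exact mul_mem hx hy

theorem mem_ladder_zero (u : UqMinus K q N) : u ∈ ladder (q ^ 2) (gen K q N) 0 := by
  induction u using UqMinus.induction with
  | algebraMap r => exact algebraMap_mem _ r
  | gen i hi =>
    cases i with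
    | zero => exact rootVec_mem_ladder (j := 0) le_rfl
    | succ i => exact gen_mem_ladder i 0
  | add x y hx hy => exact add_mem hx hy
  | mul x y hx hy => exact mul_mem hx hy

theorem isNoetherianRing_succ (hq : q ^ 2 ≠ 0) (h2 : q ^ 2 + (q ^ 2)⁻¹ ≠ 0)
    (h : IsNoetherianRing (UqMinus K q N)) : IsNoetherianRing (UqMinus K q (N + 1)) := by
  have : IsNoetherianRing (ladder (q ^ 2) (gen K q (N + 1)) (N + 1)) := by
    refine isNoetherianRing_of_surjective (UqMinus K q N) _
      ((succHom K q N).codRestrict _ fun u => range_le_ladder ⟨u, rfl⟩).toRingHom ?_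
    rintro ⟨y, hy⟩
    obtain ⟨u, rfl⟩ := ladder_le_range hy
    exact ⟨u, rfl⟩
  have := serreFamily_gen.isNoetherianRing_ladder hq h2 this 0 (Nat.zero_le _)
  exact isNoetherianRing_of_surjective _ _ (ladder (q ^ 2) (gen K q (N + 1)) 0).val.toRingHom
    fun u => ⟨⟨u, mem_ladder_zero u⟩, rfl⟩

/-- Rescaling by the weight of the `i`-th generator of `UqMinus K q (N + 1)`. -/
noncomputable def twist (K : Type) [Field K] (q : K) (N i : ℕ) :
    UqMinus K q N →ₐ[K] UqMinus K q N :=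
  scale fun j => (q ^ 2) ^ cartan i (j + 1)

theorem twistedPair (hq : q ^ 2 ≠ 0) :
    TwistedPair (q ^ 2) (fun i => coeffMul K (consZero (gen K q N) i))
      (varMul (q ^ 2) (twist K q N)) := by
  refine twistedPair_operators hq serreFamily_gen.consZero (fun i j => ?_)
    fun i j u => scale_comm _ _ u
  cases j with
  | zero => simp [consZero]
  | succ j => exact scale_gen _ _

/-- The representation of `UqMinus K q (N + 1)` by operators on formal sums of Laurent monomials
with coefficients in `UqMinus K q N`. -/
noncomputable def rep (hq : q ^ 2 ≠ 0) (N : ℕ) :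
    UqMinus K q (N + 1) →ₐ[K] Module.End K (LexExp → UqMinus K q N) :=
  lift _ ((twistedPair (N := N) hq).serreFamily_add hq)

theorem rep_gen (hq : q ^ 2 ≠ 0) {i : ℕ} (hi : i < N + 1) :
    rep hq N (gen K q (N + 1) i) =
      coeffMul K (consZero (gen K q N) i) + varMul (q ^ 2) (twist K q N) i :=
  lift_gen _ _ hi

theorem twist_injective (hq : q ^ 2 ≠ 0) (i : ℕ) : Function.Injective (twist K q N i) :=
  scale_injective fun _ => zpow_ne_zero _ hq

theorem shifts_rep_rootVec (hq : q ^ 2 ≠ 0) (h4 : 1 - (q ^ 2) ^ 2 ≠ 0) {k : ℕ} (hk : k < N + 1) :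
    ∃ p : LexExp, (∀ i, ofLex p i = if i ≤ k then 1 else 0) ∧
      Shifts p (rep hq N (rootVec (q ^ 2) (gen K q (N + 1)) k)) := by
  obtain ⟨p, hp, hs⟩ := Shifts.descProd hq (twist_injective (N := N) hq) k
  refine ⟨p, hp, ?_⟩
  have h0 : coeffMul K (consZero (gen K q N) 0) = 0 :=
    (coeffMulHom K (UqMinus K q N)).map_zero
  have hmap : rep hq N (rootVec (q ^ 2) (gen K q (N + 1)) k) =
      rootVec (q ^ 2) (fun i => rep hq N (gen K q (N + 1) i)) k :=
    rootVec_map (A := UqMinus K q (N + 1)) (B := Module.End K (LexExp → UqMinus K q N))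
      (q ^ 2) (gen K q (N + 1)) (rep hq N) k
  rw [hmap, rootVec_congr fun i hi => rep_gen hq (by lia : i < N + 1),
    (twistedPair hq).rootVec_add hq h0]
  exact hs.smul (pow_ne_zero _ h4)

theorem rep_succHom_apply (hq : q ^ 2 ≠ 0) (u : UqMinus K q N) :
    ∀ (b : LexExp) (m : LexExp → UqMinus K q N), (∀ a < b, m a = 0) →
      (∀ a < b, rep hq N (succHom K q N u) m a = 0) ∧
        rep hq N (succHom K q N u) m b = u * m b := by
  induction u using UqMinus.induction with
  | algebraMap r =>
    intro b m hm
    rw [AlgHom.commutes, AlgHom.commutes]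
    simp +contextual [Module.algebraMap_end_apply, hm, Algebra.smul_def]
  | gen i hi =>
    intro b m hm
    have hs := (Shifts.varMul hq (twist_injective (N := N) hq (i + 1)) b m hm).1
    have hb : b < LexExp.unit (i + 1) + b := lt_add_of_pos_left _ (LexExp.unit_pos _)
    rw [succHom_gen, rep_gen hq (by lia)]
    simp only [LinearMap.add_apply, Pi.add_apply, coeffMul_apply, consZero]
    exact ⟨fun a ha => by rw [hm a ha, hs a (ha.trans hb), mul_zero, add_zero],
      by rw [hs b hb, add_zero]⟩
  | add x y hx hy =>
    intro b m hm
    obtain ⟨h1, h2⟩ := hx b m hm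
    obtain ⟨h3, h4⟩ := hy b m hm
    simp only [map_add, LinearMap.add_apply, Pi.add_apply]
    exact ⟨fun a ha => by rw [h1 a ha, h3 a ha, add_zero], by rw [h2, h4, add_mul]⟩
  | mul x y hx hy =>
    intro b m hm
    obtain ⟨h3, h4⟩ := hy b m hm
    obtain ⟨h1, h2⟩ := hx b _ h3
    simp only [map_mul, Module.End.mul_apply]
    exact ⟨h1, by rw [h2, h4, mul_assoc]⟩

theorem exists_shifts_rep [NoZeroDivisors (UqMinus K q N)] (hq : q ^ 2 ≠ 0)
    (h2 : q ^ 2 + (q ^ 2)⁻¹ ≠ 0) (h4 : 1 - (q ^ 2) ^ 2 ≠ 0) {x : UqMinus K q (N + 1)}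
    (hx : x ≠ 0) : ∃ p, Shifts p (rep hq N x) := by
  refine (serreFamily_gen.exists_shifts hq h2 (rep hq N)
    (fun k hk => shifts_rep_rootVec hq h4 hk) (fun y hy hy0 => ?_) (Nat.zero_le _) x
    (mem_ladder_zero x) hx).imp fun _ h => h.2
  obtain ⟨u, rfl⟩ := ladder_le_range hy
  intro b m hm
  obtain ⟨h1, h2⟩ := rep_succHom_apply hq u b m hm
  rw [zero_add]
  refine ⟨h1, fun hb => ?_⟩
  change rep hq N (succHom K q N u) m b ≠ 0
  rw [h2]
  exact mul_ne_zero (fun h => hy0 (by simp [h])) hb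

theorem noZeroDivisors_succ (hq : q ^ 2 ≠ 0) (h2 : q ^ 2 + (q ^ 2)⁻¹ ≠ 0)
    (h4 : 1 - (q ^ 2) ^ 2 ≠ 0) (h : NoZeroDivisors (UqMinus K q N)) :
    NoZeroDivisors (UqMinus K q (N + 1)) where
  eq_zero_or_eq_zero_of_mul_eq_zero {x y} hxy := by
    by_contra! hn
    obtain ⟨p, hp⟩ := exists_shifts_rep hq h2 h4 hn.1
    obtain ⟨p', hp'⟩ := exists_shifts_rep hq h2 h4 hn.2
    refine (hp.mul hp').ne_zero ?_
    rw [← map_mul, hxy, map_zero]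

theorem algebraMap_surjective_zero :
    Function.Surjective (Algebra.ofId K (UqMinus K q 0)) :=
  surjective_of_gen_mem fun _ hi => absurd hi (Nat.not_lt_zero _)

theorem isNoetherianRing_and_noZeroDivisors (hq : q ^ 2 ≠ 0) (h2 : q ^ 2 + (q ^ 2)⁻¹ ≠ 0)
    (h4 : 1 - (q ^ 2) ^ 2 ≠ 0) (N : ℕ) :
    IsNoetherianRing (UqMinus K q N) ∧ NoZeroDivisors (UqMinus K q N) := by
  induction N with
  | zero =>
    refine ⟨isNoetherianRing_of_surjective K _ (Algebra.ofId K (UqMinus K q 0)).toRingHom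
      algebraMap_surjective_zero, ⟨fun {x y} hxy => ?_⟩⟩
    obtain ⟨a, rfl⟩ := algebraMap_surjective_zero x
    obtain ⟨b, rfl⟩ := algebraMap_surjective_zero y
    rw [← map_mul, map_eq_zero, mul_eq_zero] at hxy
    exact hxy.imp (fun h => by rw [h, map_zero]) fun h => by rw [h, map_zero]
  | succ N ih => exact ⟨isNoetherianRing_succ hq h2 ih.1, noZeroDivisors_succ hq h2 h4 ih.2⟩

theorem isNoetherian_mulOpposite [IsNoetherianRing (UqMinus K q N)] :
    IsNoetherian (UqMinus K q N)ᵐᵒᵖ (UqMinus K q N) := by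
  let φ : UqMinus K q N →ₐ[K] (UqMinus K q N)ᵐᵒᵖ := lift _ serreFamily_gen.op
  have hφ : Function.Surjective φ := by
    intro u
    obtain ⟨u, rfl⟩ := MulOpposite.op_surjective u
    change MulOpposite.op u ∈ φ.range
    induction u using UqMinus.induction with
    | algebraMap r => exact algebraMap_mem φ.range r
    | gen i hi => exact ⟨_, lift_gen _ _ hi⟩
    | add x y hx hy => exact add_mem hx hy
    | mul x y hx hy => exact mul_mem hy hx
  have : IsNoetherianRing (UqMinus K q N)ᵐᵒᵖ := isNoetherianRing_of_surjective _ _ φ.toRingHom hφ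
  let e : (UqMinus K q N)ᵐᵒᵖ ≃ₗ[(UqMinus K q N)ᵐᵒᵖ] UqMinus K q N :=
    { MulOpposite.opAddEquiv.symm with map_smul' := fun _ _ => rfl }
  exact isNoetherian_of_linearEquiv e

end UqMinus

end Generators

/-- If q^8 ≠ 1 then U_q^-(A_N) is a domain and is left and right Noetherian. -/
theorem uqMinus_domain_noetherian (K : Type) [Field K] (q : K) (hq0 : q ≠ 0)
    (hq8 : q ^ 8 ≠ 1) (N : ℕ) (hN : 1 ≤ N) :
    Nontrivial (UqMinus K q N) ∧
    (∀ f g : UqMinus K q N, f * g = 0 → f = 0 ∨ g = 0) ∧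
    (∀ c : ℕ →o Submodule (UqMinus K q N) (UqMinus K q N), ∃ n, ∀ m, n ≤ m → c n = c m) ∧
    (∀ c : ℕ →o Submodule (UqMinus K q N)ᵐᵒᵖ (UqMinus K q N),
      ∃ n, ∀ m, n ≤ m → c n = c m) := by
  have hq : q ^ 2 ≠ 0 := pow_ne_zero 2 hq0
  have h2 : q ^ 2 + (q ^ 2)⁻¹ ≠ 0 := fun h => hq8 <| by
    field_simp at h
    linear_combination (q ^ 4 - 1) * h
  have h4 : 1 - (q ^ 2) ^ 2 ≠ 0 := fun h => hq8 <| by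
    linear_combination -(1 + q ^ 4) * h
  obtain ⟨hnoeth, hdom⟩ := UqMinus.isNoetherianRing_and_noZeroDivisors hq h2 h4 N
  exact ⟨inferInstance, fun _ _ => mul_eq_zero.1, monotone_stabilizes_iff_noetherian.2 hnoeth,
    monotone_stabilizes_iff_noetherian.2 UqMinus.isNoetherian_mulOpposite⟩
end
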